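/- arXiv:1510.00238 — 4 statements merged into one kernel-verified Lean document; each statement's English description precedes it below -/
import Mathlib

section
/- Let 1 ≤ p < ∞ and let μ be Lebesgue measure on [0,1]. Let T : L_p(μ) → L_p(μ) (real scalars) be a surjective linear isometry which preserves the lattice operations, i.e. T(f ⊔ g) = (T f) ⊔ (T g) for all f, g ∈ L_p(μ). Then there exists a measure-class-preserving transformation ψ of μ such that T f = (d(ψ_*μ)/dμ)^{1/p} · (f ∘ ψ⁻¹) almost everywhere, for every f ∈ L_p(μ). -/
open MeasureTheory
open scoped ENNReal

/-- Lebesgue measure on the unit interval `[0,1]`. -/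
noncomputable def μ01 : Measure unitInterval :=
  Measure.comap Subtype.val volume

open Filter Topology

theorem aux_ae_subseq {μ : Measure unitInterval} {p : ℝ≥0∞} [Fact (1 ≤ p)]
    {f : ℕ → Lp ℝ p μ} {g : Lp ℝ p μ} (h : Tendsto f atTop (𝓝 g)) :
    ∃ ns : ℕ → ℕ, Tendsto ns atTop atTop ∧
      ∀ᵐ x ∂μ, Tendsto (fun i => f (ns i) x) atTop (𝓝 (g x)) := by
  obtain ⟨ns, h1, h2⟩ := (tendstoInMeasure_of_tendsto_Lp h).exists_seq_tendsto_ae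
  exact ⟨ns, h1.tendsto_atTop, h2⟩

theorem aux_one_pos {μ : Measure unitInterval} [IsFiniteMeasure μ] {p : ℝ≥0∞} [Fact (1 ≤ p)]
    (T : Lp ℝ p μ →ₗ[ℝ] Lp ℝ p μ)
    (hiso : ∀ f : Lp ℝ p μ, ‖T f‖ = ‖f‖)
    (hsurj : Function.Surjective T)
    (hsup : ∀ f g : Lp ℝ p μ, T (f ⊔ g) = T f ⊔ T g)
    (hinf : ∀ f g : Lp ℝ p μ, T (f ⊓ g) = T f ⊓ T g)
    (hmono : ∀ f g : Lp ℝ p μ, f ≤ g → T f ≤ T g) :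
    ∀ᵐ t ∂μ, 0 < (T (ContinuousMap.toLp p μ ℝ 1)) t := by
  set one : Lp ℝ p μ := ContinuousMap.toLp p μ ℝ 1 with hone
  have hone' : one =ᵐ[μ] fun _ => (1 : ℝ) := ContinuousMap.coeFn_toLp (𝕜 := ℝ) (p := p) μ (1 : C(unitInterval, ℝ))
  have h0 : 0 ≤ one := by
    rw [← Lp.coeFn_nonneg]
    filter_upwards [hone'] with t ht
    simp [ht]
  have hT0 : (0 : Lp ℝ p μ) ≤ T one := by simpa using hmono 0 one h0
  have hm : Measurable (T one) := (Lp.stronglyMeasurable _).measurable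
  have hA : MeasurableSet {t | (T one) t ≤ 0} := measurableSet_le hm measurable_const
  obtain ⟨f, hf⟩ := hsurj (indicatorConstLp p hA (measure_ne_top μ _) (1:ℝ))
  have hind : T f =ᵐ[μ] _ := hf ▸ indicatorConstLp_coeFn (p := p) (hs := hA) (hμs := measure_ne_top μ _) (c := (1:ℝ))
  have habs : T |f| = |T f| := by
    show T (f ⊔ -f) = T f ⊔ - T f
    rw [hsup, map_neg]
  have hz : T (|f| ⊓ one) = 0 := by
    rw [hinf, habs]
    apply Lp.ext
    filter_upwards [Lp.coeFn_inf |T f| (T one), Lp.coeFn_abs (T f), hind, Lp.coeFn_zero ℝ p μ,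
      (Lp.coeFn_nonneg _).2 hT0] with t h1 h2 h3 h4 h5
    rw [h1, h4, Pi.inf_apply, h2, h3]
    simp only [Pi.zero_apply] at h5 ⊢
    by_cases ht : (T one) t ≤ 0
    · have : (T one) t = 0 := le_antisymm ht h5
      simp [this]
    · simp [ht]; exact (not_le.1 ht).le
  have hz' : |f| ⊓ one = 0 := by
    rw [← norm_eq_zero, ← hiso, hz, norm_zero]
  have hf0 : f = 0 := by
    apply Lp.ext
    filter_upwards [Lp.coeFn_inf |f| one, Lp.coeFn_abs f, hone', Lp.coeFn_zero ℝ p μ] with t h1 h2 h3 h4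
    rw [hz', h4, Pi.inf_apply, h2, h3] at h1
    rw [h4]
    simp only [Pi.zero_apply] at *
    rcases le_total |f t| 1 with h | h
    · rw [inf_eq_left.2 h] at h1
      exact abs_eq_zero.1 h1.symm
    · rw [inf_eq_right.2 h] at h1
      norm_num at h1
  rw [hf0, map_zero] at hind
  filter_upwards [hind, Lp.coeFn_zero ℝ p μ] with t h1 h2
  rw [h2] at h1
  by_contra hc
  simp [not_lt.1 hc] at h1

theorem aux_cont {μ : Measure unitInterval} [IsFiniteMeasure μ] {p : ℝ≥0∞} [Fact (1 ≤ p)]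
    (T : Lp ℝ p μ →ₗ[ℝ] Lp ℝ p μ)
    (hcont : Continuous T)
    (hsup : ∀ f g : Lp ℝ p μ, T (f ⊔ g) = T f ⊔ T g)
    (hinf : ∀ f g : Lp ℝ p μ, T (f ⊓ g) = T f ⊓ T g)
    (h : unitInterval → ℝ) (φ : unitInterval → unitInterval) (hpos : ∀ t, 0 < h t)
    (h1 : T (ContinuousMap.toLp p μ ℝ 1) =ᵐ[μ] h)
    (h2 : T (ContinuousMap.toLp p μ ℝ ⟨Subtype.val, continuous_subtype_val⟩)
      =ᵐ[μ] fun t => h t * (φ t : ℝ)) (g : C(unitInterval, ℝ)) :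
    T (ContinuousMap.toLp p μ ℝ g) =ᵐ[μ] fun t => h t * g (φ t) := by
  set S : Set C(unitInterval, ℝ) :=
    {g | T (ContinuousMap.toLp p μ ℝ g) =ᵐ[μ] fun t => h t * g (φ t)} with hS
  have hco := fun g : C(unitInterval, ℝ) => ContinuousMap.coeFn_toLp (𝕜 := ℝ) (p := p) μ g
  have hcl : closure S = ⊤ := by
    apply ContinuousMap.sublattice_closure_eq_top
    · refine ⟨1, ?_⟩
      filter_upwards [h1] with t ht
      simp [ht]
    · intro f hf g hg
      have e : ContinuousMap.toLp p μ ℝ (f ⊓ g) =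
          ContinuousMap.toLp p μ ℝ f ⊓ ContinuousMap.toLp p μ ℝ g := by
        apply Lp.ext
        filter_upwards [hco f, hco g, hco (f ⊓ g), Lp.coeFn_inf (ContinuousMap.toLp p μ ℝ f)
          (ContinuousMap.toLp p μ ℝ g)] with t a b c d
        rw [c, d, Pi.inf_apply, a, b]; rfl
      show T _ =ᵐ[μ] _
      rw [e, hinf]
      filter_upwards [hf, hg, Lp.coeFn_inf (T (ContinuousMap.toLp p μ ℝ f))
          (T (ContinuousMap.toLp p μ ℝ g))] with t a b d
      rw [d, Pi.inf_apply, a, b, ContinuousMap.inf_apply]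
      exact (mul_min_of_nonneg _ _ (hpos t).le).symm
    · intro f hf g hg
      have e : ContinuousMap.toLp p μ ℝ (f ⊔ g) =
          ContinuousMap.toLp p μ ℝ f ⊔ ContinuousMap.toLp p μ ℝ g := by
        apply Lp.ext
        filter_upwards [hco f, hco g, hco (f ⊔ g), Lp.coeFn_sup (ContinuousMap.toLp p μ ℝ f)
          (ContinuousMap.toLp p μ ℝ g)] with t a b c d
        rw [c, d, Pi.sup_apply, a, b]; rfl
      show T _ =ᵐ[μ] _
      rw [e, hsup]
      filter_upwards [hf, hg, Lp.coeFn_sup (T (ContinuousMap.toLp p μ ℝ f))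
          (T (ContinuousMap.toLp p μ ℝ g))] with t a b d
      rw [d, Pi.sup_apply, a, b, ContinuousMap.sup_apply]
      exact (mul_max_of_nonneg _ _ (hpos t).le).symm
    · intro v x y
      have key : ∀ a b : ℝ, (a • (1 : C(unitInterval, ℝ)) +
          b • (⟨Subtype.val, continuous_subtype_val⟩ : C(unitInterval, ℝ))) ∈ S := by
        intro a b
        show T _ =ᵐ[μ] _
        simp only [map_add, map_smul]
        filter_upwards [h1, h2, Lp.coeFn_add (a • T (ContinuousMap.toLp p μ ℝ 1))
          (b • T (ContinuousMap.toLp p μ ℝ ⟨Subtype.val, continuous_subtype_val⟩)),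
          Lp.coeFn_smul a (T (ContinuousMap.toLp p μ ℝ 1)),
          Lp.coeFn_smul b (T (ContinuousMap.toLp p μ ℝ ⟨Subtype.val, continuous_subtype_val⟩))]
          with t e1 e2 e3 e4 e5
        rw [e3, Pi.add_apply, e4, e5, Pi.smul_apply, Pi.smul_apply, e1, e2]
        simp
        ring
      by_cases hxy : x = y
      · subst hxy
        exact ⟨_, key (v x) 0, by simp, by simp⟩
      · have hne : (y : ℝ) - x ≠ 0 := sub_ne_zero.2 (fun h => hxy (Subtype.ext h.symm))
        refine ⟨_, key (v x - (v y - v x) / (y - x) * x) ((v y - v x) / (y - x)), ?_, ?_⟩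
        · simp
        · simp
          field_simp
          ring
  have hg : g ∈ closure S := by rw [hcl]; trivial
  obtain ⟨u, huS, hu⟩ := mem_closure_iff_seq_limit.1 hg
  have hlim : Tendsto (fun n => T (ContinuousMap.toLp p μ ℝ (u n))) atTop
      (𝓝 (T (ContinuousMap.toLp p μ ℝ g))) :=
    ((hcont.comp (ContinuousMap.toLp p μ ℝ).continuous).tendsto g).comp hu
  obtain ⟨ns, hns, hae⟩ := aux_ae_subseq hlim
  filter_upwards [hae, ae_all_iff.2 huS] with t ht hs
  refine tendsto_nhds_unique ht ?_
  simp only [hs]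
  have hev : Continuous fun f : C(unitInterval, ℝ) => f (φ t) := by fun_prop
  exact ((hev.tendsto g).comp (hu.comp hns)).const_mul _

theorem aux_meas {μ : Measure unitInterval} [IsFiniteMeasure μ] {p : ℝ≥0∞} [Fact (1 ≤ p)]
    (hp : p ≠ ⊤) (T : Lp ℝ p μ →ₗ[ℝ] Lp ℝ p μ)
    (hiso : ∀ f : Lp ℝ p μ, ‖T f‖ = ‖f‖)
    (h : unitInterval → ℝ) (φ : unitInterval → unitInterval) (hm : Measurable h)
    (hφ : Measurable φ)
    (hT : ∀ g : C(unitInterval, ℝ), T (ContinuousMap.toLp p μ ℝ g) =ᵐ[μ] fun t => h t * g (φ t)) :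
    Measure.map φ (μ.withDensity (fun t => ‖h t‖ₑ ^ p.toReal)) = μ := by
  have hp0 : p ≠ 0 := (zero_lt_one.trans_le (Fact.out : 1 ≤ p)).ne'
  have hpr : 0 < p.toReal := ENNReal.toReal_pos hp0 hp
  symm
  have hmd : Measurable (fun t => ‖h t‖ₑ ^ p.toReal) := hm.enorm.pow_const _
  apply ext_of_forall_lintegral_eq_of_IsFiniteMeasure
  intro g
  rw [lintegral_map (by fun_prop) hφ, lintegral_withDensity_eq_lintegral_mul _ hmd (by fun_prop)]
  let f : C(unitInterval, ℝ) := ⟨fun t => ((g t : NNReal) : ℝ) ^ (1 / p.toReal), by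
    apply Continuous.rpow_const (by fun_prop)
    intro x; right; positivity⟩
  have e := hiso (ContinuousMap.toLp p μ ℝ f)
  rw [Lp.norm_def, Lp.norm_def, ENNReal.toReal_eq_toReal_iff' (Lp.eLpNorm_ne_top _) (Lp.eLpNorm_ne_top _),
    eLpNorm_congr_ae (hT f), eLpNorm_congr_ae (ContinuousMap.coeFn_toLp (𝕜 := ℝ) (p := p) μ f),
    eLpNorm_eq_lintegral_rpow_enorm_toReal hp0 hp, eLpNorm_eq_lintegral_rpow_enorm_toReal hp0 hp] at e
  have e' := ENNReal.rpow_left_injective (by positivity) e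
  have hf : ∀ t, ‖f t‖ₑ ^ p.toReal = g t := by
    intro t
    have : ‖f t‖ₑ = (g t : ℝ≥0∞) ^ (1 / p.toReal) := by
      show ‖((g t : NNReal) : ℝ) ^ (1 / p.toReal)‖ₑ = _
      rw [Real.enorm_of_nonneg (by positivity), ← ENNReal.ofReal_rpow_of_nonneg (by positivity) (by positivity)]
      simp
    rw [this, ← ENNReal.rpow_mul]
    field_simp
    simp
  simp only [enorm_mul, ENNReal.mul_rpow_of_nonneg _ _ hpr.le, hf] at e'
  exact e'.symm

theorem aux_repr {μ : Measure unitInterval} [IsFiniteMeasure μ] {p : ℝ≥0∞} [Fact (1 ≤ p)]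
    (hp : p ≠ ⊤) (T : Lp ℝ p μ →ₗ[ℝ] Lp ℝ p μ)
    (hiso : ∀ f : Lp ℝ p μ, ‖T f‖ = ‖f‖)
    (hsurj : Function.Surjective T)
    (hsup : ∀ f g : Lp ℝ p μ, T (f ⊔ g) = T f ⊔ T g) :
    ∃ (h : unitInterval → ℝ) (φ : unitInterval → unitInterval), Measurable h ∧ Measurable φ ∧
      (∀ t, 0 < h t) ∧ Measure.map φ (μ.withDensity (fun t => ‖h t‖ₑ ^ p.toReal)) = μ ∧
      Measure.QuasiMeasurePreserving φ μ μ ∧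
      ∀ f : Lp ℝ p μ, T f =ᵐ[μ] fun t => h t * f (φ t) := by
  have hinf : ∀ f g : Lp ℝ p μ, T (f ⊓ g) = T f ⊓ T g := by
    intro f g
    have e1 := congrArg T (inf_add_sup f g)
    have e2 := inf_add_sup (T f) (T g)
    rw [map_add, map_add, hsup, ← e2] at e1
    exact add_right_cancel e1
  have hmono : ∀ f g : Lp ℝ p μ, f ≤ g → T f ≤ T g := by
    intro f g hfg
    rw [← sup_eq_right, ← hsup, sup_eq_right.2 hfg]
  have hcont : Continuous T :=
    (AddMonoidHomClass.isometry_of_norm T hiso).continuous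
  have hpos := aux_one_pos T hiso hsurj hsup hinf hmono
  set h0 := T (ContinuousMap.toLp p μ ℝ 1) with hh0
  set i0 := T (ContinuousMap.toLp p μ ℝ ⟨Subtype.val, continuous_subtype_val⟩) with hi0
  have hm0 : Measurable h0 := (Lp.stronglyMeasurable _).measurable
  have hmi : Measurable i0 := (Lp.stronglyMeasurable _).measurable
  let h : unitInterval → ℝ := fun t => if 0 < h0 t then h0 t else 1
  let φ : unitInterval → unitInterval := fun t => Set.projIcc 0 1 zero_le_one (i0 t / h0 t)
  have hm : Measurable h := Measurable.ite (measurableSet_lt measurable_const hm0) hm0 measurable_const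
  have hφ : Measurable φ := continuous_projIcc.measurable.comp (hmi.div hm0)
  have hhpos : ∀ t, 0 < h t := by
    intro t
    by_cases ht : 0 < h0 t <;> simp [h, ht]
  have hco := fun g : C(unitInterval, ℝ) => ContinuousMap.coeFn_toLp (𝕜 := ℝ) (p := p) μ g
  have hi0n : (0 : Lp ℝ p μ) ≤ i0 := by
    rw [← map_zero T]
    apply hmono
    rw [← Lp.coeFn_nonneg]
    filter_upwards [hco ⟨Subtype.val, continuous_subtype_val⟩] with t ht
    rw [ht]
    exact t.2.1
  have hi0l : i0 ≤ h0 := by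
    apply hmono
    rw [← Lp.coeFn_le]
    filter_upwards [hco ⟨Subtype.val, continuous_subtype_val⟩, hco 1] with t ht ht1
    rw [ht, ht1]
    exact t.2.2
  have h1 : h0 =ᵐ[μ] h := by
    filter_upwards [hpos] with t ht
    simp [h, ht]
  have h2 : i0 =ᵐ[μ] fun t => h t * (φ t : ℝ) := by
    filter_upwards [hpos, h1, (Lp.coeFn_nonneg _).2 hi0n, (Lp.coeFn_le _ _).2 hi0l] with t a b c d
    have hmem : i0 t / h0 t ∈ Set.Icc (0:ℝ) 1 := ⟨div_nonneg c a.le, (div_le_one a).2 d⟩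
    have : (φ t : ℝ) = i0 t / h0 t := by
      simp only [φ]
      rw [Set.projIcc_of_mem zero_le_one hmem]
    rw [this, ← b]
    field_simp
  have hC := aux_cont T hcont hsup hinf h φ hhpos h1 h2
  have hmap := aux_meas hp T hiso h φ hm hφ hC
  have hq : Measure.QuasiMeasurePreserving φ μ μ := by
    refine ⟨hφ, ?_⟩
    conv_rhs => rw [← hmap]
    apply Measure.AbsolutelyContinuous.map _ hφ
    apply withDensity_absolutelyContinuous' (hm.enorm.pow_const _).aemeasurable
    refine Eventually.of_forall fun t => ?_
    have := (hhpos t).ne'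
    simp [this]
  refine ⟨h, φ, hm, hφ, hhpos, hmap, hq, ?_⟩
  intro f
  have hf := (ContinuousMap.toLp_denseRange ℝ μ ℝ hp) f
  obtain ⟨u, hu, hlim⟩ := mem_closure_iff_seq_limit.1 hf
  choose g hg using hu
  obtain ⟨ns, hns, hae⟩ := aux_ae_subseq hlim
  obtain ⟨ms, hms, hae'⟩ := aux_ae_subseq ((hcont.tendsto f).comp (hlim.comp hns))
  have hu' : ∀ n, T (u n) =ᵐ[μ] fun t => h t * u n (φ t) := by
    intro n
    rw [← hg n]
    filter_upwards [hC (g n), hq.ae (hco (g n))] with t a b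
    rw [a, b]
  filter_upwards [hae', hq.ae hae, ae_all_iff.2 hu'] with t a b c
  refine tendsto_nhds_unique a ?_
  simp only [Function.comp, c]
  exact (b.comp hms).const_mul _

theorem aux_volume_cantor : volume cantorSet = 0 := by
  have hfin : volume cantorSet ≠ ⊤ := isCompact_cantorSet.measure_lt_top.ne
  have h : ∀ c : ℝ, volume ((fun x : ℝ => (c + x) / 3) '' cantorSet) = ENNReal.ofReal (1/3) * volume cantorSet := by
    intro c
    have : (fun x : ℝ => (c + x) / 3) '' cantorSet = (fun x => (1/3 : ℝ) * x) '' ((fun x => c + x) '' cantorSet) := by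
      rw [Set.image_image]
      congr 1; ext x; ring
    rw [this]
    have e := Measure.addHaar_smul volume (1/3 : ℝ) ((fun x => c + x) '' cantorSet)
    rw [Module.finrank_self, pow_one, abs_of_pos (by norm_num), Set.image_add_left,
      measure_preimage_add] at e
    rw [Set.image_add_left, ← e]
    rfl
  have h1 : volume cantorSet ≤ ENNReal.ofReal (2/3) * volume cantorSet := by
    conv_lhs => rw [cantorSet_eq_union_halves]
    refine (measure_union_le _ _).trans ?_
    have := h 0
    simp only [zero_add] at this
    rw [this, h 2, ← two_mul, ← mul_assoc]
    gcongr
    rw [← ENNReal.ofReal_ofNat, ← ENNReal.ofReal_mul (by norm_num)]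
    norm_num
  have h2 := ENNReal.toReal_mono (by finiteness) h1
  rw [ENNReal.toReal_mul, ENNReal.toReal_ofReal (by norm_num)] at h2
  have h3 : (volume cantorSet).toReal = 0 := by
    have : 0 ≤ (volume cantorSet).toReal := ENNReal.toReal_nonneg
    linarith
  exact (ENNReal.toReal_eq_zero_iff _).1 h3 |>.resolve_right hfin

theorem aux_cantor_unc : ¬ Countable cantorSet := by
  rw [cantorSetEquivNatToBool.countable_iff]
  intro h
  have := Cardinal.mk_le_aleph0_iff.2 h
  simp only [Cardinal.mk_pi, Cardinal.prod_const, Cardinal.mk_bool, Cardinal.mk_nat] at this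
  simp at this
  exact absurd this (not_le.2 Cardinal.aleph0_lt_continuum)

theorem aux_null : ∃ C : Set unitInterval, MeasurableSet C ∧
    (Measure.comap Subtype.val volume : Measure unitInterval) C = 0 ∧ ¬ C.Countable := by
  refine ⟨Subtype.val ⁻¹' cantorSet, isClosed_cantorSet.measurableSet.preimage measurable_subtype_coe, ?_, ?_⟩
  · rw [comap_subtype_coe_apply measurableSet_Icc]
    exact measure_mono_null (Set.image_preimage_subset _ _) aux_volume_cantor
  · intro hc
    apply aux_cantor_unc
    have := hc.image Subtype.val
    rw [Subtype.image_preimage_coe, Set.inter_eq_right.2 cantorSet_subset_unitInterval] at this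
    exact this

theorem aux_equiv {μ : Measure unitInterval} {C : Set unitInterval} (hC : MeasurableSet C)
    (hC0 : μ C = 0) (hCu : ¬ C.Countable) {φ θ : unitInterval → unitInterval}
    (hφ : Measure.QuasiMeasurePreserving φ μ μ) (hθ : Measure.QuasiMeasurePreserving θ μ μ)
    (h1 : ∀ᵐ t ∂μ, θ (φ t) = t) (h2 : ∀ᵐ t ∂μ, φ (θ t) = t) :
    ∃ ψ : unitInterval ≃ᵐ unitInterval, ψ =ᵐ[μ] θ ∧ ψ.symm =ᵐ[μ] φ := by
  classical
  have mφ := hφ.measurable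
  have mθ := hθ.measurable
  let A : Set unitInterval := {x | θ (φ x) = x} ∩ (Cᶜ ∩ φ ⁻¹' Cᶜ)
  let B : Set unitInterval := {x | φ (θ x) = x} ∩ (Cᶜ ∩ θ ⁻¹' Cᶜ)
  have hA : MeasurableSet A := (measurableSet_eq_fun (mθ.comp mφ) measurable_id).inter
    (hC.compl.inter (mφ hC.compl))
  have hB : MeasurableSet B := (measurableSet_eq_fun (mφ.comp mθ) measurable_id).inter
    (hC.compl.inter (mθ hC.compl))
  have hCae : ∀ᵐ t ∂μ, t ∈ Cᶜ := by
    rw [ae_iff]; simpa using hC0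
  have hAae : ∀ᵐ t ∂μ, t ∈ A := by
    filter_upwards [h1, hCae, hφ.ae hCae] with t a b c using ⟨a, b, c⟩
  have hBae : ∀ᵐ t ∂μ, t ∈ B := by
    filter_upwards [h2, hCae, hθ.ae hCae] with t a b c using ⟨a, b, c⟩
  have hφA : ∀ x ∈ A, φ x ∈ B := by
    rintro x ⟨a, b, c⟩
    refine ⟨?_, c, ?_⟩
    · show φ (θ (φ x)) = φ x
      rw [show θ (φ x) = x from a]
    · show θ (φ x) ∈ Cᶜ
      rwa [show θ (φ x) = x from a]
  have hθB : ∀ x ∈ B, θ x ∈ A := by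
    rintro x ⟨a, b, c⟩
    refine ⟨?_, c, ?_⟩
    · show θ (φ (θ x)) = θ x
      rw [show φ (θ x) = x from a]
    · show φ (θ x) ∈ Cᶜ
      rwa [show φ (θ x) = x from a]
  let e : B ≃ᵐ A :=
    { toFun := fun x => ⟨θ x, hθB x x.2⟩
      invFun := fun x => ⟨φ x, hφA x x.2⟩
      left_inv := fun x => Subtype.ext x.2.1
      right_inv := fun x => Subtype.ext x.2.1
      measurable_toFun := (mθ.comp measurable_subtype_coe).subtype_mk
      measurable_invFun := (mφ.comp measurable_subtype_coe).subtype_mk }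
  have hAu : ¬ Countable (Aᶜ : Set unitInterval) := fun h =>
    hCu (Set.Countable.mono (fun x hx (hxA : x ∈ A) => hxA.2.1 hx) (Set.countable_coe_iff.1 h))
  have hBu : ¬ Countable (Bᶜ : Set unitInterval) := fun h =>
    hCu (Set.Countable.mono (fun x hx (hxA : x ∈ B) => hxA.2.1 hx) (Set.countable_coe_iff.1 h))
  have := hA.compl.standardBorel
  have := hB.compl.standardBorel
  let ψ : unitInterval ≃ᵐ unitInterval := (MeasurableEquiv.sumCompl hB).symm.trans
    ((MeasurableEquiv.sumCongr e (PolishSpace.measurableEquivOfNotCountable hBu hAu)).trans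
      (MeasurableEquiv.sumCompl hA))
  have hψ : ∀ x ∈ B, ψ x = θ x := by
    intro x hx
    have : (MeasurableEquiv.sumCompl hB).symm x = Sum.inl ⟨x, hx⟩ := by
      rw [MeasurableEquiv.symm_apply_eq]; rfl
    show (MeasurableEquiv.sumCompl hA) ((MeasurableEquiv.sumCongr e _) ((MeasurableEquiv.sumCompl hB).symm x)) = _
    rw [this]; rfl
  refine ⟨ψ, ?_, ?_⟩
  · filter_upwards [hBae] with x hx using hψ x hx
  · filter_upwards [hAae] with x hx
    rw [MeasurableEquiv.symm_apply_eq, hψ _ (hφA x hx)]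
    exact hx.1.symm

theorem aux_comp {μ : Measure unitInterval} [IsFiniteMeasure μ] {p : ℝ≥0∞} [Fact (1 ≤ p)]
    {h k : unitInterval → ℝ} {φ θ : unitInterval → unitInterval}
    (hq : Measure.QuasiMeasurePreserving φ μ μ) (kq : Measure.QuasiMeasurePreserving θ μ μ)
    (H : ∀ f : Lp ℝ p μ, f =ᵐ[μ] fun t => h t * (k (φ t) * f (θ (φ t)))) :
    ∀ᵐ t ∂μ, θ (φ t) = t := by
  have hco := fun g : C(unitInterval, ℝ) => ContinuousMap.coeFn_toLp (𝕜 := ℝ) (p := p) μ g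
  have hco' := fun g => hq.ae (kq.ae (hco g))
  filter_upwards [H (ContinuousMap.toLp p μ ℝ 1),
    H (ContinuousMap.toLp p μ ℝ ⟨Subtype.val, continuous_subtype_val⟩),
    hco 1, hco ⟨Subtype.val, continuous_subtype_val⟩,
    hco' 1, hco' ⟨Subtype.val, continuous_subtype_val⟩] with t a b c d e f
  rw [c, e] at a
  rw [d, f] at b
  simp only [ContinuousMap.one_apply, ContinuousMap.coe_mk, mul_one] at a b
  rw [← mul_assoc, ← a, one_mul] at b
  exact Subtype.ext b.symm

/-- Every surjective linear isometry of `L_p([0,1])` (`1 ≤ p < ∞`, real scalars)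
preserving the lattice operations is induced by a measure-class-preserving
transformation `ψ` of Lebesgue measure, via `T f = (d(ψ_*μ)/dμ)^{1/p} · (f ∘ ψ⁻¹)`. -/
theorem stmt_0 (p : ℝ≥0∞) (hp1 : 1 ≤ p) (hp : p ≠ ⊤)
    (T : Lp ℝ p μ01 →ₗ[ℝ] Lp ℝ p μ01)
    (hiso : ∀ f : Lp ℝ p μ01, ‖T f‖ = ‖f‖)
    (hsurj : Function.Surjective T)
    (hlat : ∀ f g : Lp ℝ p μ01, T (f ⊔ g) = T f ⊔ T g) :
    ∃ ψ : unitInterval ≃ᵐ unitInterval,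
      Measure.map ψ μ01 ≪ μ01 ∧ μ01 ≪ Measure.map ψ μ01 ∧
      ∀ f : Lp ℝ p μ01,
        (T f : unitInterval → ℝ) =ᵐ[μ01]
          fun t => ((Measure.map ψ μ01).rnDeriv μ01 t).toReal ^ (1 / p.toReal)
            * f (ψ.symm t) := by
  haveI : Fact (1 ≤ p) := ⟨hp1⟩
  haveI : IsFiniteMeasure μ01 := inferInstanceAs (IsFiniteMeasure (volume : Measure unitInterval))
  have hinj : Function.Injective T := by
    rw [injective_iff_map_eq_zero]
    intro f hf
    rw [← norm_eq_zero, ← hiso, hf, norm_zero]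
  let E := LinearEquiv.ofBijective T ⟨hinj, hsurj⟩
  have hTS : ∀ f, T (E.symm f) = f := fun f => E.apply_symm_apply f
  have hST : ∀ f, E.symm (T f) = f := fun f => E.symm_apply_apply f
  obtain ⟨h, φ, hm, hφ, hpos, hmap, hq, hT⟩ := aux_repr hp T hiso hsurj hlat
  obtain ⟨k, θ, km, hθ, kpos, kmap, kq, hS⟩ := aux_repr hp (E.symm : Lp ℝ p μ01 →ₗ[ℝ] Lp ℝ p μ01)
    (fun f => by
      have := hiso (E.symm f)
      rw [hTS] at this
      exact this.symm)
    E.symm.surjective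
    (fun f g => by
      apply hinj
      show T (E.symm (f ⊔ g)) = T (E.symm f ⊔ E.symm g)
      rw [hlat, hTS, hTS, hTS])
  have hco := fun g : C(unitInterval, ℝ) => ContinuousMap.coeFn_toLp (𝕜 := ℝ) (p := p) μ01 g
  have hθφ : ∀ᵐ t ∂μ01, θ (φ t) = t :=
    aux_comp hq kq (fun f => by
      have e := hT (E.symm f)
      rw [hTS] at e
      filter_upwards [e, hq.ae (hS f)] with t a b
      rw [a]
      exact congrArg _ b)
  have hφθ : ∀ᵐ t ∂μ01, φ (θ t) = t :=
    aux_comp kq hq (fun f => by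
      have e := hS (T f)
      have e0 : (E.symm : Lp ℝ p μ01 →ₗ[ℝ] Lp ℝ p μ01) (T f) = f := hST f
      rw [e0] at e
      filter_upwards [e, kq.ae (hT f)] with t a b
      rw [a]
      exact congrArg _ b)
  obtain ⟨C, hC, hC0, hCu⟩ := aux_null
  obtain ⟨ψ, h1, h2⟩ := aux_equiv (μ := μ01) hC hC0 hCu hq kq hθφ hφθ
  have hmd : Measurable (fun t => ‖h t‖ₑ ^ p.toReal) := hm.enorm.pow_const _
  have hψ : Measure.map ψ μ01 = μ01.withDensity (fun t => ‖h t‖ₑ ^ p.toReal) := by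
    rw [Measure.map_congr h1]
    conv_lhs => rw [← hmap]
    rw [Measure.map_map hθ hφ]
    have : θ ∘ φ =ᵐ[μ01.withDensity (fun t => ‖h t‖ₑ ^ p.toReal)] id :=
      (withDensity_absolutelyContinuous μ01 _).ae_le hθφ
    rw [Measure.map_congr this, Measure.map_id]
  refine ⟨ψ, ?_, ?_, ?_⟩
  · rw [hψ]; exact withDensity_absolutelyContinuous _ _
  · rw [hψ]
    apply withDensity_absolutelyContinuous' hmd.aemeasurable
    refine Eventually.of_forall fun t => ?_
    have := (hpos t).ne'
    simp [this]
  · intro f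
    rw [hψ]
    filter_upwards [hT f, Measure.rnDeriv_withDensity μ01 hmd, h2] with t a b c
    have hp0 : p ≠ 0 := (zero_lt_one.trans_le hp1).ne'
    have hpr : 0 < p.toReal := ENNReal.toReal_pos hp0 hp
    rw [a, b, c, ← ENNReal.toReal_rpow, toReal_enorm, Real.norm_of_nonneg (hpos t).le,
      ← Real.rpow_mul (hpos t).le, mul_one_div_cancel hpr.ne', Real.rpow_one]
end

section
/- Let G be the group of all surjective linear isometries T of the real Banach space L²([0,1], Lebesgue) which preserve the lattice operations (T(f ⊔ g) = (T f) ⊔ (T g) for all f, g), equipped with the strong operator topology (the topology of pointwise convergence on L²). If G acts on a nonempty complete metric space X by isometries, with jointly continuous action, and the action is transitive (for all x, y ∈ X there is g ∈ G with g·x = y), then X consists of a single point. -/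
open MeasureTheory
open scoped ENNReal

/-- The real Hilbert lattice `L²([0,1], Lebesgue)`. -/
noncomputable abbrev H2 : Type := Lp ℝ 2 μ01

/-- The group `Aut*(μ)` realised as the group of surjective linear isometries of
`L²([0,1])` preserving the lattice operations. -/
def G2 : Type :=
  {T : H2 ≃ₗᵢ[ℝ] H2 // ∀ f g : H2, T (f ⊔ g) = T f ⊔ T g}

/-- The strong operator topology (pointwise convergence on `L²`) on `G2`. -/
noncomputable instance : TopologicalSpace G2 :=
  TopologicalSpace.induced (fun T : G2 => (⇑T.1 : H2 → H2)) Pi.topologicalSpace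

/-- Composition in `G2`: `(G2mul S T) f = S (T f)`. -/
noncomputable def G2mul (S T : G2) : G2 :=
  ⟨T.1.trans S.1, fun f g => by
    simp only [LinearIsometryEquiv.trans_apply]
    rw [T.2, S.2]⟩

/-- The identity element of `G2`. -/
noncomputable def G2one : G2 :=
  ⟨LinearIsometryEquiv.refl ℝ H2, fun _ _ => rfl⟩


theorem mu_eq : μ01 = (volume : Measure unitInterval) := rfl

instance : IsProbabilityMeasure μ01 := by rw [mu_eq]; infer_instance
instance : NullSingletonClass μ01 := by rw [mu_eq]; infer_instance

/-- multiplication by an indicator function, as a function -/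
noncomputable def Pfun (A : Set unitInterval) (hA : MeasurableSet A) (f : H2) : H2 :=
  MemLp.toLp (A.indicator f) ((Lp.memLp f).indicator hA)

theorem Pfun_coe (A : Set unitInterval) (hA : MeasurableSet A) (f : H2) :
    (Pfun A hA f : H2) =ᵐ[μ01] A.indicator f := MemLp.coeFn_toLp _

theorem Pfun_add (A : Set unitInterval) (hA : MeasurableSet A) (f g : H2) :
    Pfun A hA (f + g) = Pfun A hA f + Pfun A hA g := by
  apply Lp.ext
  filter_upwards [Pfun_coe A hA (f + g), Pfun_coe A hA f, Pfun_coe A hA g,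
    Lp.coeFn_add f g, Lp.coeFn_add (Pfun A hA f) (Pfun A hA g)] with x h1 h2 h3 h4 h5
  rw [h1, h5, Pi.add_apply, h2, h3]
  by_cases hx : x ∈ A
  · simpa [hx] using h4
  · simp [hx]

theorem Pfun_smul (A : Set unitInterval) (hA : MeasurableSet A) (c : ℝ) (f : H2) :
    Pfun A hA (c • f) = c • Pfun A hA f := by
  apply Lp.ext
  filter_upwards [Pfun_coe A hA (c • f), Pfun_coe A hA f,
    Lp.coeFn_smul c f, Lp.coeFn_smul c (Pfun A hA f)] with x h1 h2 h3 h4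
  rw [h1, h4, Pi.smul_apply, h2]
  by_cases hx : x ∈ A <;> simp [hx, h3]

/-- multiplication by an indicator function, as a linear map -/
noncomputable def Plin (A : Set unitInterval) (hA : MeasurableSet A) : H2 →ₗ[ℝ] H2 where
  toFun := Pfun A hA
  map_add' := Pfun_add A hA
  map_smul' := Pfun_smul A hA

theorem Plin_norm (A : Set unitInterval) (hA : MeasurableSet A) (f : H2) :
    ‖Plin A hA f‖ ≤ 1 * ‖f‖ := by
  rw [one_mul]
  apply Lp.norm_le_norm_of_ae_le
  filter_upwards [Pfun_coe A hA f] with x h1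
  change ‖(Pfun A hA f) x‖ ≤ _
  rw [h1]
  by_cases hx : x ∈ A <;> simp [hx]

open Classical in
/-- multiplication by an indicator function, as a continuous linear map -/
noncomputable def P (A : Set unitInterval) : H2 →L[ℝ] H2 :=
  if hA : MeasurableSet A then (Plin A hA).mkContinuous 1 (Plin_norm A hA) else 0

theorem P_coe {A : Set unitInterval} (hA : MeasurableSet A) (f : H2) :
    (P A f : H2) =ᵐ[μ01] A.indicator f := by
  have : P A f = Pfun A hA f := by
    simp only [P, hA, dif_pos]; rfl
  rw [this]
  exact Pfun_coe A hA f

theorem P_congr {A B : Set unitInterval} (hA : MeasurableSet A) (hB : MeasurableSet B)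
    (h : A =ᵐ[μ01] B) : P A = P B := by
  ext1 f
  apply Lp.ext
  filter_upwards [P_coe hA f, P_coe hB f, h.mem_iff] with x h1 h2 h3
  rw [h1, h2]
  by_cases hx : x ∈ A
  · simp [hx, h3.1 hx]
  · have hy : x ∉ B := fun h => hx (h3.2 h)
    simp [hx, hy]

theorem P_mul {A B : Set unitInterval} (hA : MeasurableSet A) (hB : MeasurableSet B) :
    P A * P B = P (A ∩ B) := by
  ext1 f
  apply Lp.ext
  filter_upwards [P_coe hA (P B f), P_coe hB f, P_coe (hA.inter hB) f] with x h1 h2 h3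
  rw [mul_apply_eq_comp, h1, h3]
  by_cases hx : x ∈ A <;> by_cases hy : x ∈ B <;> simp [hx, hy, h2]

theorem P_compl {A : Set unitInterval} (hA : MeasurableSet A) : P Aᶜ = 1 - P A := by
  ext1 f
  apply Lp.ext
  filter_upwards [P_coe hA f, P_coe hA.compl f, Lp.coeFn_sub f (P A f)] with x h1 h2 h3
  rw [sub_apply, one_apply_eq_self, h2, h3, Pi.sub_apply, h1]
  by_cases hx : x ∈ A <;> simp [hx]

theorem P_univ : P Set.univ = 1 := by
  ext1 f
  apply Lp.ext
  filter_upwards [P_coe MeasurableSet.univ f] with x h1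
  rw [h1]; simp

theorem P_empty : P ∅ = 0 := by
  have := P_compl MeasurableSet.univ
  rw [P_univ] at this; simpa using this

theorem P_union {A B : Set unitInterval} (hA : MeasurableSet A) (hB : MeasurableSet B)
    (h : Disjoint A B) : P (A ∪ B) = P A + P B := by
  have e : A ∪ B = (Aᶜ ∩ Bᶜ)ᶜ := by ext; simp; tauto
  rw [e, P_compl (hA.compl.inter hB.compl), ← P_mul hA.compl hB.compl, P_compl hA, P_compl hB]
  have : P A * P B = 0 := by rw [P_mul hA hB, h.inter_eq, P_empty]
  simp only [sub_mul, mul_sub, one_mul, mul_one, this]; abel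

/-- the constant function one -/
noncomputable def one2 : H2 := indicatorConstLp 2 MeasurableSet.univ (measure_ne_top μ01 _) (1 : ℝ)

theorem one2_coe : (one2 : H2) =ᵐ[μ01] fun _ => (1 : ℝ) := by
  filter_upwards [indicatorConstLp_coeFn (p := 2) (hs := MeasurableSet.univ)
    (hμs := measure_ne_top μ01 _) (c := (1 : ℝ))] with x hx
  rw [one2, hx]; simp

theorem P_eq_zero {A : Set unitInterval} (hA : MeasurableSet A) : P A = 0 ↔ μ01 A = 0 := by
  constructor
  · intro h
    have h1 : P A one2 = 0 := by rw [h]; rfl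
    have h2 := P_coe hA one2
    rw [h1] at h2
    rw [measure_eq_zero_iff_ae_notMem]
    filter_upwards [h2, one2_coe, Lp.coeFn_zero ℝ 2 μ01] with x h2 h3 h4 hx
    rw [h4] at h2; simp [hx, h3] at h2
  · intro h
    rw [← P_empty]
    exact P_congr hA MeasurableSet.empty (ae_eq_empty.2 h)

theorem P_nonneg {A : Set unitInterval} (hA : MeasurableSet A) (f : H2) (hf : 0 ≤ f) :
    0 ≤ P A f := by
  rw [← Lp.coeFn_nonneg] at *
  filter_upwards [hf, P_coe hA f] with x h1 h2
  rw [h2]; by_cases hx : x ∈ A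
  · simpa [hx] using h1
  · simp [hx]

theorem inner_eq (f g : H2) : inner ℝ f g = ∫ x, f x * g x ∂μ01 := by
  rw [L2.inner_def]
  congr 1; ext x; simp [mul_comm]

theorem P_star {A : Set unitInterval} (hA : MeasurableSet A) : star (P A) = P A := by
  symm
  rw [ContinuousLinearMap.star_eq_adjoint, ContinuousLinearMap.eq_adjoint_iff]
  intro f g
  rw [inner_eq, inner_eq]
  apply integral_congr_ae
  filter_upwards [P_coe hA f, P_coe hA g] with x h1 h2
  rw [h1, h2]; by_cases hx : x ∈ A <;> simp [hx]

theorem inner_nonneg {f g : H2} (hf : 0 ≤ f) (hg : 0 ≤ g) : 0 ≤ inner ℝ f g := by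
  rw [inner_eq]
  apply integral_nonneg_of_ae
  filter_upwards [(Lp.coeFn_nonneg f).2 hf, (Lp.coeFn_nonneg g).2 hg] with x h1 h2
  exact mul_nonneg h1 h2

theorem nonneg_of_inner {f : H2} (h : ∀ g : H2, 0 ≤ g → 0 ≤ inner ℝ f g) : 0 ≤ f := by
  -- test with the negative part
  have h1 := h f⁻ (negPart_nonneg f)
  rw [inner_eq] at h1
  have h2 : ∀ᵐ x ∂μ01, f x * (f⁻ : H2) x = - ((f⁻ : H2) x * (f⁻ : H2) x) := by
    have e : f⁻ = (-f) ⊔ 0 := rfl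
    rw [e]
    filter_upwards [Lp.coeFn_sup (-f) 0, Lp.coeFn_neg f, Lp.coeFn_zero ℝ 2 μ01] with x h1 h2 h3
    rw [h1, Pi.sup_apply, h2, h3, Pi.neg_apply]
    simp only [Pi.zero_apply]
    rcases le_total 0 (f x) with h | h
    · rw [sup_eq_right.2 (by linarith)]; simp
    · rw [sup_eq_left.2 (by linarith)]; ring
  rw [integral_congr_ae h2, integral_neg, ← inner_eq] at h1
  have h3 : inner ℝ (f⁻ : H2) (f⁻ : H2) = (0 : ℝ) :=
    le_antisymm (by linarith) real_inner_self_nonneg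
  rw [inner_self_eq_zero] at h3
  exact negPart_eq_zero.1 h3


/-- inverse in `G2` -/
noncomputable def G2inv (T : G2) : G2 :=
  ⟨T.1.symm, fun f g => by
    apply T.1.injective
    rw [T.2]; simp⟩

noncomputable instance : Group G2 where
  mul := G2mul
  one := G2one
  inv := G2inv
  mul_assoc _ _ _ := rfl
  one_mul _ := rfl
  mul_one _ := rfl
  inv_mul_cancel T := by
    apply Subtype.ext
    apply LinearIsometryEquiv.ext
    intro f
    exact T.1.symm_apply_apply f

/-- underlying operator -/
noncomputable def op (T : G2) : H2 →L[ℝ] H2 := (T.1.toContinuousLinearEquiv : H2 →L[ℝ] H2)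

theorem op_apply (T : G2) (f : H2) : op T f = T.1 f := rfl
theorem op_mul (S T : G2) : op (S * T) = op S * op T := rfl
theorem op_one : op 1 = 1 := rfl
theorem op_inj {S T : G2} (h : op S = op T) : S = T := by
  apply Subtype.ext
  apply LinearIsometryEquiv.ext
  intro f
  exact congrArg (fun U : H2 →L[ℝ] H2 => U f) h

theorem op_inv_mul (T : G2) : op T⁻¹ * op T = 1 := by rw [← op_mul, inv_mul_cancel, op_one]
theorem op_mul_inv (T : G2) : op T * op T⁻¹ = 1 := by rw [← op_mul, mul_inv_cancel, op_one]

theorem op_star (T : G2) : star (op T) = op T⁻¹ := by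
  symm
  rw [ContinuousLinearMap.star_eq_adjoint, ContinuousLinearMap.eq_adjoint_iff]
  intro f g
  rw [← LinearIsometryEquiv.inner_map_map T.1 (op T⁻¹ f) g, ← op_apply, ← op_apply]
  have : op T (op T⁻¹ f) = f := by
    rw [← mul_apply_eq_comp, op_mul_inv]; rfl
  rw [this]

theorem op_nonneg (T : G2) (f : H2) (hf : 0 ≤ f) : 0 ≤ op T f := by
  have h := T.2 f 0
  rw [sup_eq_left.2 hf, map_zero] at h
  rw [op_apply, h]; exact le_sup_right

/-- positive partial isometries with initial projection `p` and final projection `q` -/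
structure PIso (p q W : H2 →L[ℝ] H2) : Prop where
  pos : ∀ f : H2, 0 ≤ f → 0 ≤ W f
  ini : star W * W = p
  fin : W * star W = q
  tri : W * star W * W = W

theorem star_pos {W : H2 →L[ℝ] H2} (h : ∀ f : H2, 0 ≤ f → 0 ≤ W f) (f : H2) (hf : 0 ≤ f) :
    0 ≤ (star W) f := by
  apply nonneg_of_inner
  intro g hg
  rw [ContinuousLinearMap.star_eq_adjoint, ContinuousLinearMap.adjoint_inner_left]
  exact inner_nonneg hf (h g hg)

theorem PIso.symm {p q W : H2 →L[ℝ] H2} (h : PIso p q W) : PIso q p (star W) where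
  pos := star_pos h.pos
  ini := by rw [star_star]; exact h.fin
  fin := by rw [star_star]; exact h.ini
  tri := by
    have := congrArg star h.tri
    simpa [mul_assoc] using this

theorem PIso.mul_ini {p q W : H2 →L[ℝ] H2} (h : PIso p q W) : W * p = W := by
  rw [← h.ini, ← mul_assoc, h.tri]

theorem PIso.fin_mul {p q W : H2 →L[ℝ] H2} (h : PIso p q W) : q * W = W := by
  rw [← h.fin, h.tri]

theorem PIso.comp {p q r W V : H2 →L[ℝ] H2} (h : PIso p q W) (k : PIso q r V) :
    PIso p r (V * W) where
  pos f hf := k.pos _ (h.pos f hf)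
  ini := by
    rw [star_mul]
    calc star W * star V * (V * W) = star W * ((star V * V) * W) := by noncomm_ring
      _ = p := by rw [k.ini, h.fin_mul, h.ini]
  fin := by
    rw [star_mul]
    calc V * W * (star W * star V) = V * (W * star W) * star V := by noncomm_ring
      _ = r := by rw [h.fin, k.mul_ini, k.fin]
  tri := by
    rw [star_mul]
    calc V * W * (star W * star V) * (V * W) = V * (W * star W) * ((star V * V) * W) := by
          noncomm_ring
      _ = V * W := by rw [h.fin, k.mul_ini, k.ini, h.fin_mul]

theorem PIso.add {p q W p' q' W' : H2 →L[ℝ] H2} (h : PIso p q W) (h' : PIso p' q' W')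
    (hp : p * p' = 0) (hq : q * q' = 0) : PIso (p + p') (q + q') (W + W') := by
  have sp : star p = p := by rw [← h.ini]; simp
  have sq : star q = q := by rw [← h.fin]; simp
  have e1 : star W * W' = 0 := by
    rw [← h.fin_mul, ← h'.fin_mul, star_mul, sq]
    calc star W * q * (q' * W') = star W * (q * q') * W' := by noncomm_ring
      _ = 0 := by rw [hq]; simp
  have e2 : star W' * W = 0 := by
    have := congrArg star e1; simpa using this
  have e3 : W * star W' = 0 := by
    have s' : star p' = p' := by rw [← h'.ini]; simp
    rw [← h.mul_ini, ← h'.mul_ini, star_mul, s']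
    calc W * p * (p' * star W') = W * (p * p') * star W' := by noncomm_ring
      _ = 0 := by rw [hp]; simp
  have e4 : W' * star W = 0 := by
    have := congrArg star e3; simpa using this
  have f1 : (W + W') * star (W + W') = q + q' := by
    rw [star_add, add_mul, mul_add, mul_add, e3, e4, h.fin, h'.fin]; abel
  refine ⟨fun f hf => add_nonneg (h.pos f hf) (h'.pos f hf), ?_, f1, ?_⟩
  · rw [star_add, add_mul, mul_add, mul_add, e1, e2, h.ini, h'.ini]; abel
  · rw [f1, add_mul, mul_add, mul_add, h.fin_mul, h'.fin_mul]
    have e5 : q * W' = 0 := by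
      rw [← h'.fin_mul, ← mul_assoc, hq, zero_mul]
    have e6 : q' * W = 0 := by
      rw [← h'.fin, mul_assoc, e2, mul_zero]
    rw [e5, e6]; abel

theorem exists_op {W : H2 →L[ℝ] H2} (h : PIso 1 1 W) : ∃ T : G2, op T = W := by
  have h1 : ∀ f, (star W) (W f) = f := fun f => by
    rw [← mul_apply_eq_comp, h.ini]; rfl
  have h2 : ∀ f, W ((star W) f) = f := fun f => by
    rw [← mul_apply_eq_comp, h.fin]; rfl
  let L : H2 ≃ₗ[ℝ] H2 :=
    LinearEquiv.ofLinearMap (W : H2 →ₗ[ℝ] H2) ((star W : H2 →L[ℝ] H2) : H2 →ₗ[ℝ] H2)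
      (LinearMap.ext h2) (LinearMap.ext h1)
  have hL : ∀ f, L f = W f := fun f => rfl
  let E : H2 ≃ₗᵢ[ℝ] H2 := ⟨L, fun f => by
    rw [hL]
    have : inner ℝ (W f) (W f) = inner ℝ f f := by
      rw [← ContinuousLinearMap.adjoint_inner_left, ← ContinuousLinearMap.star_eq_adjoint, h1]
    rw [real_inner_self_eq_norm_sq, real_inner_self_eq_norm_sq] at this
    exact (sq_eq_sq₀ (norm_nonneg _) (norm_nonneg _)).1 this⟩
  have mono : ∀ {f g : H2}, f ≤ g → W f ≤ W g := fun {f g} hfg => by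
    have := h.pos (g - f) (sub_nonneg.2 hfg)
    rw [map_sub] at this; exact sub_nonneg.1 this
  have mono' : ∀ {f g : H2}, f ≤ g → (star W) f ≤ (star W) g := fun {f g} hfg => by
    have := h.symm.pos (g - f) (sub_nonneg.2 hfg)
    rw [map_sub] at this; exact sub_nonneg.1 this
  refine ⟨⟨E, fun f g => ?_⟩, rfl⟩
  change W (f ⊔ g) = W f ⊔ W g
  apply le_antisymm
  · rw [← h2 (W f ⊔ W g)]
    apply mono
    apply sup_le
    · conv_lhs => rw [← h1 f]
      exact mono' le_sup_left
    · conv_lhs => rw [← h1 g]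
      exact mono' le_sup_right
  · exact sup_le (mono le_sup_left) (mono le_sup_right)

/-- `T` acts trivially outside `A` -/
def Aut (A : Set unitInterval) (T : G2) : Prop := op T * P Aᶜ = P Aᶜ

/-- `T` maps the band of `A` onto the band of `B` -/
def Maps (T : G2) (A B : Set unitInterval) : Prop := op T * P A = P B * op T

theorem Aut.inv {A : Set unitInterval} {T : G2} (h : Aut A T) : Aut A T⁻¹ := by
  have := congrArg (op T⁻¹ * ·) h
  simp only [← mul_assoc, op_inv_mul, one_mul] at this
  exact this.symm

theorem Aut.mul {A : Set unitInterval} {S T : G2} (hS : Aut A S) (h : Aut A T) :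
    Aut A (S * T) := by
  unfold Aut at *
  rw [op_mul, mul_assoc, h, hS]

theorem Aut.one {A : Set unitInterval} : Aut A 1 := by
  unfold Aut; rw [op_one, one_mul]

theorem Aut.left {A : Set unitInterval} (hA : MeasurableSet A) {T : G2} (h : Aut A T) :
    P Aᶜ * op T = P Aᶜ := by
  have := congrArg star h.inv
  rw [star_mul, op_star, inv_inv, P_star hA.compl] at this
  exact this

theorem Aut.mono {A B : Set unitInterval} (hA : MeasurableSet A) (hB : MeasurableSet B)
    (hAB : A ⊆ B) {T : G2} (h : Aut A T) : Aut B T := by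
  have e : P Bᶜ = P Aᶜ * P Bᶜ := by
    rw [P_mul hA.compl hB.compl, Set.inter_eq_right.2 (Set.compl_subset_compl.2 hAB)]
  unfold Aut at *
  rw [e, ← mul_assoc, h]

theorem Aut.congr {A B : Set unitInterval} (hA : MeasurableSet A) (hB : MeasurableSet B)
    (hAB : P A = P B) {T : G2} (h : Aut A T) : Aut B T := by
  unfold Aut at *
  rwa [P_compl hB, ← hAB, ← P_compl hA]

theorem Aut.maps {A : Set unitInterval} (hA : MeasurableSet A) {T : G2} (h : Aut A T) :
    Maps T A A := by
  have h1 := h.left hA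
  unfold Aut at h
  unfold Maps
  rw [P_compl hA] at h h1
  rw [mul_sub, mul_one] at h
  rw [sub_mul, one_mul] at h1
  have := h.trans h1.symm
  exact sub_right_injective this

theorem Aut.maps_of_disjoint {A B : Set unitInterval} (hA : MeasurableSet A)
    (hB : MeasurableSet B) (hAB : Disjoint A B) {T : G2} (h : Aut A T) : Maps T B B := by
  have e : P B = P Aᶜ * P B := by
    rw [P_mul hA.compl hB, Set.inter_eq_right.2 hAB.subset_compl_left]
  have e' : P B = P B * P Aᶜ := by
    rw [P_mul hB hA.compl, Set.inter_eq_left.2 hAB.subset_compl_left]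
  have h1 := h.left hA
  unfold Aut at h
  unfold Maps
  rw [e, ← mul_assoc, h, ← e]
  conv_rhs => rw [e', mul_assoc, h1, ← e']

theorem Maps.inv {A B : Set unitInterval} {T : G2} (h : Maps T A B) : Maps T⁻¹ B A := by
  unfold Maps at *
  calc op T⁻¹ * P B = op T⁻¹ * (P B * op T) * op T⁻¹ := by
        rw [mul_assoc, mul_assoc, op_mul_inv, mul_one]
    _ = P A * op T⁻¹ := by
        rw [← h, ← mul_assoc, op_inv_mul, one_mul]

theorem Maps.comp {A B C : Set unitInterval} {S T : G2} (h : Maps T A B) (k : Maps S B C) :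
    Maps (S * T) A C := by
  unfold Maps at *
  rw [op_mul, mul_assoc, h, ← mul_assoc, k, mul_assoc]

theorem Maps.inter {A B A' B' : Set unitInterval} (hA : MeasurableSet A) (hB : MeasurableSet B)
    (hA' : MeasurableSet A') (hB' : MeasurableSet B')
    {T : G2} (h : Maps T A B) (k : Maps T A' B') :
    Maps T (A ∩ A') (B ∩ B') := by
  unfold Maps at *
  rw [← P_mul hA hA', ← P_mul hB hB', ← mul_assoc, h, mul_assoc, k, mul_assoc]

theorem Maps.compl {A B : Set unitInterval} (hA : MeasurableSet A) (hB : MeasurableSet B)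
    {T : G2} (h : Maps T A B) : Maps T Aᶜ Bᶜ := by
  unfold Maps at *
  rw [P_compl hA, P_compl hB, mul_sub, sub_mul, h]; simp

theorem Maps.diff {A B A' B' : Set unitInterval} (hA : MeasurableSet A) (hB : MeasurableSet B)
    (hA' : MeasurableSet A') (hB' : MeasurableSet B')
    {T : G2} (h : Maps T A B) (k : Maps T A' B') :
    Maps T (A \ A') (B \ B') := by
  rw [Set.sdiff_eq, Set.sdiff_eq]
  exact h.inter hA hB hA'.compl hB'.compl (k.compl hA' hB')

theorem Maps.null {A B : Set unitInterval} (hA : MeasurableSet A) (hB : MeasurableSet B)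
    {T : G2} (h : Maps T A B) : μ01 A = 0 ↔ μ01 B = 0 := by
  rw [← P_eq_zero hA, ← P_eq_zero hB]
  constructor
  · intro e
    unfold Maps at h
    calc P B = P B * op T * op T⁻¹ := by rw [mul_assoc, op_mul_inv, mul_one]
      _ = 0 := by rw [← h, e]; simp
  · intro e
    have h := h.inv
    unfold Maps at h
    calc P A = P A * op T⁻¹ * op T := by rw [mul_assoc, op_inv_mul, mul_one]
      _ = 0 := by rw [← h, e]; simp

theorem Aut.conj {A B : Set unitInterval} (hA : MeasurableSet A) (hB : MeasurableSet B)
    {T U : G2} (h : Maps T A B) (hU : Aut A U) : Aut B (T * U * T⁻¹) := by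
  have h := h.compl hA hB
  have h' := h.inv
  unfold Maps at h h'
  unfold Aut at *
  rw [op_mul, op_mul, mul_assoc, h', mul_assoc, ← mul_assoc (op U), hU, ← mul_assoc, h, mul_assoc,
    op_mul_inv, mul_one]

theorem Aut.comm {A B : Set unitInterval} (hA : MeasurableSet A) (hB : MeasurableSet B)
    (hAB : μ01 (A ∩ B) = 0) {S T : G2} (hS : Aut A S) (hT : Aut B T) : S * T = T * S := by
  have hS1 := hS.left hA
  have hT1 := hT.left hB
  have e1 : P A * P B = 0 := by rw [P_mul hA hB, (P_eq_zero (hA.inter hB)).2 hAB]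
  have e2 : P B * P A = 0 := by
    rw [P_mul hB hA, Set.inter_comm, (P_eq_zero (hA.inter hB)).2 hAB]
  unfold Aut at hS hT
  rw [P_compl hA, mul_sub, mul_one] at hS
  rw [P_compl hB, mul_sub, mul_one] at hT
  rw [P_compl hA, sub_mul, one_mul] at hS1
  rw [P_compl hB, sub_mul, one_mul] at hT1
  have s1 : op S - 1 = (op S - 1) * P A := by
    rw [sub_mul, one_mul]; exact sub_eq_sub_iff_sub_eq_sub.1 hS
  have s2 : op S - 1 = P A * (op S - 1) := by
    rw [mul_sub, mul_one]; exact sub_eq_sub_iff_sub_eq_sub.1 hS1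
  have t1 : op T - 1 = (op T - 1) * P B := by
    rw [sub_mul, one_mul]; exact sub_eq_sub_iff_sub_eq_sub.1 hT
  have t2 : op T - 1 = P B * (op T - 1) := by
    rw [mul_sub, mul_one]; exact sub_eq_sub_iff_sub_eq_sub.1 hT1
  have z1 : (op S - 1) * (op T - 1) = 0 := by
    rw [s1, t2]
    calc (op S - 1) * P A * (P B * (op T - 1)) = (op S - 1) * (P A * P B) * (op T - 1) := by
          simp only [mul_assoc]
      _ = 0 := by rw [e1]; simp
  have z2 : (op T - 1) * (op S - 1) = 0 := by
    rw [t1, s2]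
    calc (op T - 1) * P B * (P A * (op S - 1)) = (op T - 1) * (P B * P A) * (op S - 1) := by
          simp only [mul_assoc]
      _ = 0 := by rw [e2]; simp
  apply op_inj
  rw [op_mul, op_mul]
  have : op S * op T - op T * op S = (op S - 1) * (op T - 1) - (op T - 1) * (op S - 1) := by
    noncomm_ring
  rw [z1, z2, sub_zero] at this
  exact sub_eq_zero.1 this

theorem PIso.of_maps {T : G2} {A B : Set unitInterval} (hA : MeasurableSet A)
    (hB : MeasurableSet B) (h : Maps T A B) : PIso (P A) (P B) (op T * P A) := by
  have i1 : P A * P A = P A := by rw [P_mul hA hA, Set.inter_self]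
  have i2 : P B * P B = P B := by rw [P_mul hB hB, Set.inter_self]
  have st : star (op T * P A) = P A * op T⁻¹ := by rw [star_mul, P_star hA, op_star]
  have f1 : op T * P A * star (op T * P A) = P B := by
    rw [st, mul_assoc, ← mul_assoc (P A), i1, ← mul_assoc, h, mul_assoc, op_mul_inv, mul_one]
  refine ⟨fun f hf => op_nonneg T _ (P_nonneg hA f hf), ?_, f1, ?_⟩
  · rw [st, mul_assoc, ← mul_assoc (op T⁻¹), op_inv_mul, one_mul, i1]
  · rw [f1, h, ← mul_assoc, i2]

theorem PIso.P {A : Set unitInterval} (hA : MeasurableSet A) : PIso (P A) (P A) (P A) := by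
  have := PIso.of_maps (T := 1) hA hA (by unfold Maps; rw [op_one]; simp)
  rwa [op_one, one_mul] at this


theorem op_abs (T : G2) (f : H2) : |op T f| = op T |f| := by
  change op T f ⊔ -op T f = op T (f ⊔ -f)
  rw [op_apply, op_apply, T.2, map_neg]

theorem op_inf (T : G2) (f g : H2) : op T (f ⊓ g) = op T f ⊓ op T g := by
  have h : ∀ a b : H2, a ⊓ b = -(-a ⊔ -b) := fun a b => by rw [neg_sup, neg_neg, neg_neg]
  rw [h, h, map_neg]
  simp only [op_apply]
  rw [T.2, map_neg, map_neg]

theorem disj_iff (f g : H2) : |f| ⊓ |g| = 0 ↔ ∀ᵐ x ∂μ01, f x = 0 ∨ g x = 0 := by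
  have key : ∀ᵐ x ∂μ01, (|f| ⊓ |g| : H2) x = min |f x| |g x| := by
    filter_upwards [Lp.coeFn_inf |f| |g|, Lp.coeFn_abs f, Lp.coeFn_abs g] with x h1 h2 h3
    rw [h1, Pi.inf_apply, h2, h3]
  constructor
  · intro h
    rw [h] at key
    filter_upwards [key, Lp.coeFn_zero ℝ 2 μ01] with x h1 h2
    rw [h2, Pi.zero_apply] at h1
    rcases min_choice |f x| |g x| with h | h
    · left; rw [h] at h1; exact abs_eq_zero.1 h1.symm
    · right; rw [h] at h1; exact abs_eq_zero.1 h1.symm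
  · intro h
    apply Lp.ext
    filter_upwards [key, h, Lp.coeFn_zero ℝ 2 μ01] with x h1 h2 h3
    rw [h1, h3]
    rcases h2 with h | h <;> simp [h]

theorem op_disj (T : G2) {f g : H2} (h : ∀ᵐ x ∂μ01, f x = 0 ∨ g x = 0) :
    ∀ᵐ x ∂μ01, (op T f) x = 0 ∨ (op T g) x = 0 := by
  rw [← disj_iff] at *
  rw [op_abs, op_abs, ← op_inf, h, map_zero]

theorem op_one2_ne (T : G2) : ∀ᵐ x ∂μ01, (op T one2) x ≠ 0 := by
  set D : Set unitInterval := {x | (op T one2) x = 0} with hD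
  have hDm : MeasurableSet D :=
    measurableSet_eq_fun (Lp.stronglyMeasurable _).measurable measurable_const
  have h1 : ∀ᵐ x ∂μ01, (P D one2) x = 0 ∨ (op T one2) x = 0 := by
    filter_upwards [P_coe hDm one2] with x hx
    by_cases h : x ∈ D
    · exact Or.inr h
    · left; rw [hx]; simp [h]
  have h2 := op_disj T⁻¹ h1
  have h3 : op T⁻¹ (op T one2) = one2 := by
    rw [← mul_apply_eq_comp, op_inv_mul]; rfl
  rw [h3] at h2
  have h4 : op T⁻¹ (P D one2) = 0 := by
    apply Lp.ext
    filter_upwards [h2, one2_coe, Lp.coeFn_zero ℝ 2 μ01] with x h h' h''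
    rw [h'']
    rcases h with h | h
    · exact h
    · rw [h'] at h; norm_num at h
  have h5 : P D one2 = 0 := by
    have : op T (op T⁻¹ (P D one2)) = P D one2 := by
      rw [← mul_apply_eq_comp, op_mul_inv]; rfl
    rw [← this, h4, map_zero]
  have h6 := P_coe hDm one2
  rw [h5] at h6
  filter_upwards [h6, one2_coe, Lp.coeFn_zero ℝ 2 μ01] with x h h' h'' hx
  rw [h'', Set.indicator_of_mem (show x ∈ D from hx), h'] at h
  norm_num at h

theorem exists_maps (T : G2) {A : Set unitInterval} (hA : MeasurableSet A) :
    ∃ B, MeasurableSet B ∧ Maps T A B := by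
  set B : Set unitInterval := {x | (op T (P A one2)) x = 0}ᶜ with hB
  have hBm : MeasurableSet B :=
    (measurableSet_eq_fun (Lp.stronglyMeasurable _).measurable measurable_const).compl
  refine ⟨B, hBm, ?_⟩
  -- support statements
  have hsum : ∀ᵐ x ∂μ01, (op T one2) x = (op T (P A one2)) x + (op T (P Aᶜ one2)) x := by
    have : op T one2 = op T (P A one2) + op T (P Aᶜ one2) := by
      rw [← map_add, P_compl hA, sub_apply]; simp
    rw [this]
    filter_upwards [Lp.coeFn_add (op T (P A one2)) (op T (P Aᶜ one2))] with x hx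
    exact hx
  have key : ∀ f : H2, ∀ᵐ x ∂μ01,
      (x ∉ B → (op T (P A f)) x = 0) ∧ (x ∈ B → (op T (P Aᶜ f)) x = 0) := by
    intro f
    have h1 : ∀ᵐ x ∂μ01, (P A f) x = 0 ∨ (P Aᶜ one2) x = 0 := by
      filter_upwards [P_coe hA f, P_coe hA.compl one2] with x h h'
      rw [h, h']
      by_cases hx : x ∈ A <;> simp [hx]
    have h2 : ∀ᵐ x ∂μ01, (P Aᶜ f) x = 0 ∨ (P A one2) x = 0 := by
      filter_upwards [P_coe hA.compl f, P_coe hA one2] with x h h'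
      rw [h, h']
      by_cases hx : x ∈ A <;> simp [hx]
    filter_upwards [op_disj T h1, op_disj T h2, hsum, op_one2_ne T] with x h1 h2 h3 h4
    constructor
    · intro hx
      have hx' : (op T (P A one2)) x = 0 := by simpa [hB] using hx
      rcases h1 with h | h
      · exact h
      · rw [h, hx', add_zero] at h3; exact absurd h3 h4
    · intro hx
      have hx' : ¬ (op T (P A one2)) x = 0 := by simpa [hB] using hx
      exact h2.resolve_right hx'
  unfold Maps
  ext1 f
  have e : f = P A f + P Aᶜ f := by rw [P_compl hA, sub_apply]; simp
  have e' : op T f = op T (P A f) + op T (P Aᶜ f) := by rw [← map_add, ← e]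
  apply Lp.ext
  rw [mul_apply_eq_comp, mul_apply_eq_comp]
  filter_upwards [key f, P_coe hBm (op T f), Lp.coeFn_add (op T (P A f)) (op T (P Aᶜ f))]
    with x h1 h2 h3
  rw [h2]
  by_cases hx : x ∈ B
  · rw [Set.indicator_of_mem hx, e', h3, Pi.add_apply, h1.2 hx, add_zero]
  · rw [Set.indicator_of_notMem hx, h1.1 hx]

theorem Aut.norm_le {A : Set unitInterval} (hA : MeasurableSet A) {T : G2} (h : Aut A T)
    (f : H2) : ‖op T f - f‖ ≤ 2 * ‖P A f‖ := by
  have h1 : op T (P Aᶜ f) = P Aᶜ f := by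
    rw [← mul_apply_eq_comp, h]
  have e : f = P A f + P Aᶜ f := by rw [P_compl hA, sub_apply]; simp
  have e2 : op T f - f = op T (P A f) - P A f := by
    conv_lhs => rw [e, map_add, h1]
    abel
  rw [e2]
  calc _ ≤ ‖op T (P A f)‖ + ‖P A f‖ := norm_sub_le _ _
    _ = 2 * ‖P A f‖ := by
      rw [op_apply, LinearIsometryEquiv.norm_map]; ring

theorem tendsto_P {A : ℕ → Set unitInterval} (hA : ∀ n, MeasurableSet (A n)) (hm : Antitone A)
    (h0 : μ01 (⋂ n, A n) = 0) (f : H2) :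
    Filter.Tendsto (fun n => ‖P (A n) f‖) Filter.atTop (nhds 0) := by
  have h1 : ∀ n, ‖P (A n) f‖ ^ 2 = ∫ x in A n, f x * f x ∂μ01 := by
    intro n
    rw [← real_inner_self_eq_norm_sq, inner_eq, ← integral_indicator (hA n)]
    apply integral_congr_ae
    filter_upwards [P_coe (hA n) f] with x hx
    rw [hx]
    by_cases h : x ∈ A n <;> simp [h]
  have hIntg : Integrable (fun x => f x * f x) μ01 := by
    have := L2.integrable_inner (𝕜 := ℝ) f f
    simpa [pow_two] using this
  have h2 := tendsto_setIntegral_of_antitone (μ := μ01) (f := fun x => f x * f x) hA hm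
    ⟨0, hIntg.integrableOn⟩
  have h3 : ∫ x in ⋂ n, A n, f x * f x ∂μ01 = 0 := setIntegral_measure_zero _ h0
  rw [h3] at h2
  have h4 : Filter.Tendsto (fun n => ‖P (A n) f‖ ^ 2) Filter.atTop (nhds 0) := by
    simpa only [h1] using h2
  have h5 := h4.sqrt
  simpa using h5


/-- distribution function of `A` -/
noncomputable def FF (A : Set unitInterval) (x : unitInterval) : ℝ := μ01.real (A ∩ Set.Iic x)

theorem FF_mono (A : Set unitInterval) : Monotone (FF A) := fun x y h =>
  measureReal_mono (Set.inter_subset_inter_right _ (Set.Iic_subset_Iic.2 h))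

theorem FF_lip (A : Set unitInterval) {x y : unitInterval} (h : x ≤ y) :
    FF A y ≤ FF A x + ((y : ℝ) - x) := by
  have h1 : A ∩ Set.Iic y ⊆ (A ∩ Set.Iic x) ∪ Set.Ioc x y := by
    rintro z ⟨hz, hzy⟩
    by_cases hzx : z ≤ x
    · exact Or.inl ⟨hz, hzx⟩
    · exact Or.inr ⟨not_le.1 hzx, hzy⟩
  have h2 : μ01.real (Set.Ioc x y) = (y : ℝ) - x := by
    have : (x : ℝ) ≤ y := h
    rw [measureReal_def, mu_eq, unitInterval.volume_Ioc, ENNReal.toReal_ofReal (by linarith)]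
  calc FF A y ≤ μ01.real ((A ∩ Set.Iic x) ∪ Set.Ioc x y) := measureReal_mono h1
    _ ≤ _ := measureReal_union_le _ _
    _ = _ := by rw [h2]; rfl

theorem FF_cont (A : Set unitInterval) : Continuous (FF A) := by
  have : LipschitzWith 1 (FF A) := by
    apply LipschitzWith.of_dist_le_mul
    intro x y
    rw [NNReal.coe_one, one_mul, Real.dist_eq, Subtype.dist_eq, Real.dist_eq]
    rcases le_total x y with h | h
    · have h1 := FF_lip A h
      have h2 := FF_mono A h
      have h3 : (x : ℝ) ≤ y := h
      rw [abs_le, abs_of_nonpos (by linarith)]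
      constructor <;> linarith
    · have h1 := FF_lip A h
      have h2 := FF_mono A h
      have h3 : (y : ℝ) ≤ x := h
      rw [abs_le, abs_of_nonneg (by linarith)]
      constructor <;> linarith
  exact this.continuous

theorem FF_zero (A : Set unitInterval) : FF A 0 = 0 := by
  have : A ∩ Set.Iic 0 ⊆ {0} := fun x hx => by
    have : x ≤ 0 := hx.2
    exact le_antisymm this unitInterval.nonneg'
  have h := measureReal_mono (μ := μ01) this
  have h0 : μ01.real {(0 : unitInterval)} = 0 := by
    rw [measureReal_def, measure_singleton]; rfl
  exact le_antisymm (h.trans h0.le) measureReal_nonneg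

theorem FF_one (A : Set unitInterval) : FF A 1 = μ01.real A := by
  have : Set.Iic (1 : unitInterval) = Set.univ := by
    ext x; simpa using unitInterval.le_one'
  rw [FF, this, Set.inter_univ]

theorem FF_exists (A : Set unitInterval) {t : ℝ} (h0 : 0 ≤ t) (h1 : t ≤ μ01.real A) :
    ∃ s, FF A s = t :=
  mem_range_of_exists_le_of_exists_ge (FF_cont A) ⟨0, by rw [FF_zero]; exact h0⟩
    ⟨1, by rw [FF_one]; exact h1⟩

theorem FF_level (A : Set unitInterval) {t : ℝ} (h0 : 0 ≤ t) (h1 : t ≤ μ01.real A) :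
    ∃ s, {x | FF A x ≤ t} = Set.Iic s ∧ FF A s = t := by
  have hc : IsCompact {x | FF A x ≤ t} := (isClosed_le (FF_cont A) continuous_const).isCompact
  obtain ⟨s, hs, hmax⟩ := hc.exists_isGreatest ⟨0, by simpa [FF_zero] using h0⟩
  obtain ⟨s', hs'⟩ := FF_exists A h0 h1
  refine ⟨s, ?_, ?_⟩
  · ext x
    constructor
    · intro hx; exact hmax hx
    · intro hx; exact (FF_mono A hx).trans hs
  · apply le_antisymm hs
    rw [← hs']
    exact FF_mono A (hmax hs'.le)

theorem real_pos {A : Set unitInterval} (h : μ01 A ≠ 0) : 0 < μ01.real A := by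
  rw [measureReal_def]
  exact ENNReal.toReal_pos h (measure_ne_top _ _)

theorem real_ne {A : Set unitInterval} (h : 0 < μ01.real A) : μ01 A ≠ 0 := by
  intro h0
  rw [measureReal_def, h0] at h
  simp at h

theorem shrink {A : Set unitInterval} (hA : MeasurableSet A) (h0 : μ01 A ≠ 0) :
    ∃ E : ℕ → Set unitInterval, (∀ n, MeasurableSet (E n)) ∧ Antitone E ∧ E 0 = A ∧
      (∀ n, μ01 (E n) ≠ 0) ∧ (∀ m n, m < n → μ01 (E m \ E n) ≠ 0) ∧ μ01 (⋂ n, E n) = 0 := by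
  have hm := real_pos h0
  set m := μ01.real A with hmdef
  have hs : ∀ n : ℕ, ∃ s, FF A s = m / 2 ^ n ∧ (n = 0 → s = 1) := by
    intro n
    rcases Nat.eq_zero_or_pos n with h | h
    · exact ⟨1, by rw [h, FF_one]; simp [hmdef], fun _ => rfl⟩
    · obtain ⟨s, hs⟩ := FF_exists A (t := m / 2 ^ n) (by positivity)
        (div_le_self hm.le (one_le_pow₀ (by norm_num)))
      exact ⟨s, hs, fun h' => by omega⟩
  choose s hs hs1 using hs
  have hanti : StrictAnti s := by
    apply strictAnti_nat_of_succ_lt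
    intro n
    by_contra hcon
    have h1 := FF_mono A (not_lt.1 hcon)
    rw [hs, hs, pow_succ] at h1
    have h2 : 0 < m / 2 ^ n := by positivity
    have h3 : m / (2 ^ n * 2) = (m / 2 ^ n) / 2 := by field_simp
    linarith
  have hmeas : ∀ n, MeasurableSet (A ∩ Set.Iic (s n)) := fun n => hA.inter measurableSet_Iic
  have hsub : ∀ {m n}, m ≤ n → A ∩ Set.Iic (s n) ⊆ A ∩ Set.Iic (s m) := fun {m n} h =>
    Set.inter_subset_inter_right _ (Set.Iic_subset_Iic.2 (hanti.antitone h))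
  refine ⟨fun n => A ∩ Set.Iic (s n), hmeas, fun m n h => hsub h, ?_, ?_, ?_, ?_⟩
  · have : Set.Iic (1 : unitInterval) = Set.univ := by
      ext x; simpa using unitInterval.le_one'
    simp only [hs1 0 rfl, this, Set.inter_univ]
  · intro n
    apply real_ne
    change 0 < FF A (s n)
    rw [hs]; positivity
  · intro k n hkn
    apply real_ne
    rw [measureReal_sdiff (hsub hkn.le) (hmeas n)]
    change 0 < FF A (s k) - FF A (s n)
    rw [hs, hs, sub_pos]
    exact div_lt_div_of_pos_left hm (by positivity) (pow_lt_pow_right₀ (by norm_num) hkn)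
  · have h1 : μ01.real (⋂ n, A ∩ Set.Iic (s n)) ≤ 0 := by
      have ht : Filter.Tendsto (fun n : ℕ => m * (1 / 2) ^ n) Filter.atTop (nhds (m * 0)) :=
        (tendsto_pow_atTop_nhds_zero_of_lt_one (by norm_num) (by norm_num)).const_mul m
      rw [mul_zero] at ht
      apply ge_of_tendsto' ht
      intro n
      calc _ ≤ μ01.real (A ∩ Set.Iic (s n)) := measureReal_mono (Set.iInter_subset _ n)
        _ = FF A (s n) := rfl
        _ = _ := by rw [hs]; simp [div_eq_mul_inv]
    by_contra h2
    exact absurd (real_pos h2) (not_lt.2 h1)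

/-- normalised distribution function, as a self-map of the interval -/
noncomputable def phi (A : Set unitInterval) (x : unitInterval) : unitInterval :=
  ⟨FF A x / μ01.real A, div_nonneg measureReal_nonneg measureReal_nonneg, by
    apply div_le_one_of_le₀ _ measureReal_nonneg
    exact measureReal_mono Set.inter_subset_left⟩

theorem phi_meas (A : Set unitInterval) : Measurable (phi A) := by
  apply Continuous.measurable
  exact Continuous.subtype_mk ((FF_cont A).div_const _) _

theorem phi_le_iff {A : Set unitInterval} (h0 : μ01 A ≠ 0) (x t : unitInterval) :
    phi A x ≤ t ↔ FF A x ≤ t * μ01.real A := by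
  rw [← Subtype.coe_le_coe]
  exact div_le_iff₀ (real_pos h0)

theorem phi_pre {A : Set unitInterval} (h0 : μ01 A ≠ 0) (t : unitInterval) :
    μ01.real (A ∩ phi A ⁻¹' Set.Iic t) = t * μ01.real A := by
  obtain ⟨s, hs, hs'⟩ := FF_level A (t := t * μ01.real A)
    (mul_nonneg t.2.1 measureReal_nonneg)
    (mul_le_of_le_one_left measureReal_nonneg t.2.2)
  have : phi A ⁻¹' Set.Iic t = {x | FF A x ≤ t * μ01.real A} := by
    ext x; exact phi_le_iff h0 x t
  rw [this, hs]
  exact hs'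

theorem phi_mp {A : Set unitInterval} (hA : MeasurableSet A) (h0 : μ01 A ≠ 0) :
    MeasurePreserving (phi A) (μ01.restrict A) (μ01 A • μ01) := by
  refine ⟨phi_meas A, ?_⟩
  have : IsFiniteMeasure (μ01 A • μ01) := Measure.smul_finite _ (measure_ne_top _ _)
  apply Measure.ext_of_Iic
  intro t
  rw [Measure.map_apply (phi_meas A) measurableSet_Iic,
    Measure.restrict_apply (phi_meas A measurableSet_Iic), Set.inter_comm]
  have h := phi_pre h0 t
  have e : (μ01 A • μ01) (Set.Iic t) = μ01 A * ENNReal.ofReal t := by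
    rw [Measure.smul_apply, smul_eq_mul]
    congr 1
    rw [mu_eq, unitInterval.volume_Iic]
  rw [e, ← ENNReal.ofReal_toReal (measure_ne_top μ01 (A ∩ _)), ← measureReal_def, h, mul_comm,
    ENNReal.ofReal_mul measureReal_nonneg, measureReal_def,
    ENNReal.ofReal_toReal (measure_ne_top μ01 _)]

theorem phi_ae {A : Set unitInterval} (hA : MeasurableSet A) (h0 : μ01 A ≠ 0)
    {p : unitInterval → Prop} (h : ∀ᵐ x ∂μ01, p x) : ∀ᵐ x ∂μ01, x ∈ A → p (phi A x) := by
  rw [← ae_restrict_iff' hA]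
  exact (phi_mp hA h0).quasiMeasurePreserving.ae (Measure.ae_smul_measure h _)


section V
variable {A : Set unitInterval}

/-- the normalising constant -/
noncomputable def cc (A : Set unitInterval) : ℝ := (Real.sqrt (μ01.real A))⁻¹

theorem cc_sq (h0 : μ01 A ≠ 0) : cc A * cc A * μ01.real A = 1 := by
  have h := real_pos h0
  have h2 := Real.mul_self_sqrt h.le
  have h3 := (Real.sqrt_pos.2 h).ne'
  unfold cc
  field_simp
  rw [sq]; exact h2.symm

theorem V_memLp (hA : MeasurableSet A) (h0 : μ01 A ≠ 0) (f : H2) :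
    MemLp (A.indicator fun x => cc A * f (phi A x)) 2 μ01 := by
  rw [memLp_indicator_iff_restrict hA]
  apply MemLp.const_mul
  exact ((Lp.memLp f).smul_measure (measure_ne_top μ01 A)).comp_measurePreserving (phi_mp hA h0)

/-- the weighted composition operator -/
noncomputable def Vfun (hA : MeasurableSet A) (h0 : μ01 A ≠ 0) (f : H2) : H2 :=
  MemLp.toLp _ (V_memLp hA h0 f)

theorem Vfun_coe (hA : MeasurableSet A) (h0 : μ01 A ≠ 0) (f : H2) :
    (Vfun hA h0 f : H2) =ᵐ[μ01] A.indicator fun x => cc A * f (phi A x) := MemLp.coeFn_toLp _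

theorem Vfun_add (hA : MeasurableSet A) (h0 : μ01 A ≠ 0) (f g : H2) :
    Vfun hA h0 (f + g) = Vfun hA h0 f + Vfun hA h0 g := by
  apply Lp.ext
  filter_upwards [Vfun_coe hA h0 (f + g), Vfun_coe hA h0 f, Vfun_coe hA h0 g,
    phi_ae hA h0 (Lp.coeFn_add f g), Lp.coeFn_add (Vfun hA h0 f) (Vfun hA h0 g)]
    with x h1 h2 h3 h4 h5
  rw [h1, h5, Pi.add_apply, h2, h3]
  by_cases hx : x ∈ A
  · simp only [Set.indicator_of_mem hx]
    rw [h4 hx, Pi.add_apply, mul_add]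
  · simp [hx]

theorem Vfun_smul (hA : MeasurableSet A) (h0 : μ01 A ≠ 0) (c : ℝ) (f : H2) :
    Vfun hA h0 (c • f) = c • Vfun hA h0 f := by
  apply Lp.ext
  filter_upwards [Vfun_coe hA h0 (c • f), Vfun_coe hA h0 f,
    phi_ae hA h0 (Lp.coeFn_smul c f), Lp.coeFn_smul c (Vfun hA h0 f)]
    with x h1 h2 h4 h5
  rw [h1, h5, Pi.smul_apply, h2]
  by_cases hx : x ∈ A
  · simp only [Set.indicator_of_mem hx]
    rw [h4 hx, Pi.smul_apply]; simp only [smul_eq_mul]; ring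
  · simp [hx]

theorem Vfun_inner (hA : MeasurableSet A) (h0 : μ01 A ≠ 0) (f g : H2) :
    inner ℝ (Vfun hA h0 f) (Vfun hA h0 g) = (inner ℝ f g : ℝ) := by
  rw [inner_eq, inner_eq]
  have h1 : ∫ x, (Vfun hA h0 f) x * (Vfun hA h0 g) x ∂μ01
      = ∫ x in A, cc A * cc A * (f (phi A x) * g (phi A x)) ∂μ01 := by
    rw [← integral_indicator hA]
    apply integral_congr_ae
    filter_upwards [Vfun_coe hA h0 f, Vfun_coe hA h0 g] with x h1 h2
    rw [h1, h2]
    by_cases hx : x ∈ A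
    · simp only [Set.indicator_of_mem hx]; ring
    · simp [hx]
  have hfg : AEStronglyMeasurable (fun x => f x * g x) (Measure.map (phi A) (μ01.restrict A)) :=
    ((Lp.stronglyMeasurable f).mul (Lp.stronglyMeasurable g)).aestronglyMeasurable
  have h2 : ∫ x in A, f (phi A x) * g (phi A x) ∂μ01 = μ01.real A * ∫ x, f x * g x ∂μ01 := by
    rw [← integral_map (f := fun x => f x * g x) (phi_meas A).aemeasurable hfg,
      (phi_mp hA h0).map_eq, integral_smul_measure]
    rfl
  rw [h1, integral_const_mul, h2, ← mul_assoc, cc_sq h0, one_mul]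

/-- the weighted composition operator, as a linear map -/
noncomputable def Vlin (hA : MeasurableSet A) (h0 : μ01 A ≠ 0) : H2 →ₗ[ℝ] H2 where
  toFun := Vfun hA h0
  map_add' := Vfun_add hA h0
  map_smul' := Vfun_smul hA h0

/-- the weighted composition operator, as a continuous linear map -/
noncomputable def V (hA : MeasurableSet A) (h0 : μ01 A ≠ 0) : H2 →L[ℝ] H2 :=
  (Vlin hA h0).mkContinuous 1 (fun f => by
    rw [one_mul]
    have := Vfun_inner hA h0 f f
    rw [real_inner_self_eq_norm_sq, real_inner_self_eq_norm_sq] at this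
    exact ((sq_eq_sq₀ (norm_nonneg _) (norm_nonneg _)).1 this).le)

theorem V_coe (hA : MeasurableSet A) (h0 : μ01 A ≠ 0) (f : H2) :
    (V hA h0 f : H2) =ᵐ[μ01] A.indicator fun x => cc A * f (phi A x) := Vfun_coe hA h0 f

theorem V_inner (hA : MeasurableSet A) (h0 : μ01 A ≠ 0) (f g : H2) :
    inner ℝ (V hA h0 f) (V hA h0 g) = (inner ℝ f g : ℝ) := Vfun_inner hA h0 f g

theorem eq_zero_of_Iic {h : H2} (hh : ∀ s, ∫ x in Set.Iic s, h x ∂μ01 = 0) : h = 0 := by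
  have hIntg : Integrable h μ01 := (Lp.memLp h).integrable (by norm_num)
  have key : ∀ S, MeasurableSet S → ∫ x in S, h x ∂μ01 = 0 := by
    have huniv : ∫ x, h x ∂μ01 = 0 := by
      have : Set.Iic (1 : unitInterval) = Set.univ := by
        ext x; simpa using unitInterval.le_one'
      have h1 := hh 1
      rwa [this, setIntegral_univ] at h1
    intro S hS
    induction S, hS using MeasurableSpace.induction_on_inter
      ((BorelSpace.measurable_eq (α := unitInterval)).trans
        (borel_eq_generateFrom_Iic unitInterval)) (isPiSystem_Iic (α := unitInterval)) with
    | empty => simp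
    | basic t ht =>
      obtain ⟨s, rfl⟩ := ht
      exact hh s
    | compl t ht h1 =>
      have := integral_add_compl ht hIntg
      rw [h1, huniv] at this; linarith
    | iUnion f hd hf h1 =>
      rw [integral_iUnion hf hd hIntg.integrableOn]
      simp [h1]
  have := hIntg.ae_eq_zero_of_forall_setIntegral_eq_zero (fun S hS _ => key S hS)
  apply Lp.ext
  filter_upwards [this, Lp.coeFn_zero ℝ 2 μ01] with x h1 h2
  rw [h1, h2]

theorem V_perp (hA : MeasurableSet A) (h0 : μ01 A ≠ 0) {h : H2} (hs : P A h = h)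
    (hp : ∀ g, inner ℝ h (V hA h0 g) = (0 : ℝ)) : h = 0 := by
  apply eq_zero_of_Iic
  intro s
  have hIm : MeasurableSet (Set.Iic (phi A s)) := measurableSet_Iic
  have h1 := hp (P (Set.Iic (phi A s)) one2)
  -- the preimage agrees with `Iic s` on `A`
  have hnull : ∀ᵐ x ∂μ01, x ∈ A → (phi A x ≤ phi A s ↔ x ≤ s) := by
    have hsub : A ∩ Set.Iic s ⊆ A ∩ phi A ⁻¹' Set.Iic (phi A s) := by
      rintro x ⟨hx, hxs⟩
      refine ⟨hx, ?_⟩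
      exact div_le_div_of_nonneg_right (FF_mono A hxs) measureReal_nonneg
    have hm : MeasurableSet (A ∩ Set.Iic s) := hA.inter measurableSet_Iic
    have hz : μ01 ((A ∩ phi A ⁻¹' Set.Iic (phi A s)) \ (A ∩ Set.Iic s)) = 0 := by
      by_contra hne
      have hpos := real_pos hne
      rw [measureReal_sdiff hsub hm, phi_pre h0] at hpos
      have e : ((phi A s : unitInterval) : ℝ) * μ01.real A = μ01.real (A ∩ Set.Iic s) :=
        div_mul_cancel₀ _ (real_pos h0).ne'
      rw [e] at hpos
      linarith
    rw [measure_eq_zero_iff_ae_notMem] at hz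
    filter_upwards [hz] with x hx hxA
    constructor
    · intro hle
      by_contra hcon
      exact hx ⟨⟨hxA, hle⟩, fun h => hcon h.2⟩
    · intro hle
      exact (hsub ⟨hxA, hle⟩).2
  rw [inner_eq] at h1
  have h2 : ∫ x, h x * (V hA h0 (P (Set.Iic (phi A s)) one2)) x ∂μ01
      = ∫ x in Set.Iic s, cc A * h x ∂μ01 := by
    rw [← integral_indicator measurableSet_Iic]
    apply integral_congr_ae
    have hs' := P_coe hA h
    rw [hs] at hs'
    filter_upwards [hnull, V_coe hA h0 (P (Set.Iic (phi A s)) one2),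
      phi_ae hA h0 (P_coe hIm one2), phi_ae hA h0 one2_coe, hs'] with x e1 e2 e3 e4 e5
    rw [e2]
    by_cases hx : x ∈ A
    · rw [Set.indicator_of_mem hx, e3 hx]
      by_cases hxs : x ≤ s
      · rw [Set.indicator_of_mem (show x ∈ Set.Iic s from hxs),
          Set.indicator_of_mem (show phi A x ∈ Set.Iic (phi A s) from (e1 hx).2 hxs), e4 hx]
        ring
      · rw [Set.indicator_of_notMem (show x ∉ Set.Iic s from hxs),
          Set.indicator_of_notMem (show phi A x ∉ Set.Iic (phi A s) from fun h => hxs ((e1 hx).1 h))]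
        ring
    · rw [Set.indicator_of_notMem hx] at e5 ⊢
      have : (Set.Iic s).indicator (fun x => cc A * h x) x = 0 := by
        by_cases hxs : x ∈ Set.Iic s
        · rw [Set.indicator_of_mem hxs, e5, mul_zero]
        · rw [Set.indicator_of_notMem hxs]
      rw [this, mul_zero]
  rw [h2, integral_const_mul] at h1
  have hc : cc A ≠ 0 := by
    intro hc
    have := cc_sq h0
    rw [hc] at this; simp at this
  exact (mul_eq_zero.1 h1).resolve_left hc

theorem V_piso (hA : MeasurableSet A) (h0 : μ01 A ≠ 0) : PIso 1 (P A) (V hA h0) := by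
  have ini : star (V hA h0) * V hA h0 = 1 := by
    ext1 f
    apply ext_inner_right ℝ
    intro g
    rw [mul_apply_eq_comp, ContinuousLinearMap.star_eq_adjoint,
      ContinuousLinearMap.adjoint_inner_left, V_inner]
    rfl
  have tri : V hA h0 * star (V hA h0) * V hA h0 = V hA h0 := by
    rw [mul_assoc, ini, mul_one]
  have hPV : P A * V hA h0 = V hA h0 := by
    ext1 f
    apply Lp.ext
    rw [mul_apply_eq_comp]
    filter_upwards [P_coe hA (V hA h0 f), V_coe hA h0 f] with x h1 h2
    rw [h1]
    by_cases hx : x ∈ A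
    · rw [Set.indicator_of_mem hx]
    · rw [Set.indicator_of_notMem hx, h2, Set.indicator_of_notMem hx]
  have hPP : P A * P A = P A := by rw [P_mul hA hA, Set.inter_self]
  refine ⟨?_, ini, ?_, tri⟩
  · intro f hf
    rw [← Lp.coeFn_nonneg] at *
    filter_upwards [V_coe hA h0 f, phi_ae hA h0 hf] with x h1 h2
    rw [h1]
    by_cases hx : x ∈ A
    · rw [Set.indicator_of_mem hx]
      exact mul_nonneg (inv_nonneg.2 (Real.sqrt_nonneg _)) (h2 hx)
    · rw [Set.indicator_of_notMem hx]; rfl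
  · symm
    rw [← sub_eq_zero]
    ext1 f
    rw [zero_apply]
    apply V_perp hA h0
    · rw [← mul_apply_eq_comp, mul_sub, hPP, ← mul_assoc, hPV]
    · intro g
      have e : (star (V hA h0)) ((P A - V hA h0 * star (V hA h0)) f) = 0 := by
        have : star (V hA h0) * (P A - V hA h0 * star (V hA h0)) = 0 := by
          rw [mul_sub, ← mul_assoc, ini, one_mul]
          have h := congrArg star hPV
          rw [star_mul, P_star hA] at h
          rw [h, sub_self]
        rw [← mul_apply_eq_comp, this]; rfl
      rw [← ContinuousLinearMap.adjoint_inner_left, ← ContinuousLinearMap.star_eq_adjoint, e,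
        inner_zero_left]
end V

theorem exists_piso {A B : Set unitInterval} (hA : MeasurableSet A) (hB : MeasurableSet B)
    (h0 : μ01 A ≠ 0) (h1 : μ01 B ≠ 0) : ∃ W, PIso (P A) (P B) W :=
  ⟨_, (V_piso hA h0).symm.comp (V_piso hB h1)⟩

theorem extend {A B U : Set unitInterval} (hA : MeasurableSet A) (hB : MeasurableSet B)
    (hU : MeasurableSet U) (hAU : A ⊆ U) (hBU : B ⊆ U) (h0 : μ01 (U \ A) ≠ 0)
    (h1 : μ01 (U \ B) ≠ 0) {W : H2 →L[ℝ] H2} (hW : PIso (P A) (P B) W) :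
    ∃ h : G2, Aut U h ∧ op h * P A = W := by
  have hUA := hU.diff hA
  have hUB := hU.diff hB
  obtain ⟨W', hW'⟩ := exists_piso hUA hUB h0 h1
  have hUc := PIso.P hU.compl
  have d1 : Disjoint A (U \ A) := Set.disjoint_sdiff_right
  have d2 : Disjoint B (U \ B) := Set.disjoint_sdiff_right
  have z : ∀ {S T : Set unitInterval}, MeasurableSet S → MeasurableSet T → Disjoint S T →
      P S * P T = 0 := fun hS hT h => by rw [P_mul hS hT, h.inter_eq, P_empty]
  have a1 := hW.add hW' (z hA hUA d1) (z hB hUB d2)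
  rw [← P_union hA hUA d1, ← P_union hB hUB d2, Set.union_sdiff_cancel hAU,
    Set.union_sdiff_cancel hBU] at a1
  have d3 : Disjoint U Uᶜ := disjoint_compl_right
  have a2 := a1.add hUc (z hU hU.compl d3) (z hU hU.compl d3)
  rw [← P_union hU hU.compl d3, Set.union_compl_self, P_univ] at a2
  obtain ⟨h, hh⟩ := exists_op a2
  refine ⟨h, ?_, ?_⟩
  · unfold Aut
    rw [hh, add_mul, ← a1.mul_ini, mul_assoc, z hU hU.compl d3, P_mul hU.compl hU.compl,
      Set.inter_self, mul_zero, zero_add]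
  · rw [hh, add_mul, add_mul, hW.mul_ini, ← hW'.mul_ini, mul_assoc, z hUA hA d1.symm, mul_zero,
      z hU.compl hA (Set.disjoint_left.2 fun x hx hx' => hx (hAU hx')), add_zero, add_zero]

theorem extend_maps {A B U : Set unitInterval} (hA : MeasurableSet A) (hB : MeasurableSet B)
    (hU : MeasurableSet U) (hAU : A ⊆ U) (hBU : B ⊆ U) (hA0 : μ01 A ≠ 0) (hB0 : μ01 B ≠ 0)
    (h0 : μ01 (U \ A) ≠ 0) (h1 : μ01 (U \ B) ≠ 0) : ∃ h : G2, Aut U h ∧ Maps h A B := by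
  obtain ⟨W, hW⟩ := exists_piso hA hB hA0 hB0
  obtain ⟨h, hh, e⟩ := extend hA hB hU hAU hBU h0 h1 hW
  refine ⟨h, hh, ?_⟩
  have hAA : P A * P A = P A := by rw [P_mul hA hA, Set.inter_self]
  have f1 : op h * P A * op h⁻¹ = P B := by
    rw [← hW.fin, ← e, star_mul, P_star hA, op_star]
    simp only [mul_assoc]
    rw [← mul_assoc (P A) (P A), hAA]
  unfold Maps
  rw [← f1, mul_assoc _ (op h⁻¹), op_inv_mul, mul_one]


theorem Maps.congr_left {A A' B : Set unitInterval} (hAB : P A = P A') {T : G2} (h : Maps T A B) :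
    Maps T A' B := by
  unfold Maps at *; rwa [← hAB]

theorem Maps.union {A B A' B' : Set unitInterval} (hA : MeasurableSet A) (hB : MeasurableSet B)
    (hA' : MeasurableSet A') (hB' : MeasurableSet B') (hd : Disjoint A A') (hd' : Disjoint B B')
    {T : G2} (h : Maps T A B) (k : Maps T A' B') : Maps T (A ∪ A') (B ∪ B') := by
  unfold Maps at *
  rw [P_union hA hA' hd, P_union hB hB' hd', mul_add, h, k, add_mul]

theorem P_congr_null {A B : Set unitInterval} (hA : MeasurableSet A) (hB : MeasurableSet B)
    (h1 : μ01 (A \ B) = 0) (h2 : μ01 (B \ A) = 0) : P A = P B :=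
  P_congr hA hB (ae_eq_set.2 ⟨h1, h2⟩)

theorem null_mono {A B : Set unitInterval} (h : A ⊆ B) (h0 : μ01 B = 0) : μ01 A = 0 :=
  measure_mono_null h h0

theorem nn_mono {A B : Set unitInterval} (h : A ⊆ B) (h0 : μ01 A ≠ 0) : μ01 B ≠ 0 :=
  fun e => h0 (measure_mono_null h e)

theorem split {A : Set unitInterval} (hA : MeasurableSet A) (h0 : μ01 A ≠ 0) :
    ∃ B, MeasurableSet B ∧ B ⊆ A ∧ μ01 B ≠ 0 ∧ μ01 (A \ B) ≠ 0 := by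
  obtain ⟨E, h1, h2, h3, h4, h5, -⟩ := shrink hA h0
  refine ⟨E 1, h1 1, ?_, h4 1, ?_⟩
  · rw [← h3]; exact h2 (by norm_num)
  · rw [← h3]; exact h5 0 1 (by norm_num)

theorem move2 {C1 C2 J B : Set unitInterval} (h2 : MeasurableSet C2)
    (hJ : MeasurableSet J) (hB : MeasurableSet B) (hJI : J ⊆ C1 ∩ C2) (hJ0 : μ01 J ≠ 0)
    (hJ1 : μ01 ((C1 ∩ C2) \ J) ≠ 0) (hBU : B ⊆ C1 ∪ C2) (hB2 : μ01 (C2 \ B) ≠ 0) :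
    ∃ (q : G2) (B1 : Set unitInterval), Aut C2 q ∧ MeasurableSet B1 ∧ B1 ⊆ C1 ∧
      μ01 (C1 \ B1) ≠ 0 ∧ Maps q B B1 := by
  by_cases h : μ01 (B ∩ C2) = 0
  · refine ⟨1, B \ C2, Aut.one, hB.diff h2, ?_, ?_, ?_⟩
    · intro x hx; exact (hBU hx.1).resolve_right hx.2
    · refine nn_mono ?_ hJ1
      rintro x ⟨⟨a, b⟩, c⟩; exact ⟨a, fun d => d.2 b⟩
    · unfold Maps
      rw [op_one, one_mul, mul_one]
      apply P_congr_null hB (hB.diff h2)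
      · refine null_mono ?_ h
        rintro x ⟨a, b⟩; exact ⟨a, by by_contra hc; exact b ⟨a, hc⟩⟩
      · refine null_mono ?_ h
        rintro x ⟨⟨a, b⟩, c⟩; exact absurd a c
  · obtain ⟨q, hq, hqm⟩ := extend_maps (hB.inter h2) hJ h2 Set.inter_subset_right
      (fun x hx => (hJI hx).2) h hJ0
      (nn_mono (by rintro x ⟨a, b⟩; exact ⟨a, fun d => b d.1⟩) hB2)
      (nn_mono (by rintro x ⟨a, b⟩; exact ⟨a.2, b⟩) hJ1)
    have d : Disjoint C2 (B \ C2) := Set.disjoint_sdiff_right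
    refine ⟨q, J ∪ B \ C2, hq, hJ.union (hB.diff h2), ?_, ?_, ?_⟩
    · rintro x (hx | hx)
      · exact (hJI hx).1
      · exact (hBU hx.1).resolve_right hx.2
    · refine nn_mono ?_ hJ1
      rintro x ⟨⟨a, b⟩, c⟩; exact ⟨a, fun d => d.elim c fun e => e.2 b⟩
    · have := hqm.union (hB.inter h2) hJ (hB.diff h2) (hB.diff h2)
        (d.mono_left Set.inter_subset_right) (d.mono_left (hJI.trans Set.inter_subset_right))
        (hq.maps_of_disjoint h2 (hB.diff h2) d)
      rwa [Set.inter_union_sdiff] at this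

theorem factor {C1 C2 : Set unitInterval} (h1 : MeasurableSet C1) (h2 : MeasurableSet C2)
    (hI : μ01 (C1 ∩ C2) ≠ 0) (hK2 : μ01 (C2 \ C1) ≠ 0) {T : G2}
    (hT : Aut (C1 ∪ C2) T) : ∃ q' q h k t : G2, Aut C1 q' ∧ Aut C2 q ∧ Aut C1 h ∧ Aut C2 k ∧
      Aut C1 t ∧ T = q'⁻¹ * (q⁻¹ * (h * (k * t))) := by
  obtain ⟨J, hJ, hJI, hJ0, hJ1⟩ := split (h1.inter h2) hI
  have hU := h1.union h2
  have hK := h2.diff h1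
  have m1 : ∀ {S}, Aut C1 S → Aut (C1 ∪ C2) S := fun h => h.mono h1 hU Set.subset_union_left
  have m2 : ∀ {S}, Aut C2 S → Aut (C1 ∪ C2) S := fun h => h.mono h2 hU Set.subset_union_right
  -- image of `C2 \ C1`
  obtain ⟨B, hB, hBU, hTB⟩ : ∃ B, MeasurableSet B ∧ B ⊆ C1 ∪ C2 ∧ Maps T (C2 \ C1) B := by
    obtain ⟨B, hB, h⟩ := exists_maps T hK
    refine ⟨B ∩ (C1 ∪ C2), hB.inter hU, Set.inter_subset_right, ?_⟩
    have := h.inter hK hB hU hU (hT.maps hU)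
    rwa [Set.inter_eq_left.2 (show C2 \ C1 ⊆ C1 ∪ C2 from fun x hx => Or.inr hx.1)] at this
  have hR : μ01 ((C1 ∪ C2) \ B) ≠ 0 := by
    have := (hT.maps hU).diff hU hU hK hB hTB
    intro e
    rw [← this.null (hU.diff hK) (hU.diff hB)] at e
    exact nn_mono (B := (C1 ∪ C2) \ (C2 \ C1)) (fun x hx => ⟨Or.inl hx.1, fun y => y.2 hx.1⟩) hI e
  -- first move
  obtain ⟨q', B', hq', hB', hBU', hm', hR'⟩ : ∃ (q' : G2) (B' : Set unitInterval), Aut C1 q' ∧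
      MeasurableSet B' ∧ B' ⊆ C1 ∪ C2 ∧ Maps q' B B' ∧ μ01 (C2 \ B') ≠ 0 := by
    by_cases h : μ01 (C2 \ B) = 0
    · have c1 : μ01 (C1 \ B) ≠ 0 := by
        intro e
        apply hR
        rw [Set.union_sdiff_distrib]
        exact measure_union_null e h
      have c2 : μ01 (C1 \ (C1 \ B)) ≠ 0 := by
        intro e
        apply hI
        refine null_mono ?_ (measure_union_null e h)
        intro x hx
        by_cases hb : x ∈ B
        · exact Or.inl ⟨hx.1, fun y => y.2 hb⟩
        · exact Or.inr ⟨hx.2, hb⟩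
      obtain ⟨q', hq', hm⟩ := extend_maps (h1.diff hB) hJ h1 Set.sdiff_subset
        (hJI.trans Set.inter_subset_left) c1 hJ0 c2
        (nn_mono (fun x hx => ⟨hx.1.1, hx.2⟩) hJ1)
      refine ⟨q', (C1 ∪ C2) \ J, hq', hU.diff hJ, Set.sdiff_subset, ?_, ?_⟩
      · have := ((m1 hq').maps hU).diff hU hU (h1.diff hB) hJ hm
        refine this.congr_left (P_congr_null (hU.diff (h1.diff hB)) hB ?_ ?_)
        · refine null_mono ?_ h
          rintro x ⟨⟨a, b⟩, c⟩
          refine ⟨a.resolve_left fun y => b ⟨y, c⟩, c⟩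
        · rw [show B \ ((C1 ∪ C2) \ (C1 \ B)) = ∅ from ?_, measure_empty]
          rw [Set.sdiff_eq_empty]
          exact fun x hx => ⟨hBU hx, fun y => y.2 hx⟩
      · exact nn_mono (fun x hx => ⟨(hJI hx).2, fun y => y.2 hx⟩) hJ0
    · exact ⟨1, B, Aut.one, hB, hBU, by unfold Maps; rw [op_one, one_mul, mul_one], h⟩
  obtain ⟨q, B1, hq, hB1, hB1C, hC1B, hm⟩ := move2 h2 hJ hB' hJI hJ0 hJ1 hBU' hR'
  obtain ⟨k, hk, hkm⟩ := extend_maps hK hJ h2 Set.sdiff_subset (hJI.trans Set.inter_subset_right)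
    hK2 hJ0 (nn_mono (fun x hx => ⟨hx.2, fun y => y.2 hx.1⟩) hI)
    (nn_mono (fun x hx => ⟨hx.1.2, hx.2⟩) hJ1)
  have hS : Maps (q * q' * T * k⁻¹) J B1 := by
    have := (hkm.inv.comp hTB).comp (hm'.comp hm)
    simpa [mul_assoc] using this
  obtain ⟨h, hh, he⟩ := extend hJ hB1 h1 (hJI.trans Set.inter_subset_left) hB1C
    (nn_mono (fun x hx => ⟨hx.1.1, hx.2⟩) hJ1) hC1B (PIso.of_maps hJ hB1 hS)
  refine ⟨q', q, h, k, (h * k)⁻¹ * (q * q' * T), hq', hq, hh, hk, ?_, by group⟩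
  have tU : Aut (C1 ∪ C2) ((h * k)⁻¹ * (q * q' * T)) :=
    ((m1 hh).mul (m2 hk)).inv.mul (((m2 hq).mul (m1 hq')).mul hT)
  have ec : C1ᶜ = (C2 \ C1) ∪ (C1 ∪ C2)ᶜ := by
    ext x; simp only [Set.mem_compl_iff, Set.mem_union, Set.mem_sdiff]; tauto
  have key : op (q * q' * T) * P (C2 \ C1) = op (h * k) * P (C2 \ C1) := by
    have e1 : q * q' * T = (q * q' * T * k⁻¹) * k := by group
    rw [e1, op_mul _ k, mul_assoc, hkm, ← mul_assoc, ← he, mul_assoc, ← hkm, ← mul_assoc, ← op_mul]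
  unfold Aut at tU ⊢
  rw [ec, P_union hK hU.compl (Set.disjoint_left.2 fun x hx hy => hy (Or.inr hx.1)), mul_add, tU,
    op_mul, mul_assoc, key, ← mul_assoc, op_inv_mul, one_mul]


structure Act {X : Type*} [MetricSpace X] (a : G2 → X → X) : Prop where
  one : ∀ x, a 1 x = x
  mul : ∀ S T x, a (S * T) x = a S (a T x)
  cont : Continuous fun p : G2 × X => a p.1 p.2
  iso : ∀ g, Isometry (a g)

def Fx {X : Type*} [MetricSpace X] (a : G2 → X → X) (x : X) (ε : ℝ) (A : Set unitInterval) : Prop :=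
  ∀ T, Aut A T → dist (a T x) x ≤ ε

section
variable {X : Type*} [MetricSpace X] {a : G2 → X → X}

theorem Act.dist_mul (ha : Act a) (x : X) (S T : G2) :
    dist (a (S * T) x) x ≤ dist (a S x) x + dist (a T x) x := by
  rw [ha.mul]
  calc dist (a S (a T x)) x ≤ dist (a S (a T x)) (a S x) + dist (a S x) x := dist_triangle _ _ _
    _ = _ := by rw [(ha.iso S).dist_eq, add_comm]

theorem Act.inv_apply (ha : Act a) (x : X) (T : G2) : a T⁻¹ (a T x) = x := by
  rw [← ha.mul, inv_mul_cancel, ha.one]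

theorem Act.apply_inv (ha : Act a) (x : X) (T : G2) : a T (a T⁻¹ x) = x := by
  rw [← ha.mul, mul_inv_cancel, ha.one]

theorem Fx.mono {x : X} {ε δ : ℝ} {A B : Set unitInterval} (h : Fx a x ε B) (hA : MeasurableSet A)
    (hB : MeasurableSet B) (hAB : A ⊆ B) (hε : ε ≤ δ) : Fx a x δ A :=
  fun T hT => (h T (hT.mono hA hB hAB)).trans hε

theorem Fx.congr {x : X} {ε : ℝ} {A B : Set unitInterval} (h : Fx a x ε B) (hA : MeasurableSet A)
    (hB : MeasurableSet B) (hAB : P A = P B) : Fx a x ε A :=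
  fun T hT => h T (hT.congr hA hB hAB)

theorem small (ha : Act a) (x : X) {A : ℕ → Set unitInterval} (hA : ∀ n, MeasurableSet (A n))
    (hm : Antitone A) (h0 : μ01 (⋂ n, A n) = 0) {ε : ℝ} (hε : 0 < ε) :
    ∃ n, Fx a x ε (A n) := by
  have hc : Continuous fun g : G2 => a g x := ha.cont.comp (Continuous.prodMk_left x)
  have hn : {g : G2 | dist (a g x) x < ε} ∈ nhds (1 : G2) := by
    apply (isOpen_lt (hc.dist continuous_const) continuous_const).mem_nhds
    simp only [Set.mem_ofPred_eq, ha.one, dist_self]; exact hε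
  by_contra hcon
  push Not at hcon
  unfold Fx at hcon
  push Not at hcon
  choose T hT hd using hcon
  have ht : Filter.Tendsto T Filter.atTop (nhds (1 : G2)) := by
    rw [nhds_induced, Filter.tendsto_comap_iff, tendsto_pi_nhds]
    intro f
    change Filter.Tendsto (fun n => op (T n) f) Filter.atTop (nhds f)
    rw [tendsto_iff_norm_sub_tendsto_zero]
    have := (tendsto_P hA hm h0 f).const_mul 2
    rw [mul_zero] at this
    exact squeeze_zero (fun _ => norm_nonneg _) (fun n => (hT n).norm_le (hA n) f) this
  obtain ⟨n, hn⟩ := (ht.eventually hn).exists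
  exact absurd hn (not_lt.2 (hd n).le)

theorem glue (ha : Act a) {x : X} {ε : ℝ} {C1 C2 : Set unitInterval} (h1 : MeasurableSet C1)
    (h2 : MeasurableSet C2) (hI : μ01 (C1 ∩ C2) ≠ 0) (f1 : Fx a x ε C1) (f2 : Fx a x ε C2) :
    Fx a x (5 * ε) (C1 ∪ C2) := by
  have hε : 0 ≤ ε := dist_nonneg.trans (f1 1 Aut.one)
  by_cases hK2 : μ01 (C2 \ C1) = 0
  · have : Fx a x ε (C1 ∪ C2) := f1.congr (h1.union h2) h1 (P_congr_null (h1.union h2) h1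
      (by rwa [Set.union_sdiff_left]) (by
        rw [Set.sdiff_eq_empty.2 Set.subset_union_left, measure_empty]))
    intro T hT
    linarith [this T hT]
  intro T hT
  obtain ⟨q', q, h, k, t, hq', hq, hh, hk, ht, rfl⟩ := factor h1 h2 hI hK2 hT
  have := ha.dist_mul x q'⁻¹ (q⁻¹ * (h * (k * t)))
  have := ha.dist_mul x q⁻¹ (h * (k * t))
  have := ha.dist_mul x h (k * t)
  have := ha.dist_mul x k t
  linarith [f1 _ hq'.inv, f2 _ hq.inv, f1 _ hh, f2 _ hk, f1 _ ht]

theorem fx_zero {x : X} {A : Set unitInterval} (c : ℝ) (h : ∀ ε, 0 < ε → Fx a x (c * ε) A) :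
    Fx a x 0 A := by
  intro T hT
  have : Filter.Tendsto (fun ε : ℝ => c * ε) (nhdsWithin 0 (Set.Ioi 0)) (nhds 0) := by
    have : Filter.Tendsto (fun ε : ℝ => c * ε) (nhds 0) (nhds (c * 0)) :=
      (continuous_const.mul continuous_id).tendsto 0
    rw [mul_zero] at this
    exact this.mono_left nhdsWithin_le_nhds
  refine ge_of_tendsto this ?_
  filter_upwards [self_mem_nhdsWithin] with ε hε
  exact h ε hε T hT

theorem iInter_union_null {A B : ℕ → Set unitInterval} (hA : Antitone A) (hB : Antitone B)
    (h1 : μ01 (⋂ n, A n) = 0) (h2 : μ01 (⋂ n, B n) = 0) : μ01 (⋂ n, (A n ∪ B n)) = 0 := by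
  rw [Set.iInter_union_of_antitone hA hB]
  exact measure_union_null h1 h2

/-- gluing a small set onto a set of exact invariance -/
theorem glue_small (ha : Act a) {x : X} {C : Set unitInterval} (hC : MeasurableSet C)
    (h0 : μ01 C ≠ 0) (f : Fx a x 0 C) {A : ℕ → Set unitInterval} (hA : ∀ n, MeasurableSet (A n))
    (hm : Antitone A) (hn : μ01 (⋂ n, A n) = 0) {ε : ℝ} (hε : 0 < ε) :
    ∃ n, Fx a x ε (C ∪ A n) := by
  obtain ⟨D, d1, d2, d3, d4, -, d6⟩ := shrink hC h0
  obtain ⟨n, hs⟩ := small ha x (A := fun n => D n ∪ A n) (fun n => (d1 n).union (hA n))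
    (d2.sup hm) (iInter_union_null d2 hm d6 hn) (ε := ε / 5) (by positivity)
  have hDC : D n ⊆ C := by rw [← d3]; exact d2 (Nat.zero_le n)
  refine ⟨n, ?_⟩
  have := glue ha hC ((d1 n).union (hA n))
    (nn_mono (fun y hy => ⟨hDC hy, Or.inl hy⟩) (d4 n))
    (f.mono hC hC le_rfl (show (0 : ℝ) ≤ ε / 5 by positivity)) hs
  refine this.mono (hC.union (hA n)) (hC.union ((d1 n).union (hA n)))
    (Set.union_subset_union_right _ Set.subset_union_right) (by linarith)

theorem glue0 (ha : Act a) {x : X} {C1 C2 : Set unitInterval} (h1 : MeasurableSet C1)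
    (h2 : MeasurableSet C2) (f1 : Fx a x 0 C1) (f2 : Fx a x 0 C2) :
    Fx a x 0 (C1 ∪ C2) := by
  have z : ∀ {A B : Set unitInterval}, MeasurableSet A → MeasurableSet B → μ01 A = 0 →
      Fx a x 0 B → Fx a x 0 (A ∪ B) := by
    intro A B hA hB h0 f
    refine f.congr (hA.union hB) hB (P_congr_null (hA.union hB) hB ?_ ?_)
    · rw [Set.union_sdiff_right]; exact null_mono Set.sdiff_subset h0
    · rw [Set.sdiff_eq_empty.2 Set.subset_union_right, measure_empty]
  by_cases z1 : μ01 C1 = 0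
  · exact z h1 h2 z1 f2
  by_cases z2 : μ01 C2 = 0
  · rw [Set.union_comm]; exact z h2 h1 z2 f1
  refine fx_zero 5 fun ε hε => ?_
  obtain ⟨D, d1, d2, d3, d4, -, d6⟩ := shrink h2 z2
  obtain ⟨n, hn⟩ := glue_small ha h1 z1 f1 d1 d2 d6 hε
  have hDC : D n ⊆ C2 := by rw [← d3]; exact d2 (Nat.zero_le n)
  have := glue ha (h1.union (d1 n)) h2 (nn_mono (fun y hy => ⟨Or.inr hy, hDC hy⟩) (d4 n)) hn
    (f2.mono h2 h2 le_rfl hε.le)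
  exact this.mono (h1.union h2) ((h1.union (d1 n)).union h2)
    (Set.union_subset_union_left _ Set.subset_union_left) le_rfl

theorem fx_iUnion (ha : Act a) {x : X} {C : ℕ → Set unitInterval} (hC : ∀ n, MeasurableSet (C n))
    (hm : Monotone C) (f : ∀ n, Fx a x 0 (C n)) : Fx a x 0 (⋃ n, C n) := by
  have hU : MeasurableSet (⋃ n, C n) := MeasurableSet.iUnion hC
  have hA : ∀ n, MeasurableSet ((⋃ n, C n) \ C n) := fun n => hU.diff (hC n)
  have hAm : Antitone fun n => (⋃ n, C n) \ C n := fun i j h => Set.sdiff_subset_sdiff_right (hm h)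
  have hA0 : (⋂ n, ((⋃ n, C n) \ C n)) = ∅ := by
    rw [← Set.sdiff_iUnion, sdiff_self]; rfl
  have hA0' : μ01 (⋂ n, ((⋃ n, C n) \ C n)) = 0 := by rw [hA0, measure_empty]
  refine fx_zero 5 fun ε hε => ?_
  by_cases z : ∃ k, μ01 (C k) ≠ 0
  · obtain ⟨k, hk⟩ := z
    obtain ⟨n, hn⟩ := glue_small ha (hC k) hk (f k) hA hAm hA0' hε
    have := glue ha ((hC k).union (hA n)) (hC (max k n))
      (nn_mono (fun y hy => ⟨Or.inl hy, hm (le_max_left k n) hy⟩) hk) hn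
      ((f _).mono (hC _) (hC _) le_rfl hε.le)
    refine this.mono hU (((hC k).union (hA n)).union (hC _)) ?_ le_rfl
    intro y hy
    by_cases hyn : y ∈ C n
    · exact Or.inr (hm (le_max_right k n) hyn)
    · exact Or.inl (Or.inr ⟨hy, hyn⟩)
  · push Not at z
    obtain ⟨n, hn⟩ := small ha x hA hAm hA0' hε
    refine (hn.congr hU (hA n) (P_congr_null hU (hA n) ?_ ?_)).mono hU hU le_rfl (by linarith)
    · refine null_mono ?_ (z n)
      intro y hy; by_contra hc; exact hy.2 ⟨hy.1, hc⟩
    · rw [Set.sdiff_eq_empty.2 Set.sdiff_subset, measure_empty]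

theorem exists_max (ha : Act a) (x : X) : ∃ C, MeasurableSet C ∧ Fx a x 0 C ∧
    ∀ Q, MeasurableSet Q → Fx a x 0 Q → μ01 (Q \ C) = 0 := by
  let S : Set ℝ := {r | ∃ Q, MeasurableSet Q ∧ Fx a x 0 Q ∧ μ01.real Q = r}
  have hne : S.Nonempty := by
    refine ⟨_, ∅, MeasurableSet.empty, ?_, rfl⟩
    intro T hT
    have : T = 1 := op_inj (by
      unfold Aut at hT; rw [Set.compl_empty, P_univ, mul_one] at hT; rw [hT, op_one])
    rw [this, ha.one, dist_self]
  have hb : BddAbove S := ⟨1, by rintro r ⟨Q, -, -, rfl⟩; exact measureReal_le_one⟩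
  obtain ⟨u, -, hu, huS⟩ := exists_seq_tendsto_sSup hne hb
  choose Q hQ hQf hQu using huS
  have hp : ∀ n, Fx a x 0 (partialSups Q n) ∧ MeasurableSet (partialSups Q n) := by
    intro n
    induction n with
    | zero => rw [partialSups_zero]; exact ⟨hQf 0, hQ 0⟩
    | succ n ih =>
      rw [partialSups_add_one]
      exact ⟨glue0 ha ih.2 (hQ _) ih.1 (hQf _), ih.2.union (hQ _)⟩
  have hC : MeasurableSet (⋃ n, partialSups Q n) := MeasurableSet.iUnion fun n => (hp n).2
  have hCf := fx_iUnion ha (fun n => (hp n).2) (partialSups Q).monotone fun n => (hp n).1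
  refine ⟨⋃ n, partialSups Q n, hC, hCf, ?_⟩
  intro R hR hRf
  by_contra h0
  have g := glue0 ha hC hR hCf hRf
  have l1 : μ01.real ((⋃ n, partialSups Q n) ∪ R) ≤ sSup S := le_csSup hb ⟨_, hC.union hR, g, rfl⟩
  have l2 : sSup S ≤ μ01.real (⋃ n, partialSups Q n) := by
    refine le_of_tendsto hu (Filter.Eventually.of_forall fun n => ?_)
    rw [← hQu]
    exact measureReal_mono ((le_partialSups Q n).trans (Set.subset_iUnion _ n))
  have l3 := real_pos h0
  have l4 := measureReal_union (μ := μ01) (Set.disjoint_sdiff_right (t := R) (s := ⋃ n, partialSups Q n))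
    (hR.diff hC)
  rw [Set.union_sdiff_self] at l4
  linarith
end


theorem chain_step {F F' E E' : Set unitInterval} (hF : MeasurableSet F) (hF' : MeasurableSet F')
    (hE : MeasurableSet E) (hE' : MeasurableSet E') (sF : F' ⊆ F) (sE : E' ⊆ E)
    (nF : μ01 F' ≠ 0) (nE : μ01 E' ≠ 0) (dF : μ01 (F \ F') ≠ 0) (dE : μ01 (E \ E') ≠ 0)
    {g : G2} (hg : Maps g F E) : ∃ h, Aut F h ∧ Maps (g * h) F' E' := by
  obtain ⟨B0, hB0, hm0⟩ := exists_maps g⁻¹ hE'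
  have hB := hB0.inter hF
  have hm : Maps g⁻¹ E' (B0 ∩ F) := by
    have := hm0.inter hE' hB0 hE hF hg.inv
    rwa [Set.inter_eq_left.2 sE] at this
  have n1 : μ01 (B0 ∩ F) ≠ 0 := fun e => nE ((hm.null hE' hB).2 e)
  have n2 : μ01 (F \ (B0 ∩ F)) ≠ 0 := fun e =>
    dE (((hg.inv.diff hE hF hE' hB hm).null (hE.diff hE') (hF.diff hB)).2 e)
  obtain ⟨h, hh, hhm⟩ := extend_maps hF' hB hF sF Set.inter_subset_right nF n1 dF n2
  refine ⟨h, hh, hhm.comp ?_⟩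
  have := hm.inv
  rwa [inv_inv] at this

theorem chain {F E : ℕ → Set unitInterval} (hF : ∀ n, MeasurableSet (F n))
    (hE : ∀ n, MeasurableSet (E n)) (aF : Antitone F) (aE : Antitone E) (h0 : E 0 = F 0)
    (nF : ∀ n, μ01 (F n) ≠ 0) (nE : ∀ n, μ01 (E n) ≠ 0)
    (dF : ∀ n, μ01 (F n \ F (n + 1)) ≠ 0) (dE : ∀ n, μ01 (E n \ E (n + 1)) ≠ 0) :
    ∃ g : ℕ → G2, (∀ n, Maps (g n) (F n) (E n)) ∧
      ∀ n m, n ≤ m → Aut (F n) ((g n)⁻¹ * g m) := by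
  have step : ∀ n g, ∃ h, Maps g (F n) (E n) →
      Aut (F n) h ∧ Maps (g * h) (F (n + 1)) (E (n + 1)) := by
    intro n g
    by_cases hg : Maps g (F n) (E n)
    · obtain ⟨h, hh⟩ := chain_step (hF n) (hF (n + 1)) (hE n) (hE (n + 1)) (aF (Nat.le_succ n))
        (aE (Nat.le_succ n)) (nF _) (nE _) (dF n) (dE n) hg
      exact ⟨h, fun _ => hh⟩
    · exact ⟨1, fun h => absurd h hg⟩
  choose H hH using step
  let g : ℕ → G2 := fun n => Nat.rec 1 (fun n g => g * H n g) n
  have gs : ∀ n, g (n + 1) = g n * H n (g n) := fun n => rfl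
  have gm : ∀ n, Maps (g n) (F n) (E n) := by
    intro n
    induction n with
    | zero =>
      change Maps 1 (F 0) (E 0)
      unfold Maps; rw [op_one, h0, one_mul, mul_one]
    | succ n ih => rw [gs]; exact (hH n _ ih).2
  refine ⟨g, gm, ?_⟩
  intro n m hnm
  induction m, hnm using Nat.le_induction with
  | base => rw [inv_mul_cancel]; exact Aut.one
  | succ m hm ih =>
    rw [gs, ← mul_assoc]
    exact ih.mul ((hH m _ (gm m)).1.mono (hF m) (hF n) (aF hm))

section
variable {X : Type*} [MetricSpace X] {a : G2 → X → X}

theorem conj_fx (ha : Act a) {x : X} {A B : Set unitInterval} (hA : MeasurableSet A)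
    (hB : MeasurableSet B) {γ : G2} (h : Maps γ A B) (f : Fx a x 0 A) : Fx a (a γ x) 0 B := by
  intro T hT
  have := f _ (hT.conj hB hA h.inv)
  rw [← (ha.iso γ).dist_eq, ← ha.mul] at this
  rw [← ha.mul]
  convert this using 3
  group

theorem limit [CompleteSpace X] (ha : Act a) {x : X} {F : ℕ → Set unitInterval}
    (hf : ∀ n, Fx a x ((1 / 2) ^ n) (F n)) {g : ℕ → G2}
    (hg : ∀ n m, n ≤ m → Aut (F n) ((g n)⁻¹ * g m)) :
    ∃ y, Filter.Tendsto (fun n => a (g n) x) Filter.atTop (nhds y) := by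
  apply cauchySeq_tendsto_of_complete
  refine cauchySeq_of_le_geometric (1 / 2) 1 (by norm_num) fun n => ?_
  have := hf n _ (hg n (n + 1) (Nat.le_succ n))
  rw [ha.mul, ← (ha.iso (g n)).dist_eq, ha.apply_inv, dist_comm] at this
  linarith

theorem contra [CompleteSpace X] (ha : Act a) (htrans : ∀ x y : X, ∃ g, a g x = y) (x : X)
    {C : Set unitInterval} (hC : MeasurableSet C) (f : Fx a x 0 C)
    (hmax : ∀ Q, MeasurableSet Q → Fx a x 0 Q → μ01 (Q \ C) = 0) : μ01 Cᶜ = 0 := by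
  by_contra hc
  obtain ⟨b, b1, b2, b3, b4, b5, b6⟩ := shrink hC.compl hc
  have hbC : ∀ n, b n ⊆ Cᶜ := fun n => by rw [← b3]; exact b2 (Nat.zero_le n)
  have ex : ∀ ε : ℝ, 0 < ε → ∃ n, Fx a x ε (C ∪ b n) := by
    intro ε hε
    by_cases hC0 : μ01 C = 0
    · refine small ha x (A := fun n => C ∪ b n) (fun n => hC.union (b1 n))
        (fun i j h => Set.union_subset_union_right _ (b2 h)) ?_ hε
      rw [← Set.union_iInter]; exact measure_union_null hC0 b6
    · exact glue_small ha hC hC0 f b1 b2 b6 hε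
  obtain ⟨φ, hφ, hφf⟩ := Filter.extraction_forall_of_eventually'
    (P := fun n k => Fx a x ((1 / 2) ^ n) (C ∪ b k)) (fun n => by
      obtain ⟨N, hN⟩ := ex ((1 / 2) ^ n) (by positivity)
      exact ⟨N, fun k hk => hN.mono (hC.union (b1 k)) (hC.union (b1 N))
        (Set.union_subset_union_right _ (b2 hk)) le_rfl⟩)
  let F : ℕ → Set unitInterval := fun n => C ∪ b (φ n)
  have hF : ∀ n, MeasurableSet (F n) := fun n => hC.union (b1 _)
  have aF : Antitone F := fun i j h => Set.union_subset_union_right _ (b2 (hφ.monotone h))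
  have nF : ∀ n, μ01 (F n) ≠ 0 := fun n => nn_mono Set.subset_union_right (b4 (φ n))
  have dF : ∀ n, μ01 (F n \ F (n + 1)) ≠ 0 := fun n =>
    nn_mono (fun y hy => ⟨Or.inr hy.1, fun h => h.elim (hbC _ hy.1) hy.2⟩)
      (b5 (φ n) (φ (n + 1)) (hφ (Nat.lt_succ_self n)))
  have hFf : ∀ n, Fx a x ((1 / 2) ^ n) (F n) := hφf
  by_cases hC0 : μ01 C = 0
  · obtain ⟨Z, hZ, hZF, hZ0, hZ1⟩ := split (hF 0) (nF 0)
    obtain ⟨e, e1, e2, e3, e4, e5, -⟩ := shrink ((hF 0).diff hZ) hZ1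
    have heZ : ∀ n, e n ⊆ F 0 \ Z := fun n => by rw [← e3]; exact e2 (Nat.zero_le n)
    have hE : ∀ n, MeasurableSet (Z ∪ e n) := fun n => hZ.union (e1 n)
    obtain ⟨g, hgm, hga⟩ := chain (E := fun n => Z ∪ e n) hF hE aF
      (fun i j h => Set.union_subset_union_right _ (e2 h))
      (by change Z ∪ e 0 = F 0; rw [e3, Set.union_sdiff_cancel hZF]) nF
      (fun n => nn_mono Set.subset_union_left hZ0) dF
      (fun n => nn_mono (fun y hy => ⟨Or.inr hy.1, fun h => h.elim (heZ _ hy.1).2 hy.2⟩)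
        (e5 n (n + 1) (Nat.lt_succ_self n)))
    obtain ⟨y, hy⟩ := limit ha hFf hga
    obtain ⟨γ, rfl⟩ := htrans x y
    have fZ : Fx a (a γ x) 0 Z := by
      intro T hT
      have t1 : Filter.Tendsto (fun n => dist (a T (a (g n) x)) (a (g n) x)) Filter.atTop
          (nhds (dist (a T (a γ x)) (a γ x))) :=
        (((ha.iso T).continuous.tendsto _).comp hy).dist hy
      have t2 : Filter.Tendsto (fun n : ℕ => ((1 / 2 : ℝ)) ^ n) Filter.atTop (nhds 0) :=
        tendsto_pow_atTop_nhds_zero_of_lt_one (by norm_num) (by norm_num)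
      refine le_of_tendsto_of_tendsto' t1 t2 fun n => ?_
      have := hFf n _ ((hT.mono hZ (hE n) Set.subset_union_left).conj (hE n) (hF n) (hgm n).inv)
      rw [← (ha.iso (g n)).dist_eq, ← ha.mul] at this
      rw [← ha.mul]
      have eg : T * g n = g n * ((g n)⁻¹ * T * (g n)⁻¹⁻¹) := by group
      rw [eg]
      exact this
    obtain ⟨Q, hQ, hQm⟩ := exists_maps γ⁻¹ hZ
    have fQ := conj_fx ha hZ hQ hQm fZ
    rw [ha.inv_apply] at fQ
    have := hmax Q hQ fQ
    apply hZ0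
    rw [hQm.null hZ hQ]
    refine null_mono ?_ (measure_union_null this hC0)
    intro z hz
    by_cases hzC : z ∈ C
    · exact Or.inr hzC
    · exact Or.inl ⟨hz, hzC⟩
  · obtain ⟨E, hE, aE, E0, nE, dE, iE⟩ := shrink (hF 0) (nF 0)
    obtain ⟨g, hgm, hga⟩ := chain hF hE aF aE E0 nF nE dF (fun n => dE n (n + 1) (Nat.lt_succ_self n))
    obtain ⟨y, hy⟩ := limit ha hFf hga
    obtain ⟨γ, rfl⟩ := htrans x y
    obtain ⟨D, hD, hDm⟩ := exists_maps γ hC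
    have fD := conj_fx ha hC hD hDm f
    obtain ⟨k, hk⟩ : ∃ k, μ01 (D \ E k) ≠ 0 := by
      by_contra hcon
      push Not at hcon
      apply hC0
      rw [hDm.null hC hD]
      have h1 : μ01 (⋃ k, D \ E k) = 0 := measure_iUnion_null hcon
      rw [← Set.sdiff_iInter] at h1
      refine null_mono ?_ (measure_union_null h1 iE)
      intro z hz
      by_cases hzC : z ∈ ⋂ n, E n
      · exact Or.inr hzC
      · exact Or.inl ⟨hz, hzC⟩
    have hD' := hD.diff (hE k)
    obtain ⟨Q, hQ, hQm⟩ := exists_maps (g k)⁻¹ hD'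
    have hQF : μ01 (Q ∩ F k) = 0 := by
      rw [← (hQm.inter hD' hQ (hE k) (hF k) (hgm k).inv).null (hD'.inter (hE k)) (hQ.inter (hF k))]
      rw [Set.sdiff_inter_self, measure_empty]
    have fQ : Fx a x 0 Q := by
      intro u hu
      have hw := hu.conj hQ hD' hQm.inv
      rw [inv_inv] at hw
      have hwy := fD _ (hw.mono hD' hD Set.sdiff_subset)
      set w := g k * u * (g k)⁻¹ with hwdef
      refine le_trans ?_ hwy
      have t1 : Filter.Tendsto (fun n => dist (a w (a (g n) x)) (a (g n) x)) Filter.atTop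
          (nhds (dist (a w (a γ x)) (a γ x))) :=
        (((ha.iso w).continuous.tendsto _).comp hy).dist hy
      refine ge_of_tendsto t1 ?_
      filter_upwards [Filter.eventually_ge_atTop k] with n hn
      have hcm := Aut.comm hQ (hF k) hQF hu (hga k n hn)
      have e : w * g n = g n * u := by
        calc w * g n = g k * (u * ((g k)⁻¹ * g n)) := by rw [hwdef]; group
          _ = g n * u := by rw [hcm]; group
      rw [← ha.mul, e, ha.mul, (ha.iso (g n)).dist_eq]
    have := hmax Q hQ fQ
    apply hk
    rw [hQm.null hD' hQ]
    refine null_mono ?_ (measure_union_null this hQF)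
    intro z hz
    by_cases hzC : z ∈ C
    · exact Or.inr ⟨hz, Or.inl hzC⟩
    · exact Or.inl ⟨hz, hzC⟩
end

theorem stmt_1 (X : Type*) [MetricSpace X] [CompleteSpace X] [Nonempty X]
    (a : G2 → X → X)
    (hone : ∀ x : X, a G2one x = x)
    (hmul : ∀ (S T : G2) (x : X), a (G2mul S T) x = a S (a T x))
    (hcont : Continuous fun p : G2 × X => a p.1 p.2)
    (hiso : ∀ g : G2, Isometry (a g))
    (htrans : ∀ x y : X, ∃ g : G2, a g x = y) :
    Subsingleton X := by
  have ha : Act a := ⟨hone, hmul, hcont, hiso⟩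
  refine ⟨fun x y => ?_⟩
  obtain ⟨C, hC, f, hmax⟩ := exists_max ha x
  have h0 := contra ha htrans x hC f hmax
  obtain ⟨g, rfl⟩ := htrans x y
  have : Aut C g := by
    unfold Aut; rw [(P_eq_zero hC.compl).2 h0, mul_zero]
  exact (dist_le_zero.1 (f g this)).symm
end

section
/- Let G = Homeo⁺[0,1] be the group of homeomorphisms of [0,1] fixing 0 and 1, with the topology of uniform convergence. If G acts on a nonempty complete metric space X by isometries, with jointly continuous action, and the action is transitive (for all x, y ∈ X there is g ∈ G with g·x = y), then X consists of a single point. -/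
/-- The group `Homeo⁺[0,1]` of homeomorphisms of `[0,1]` fixing the endpoints. -/
def HomeoPlus : Type :=
  {g : unitInterval ≃ₜ unitInterval // g 0 = 0 ∧ g 1 = 1}

instance : Group HomeoPlus where
  mul f g := ⟨g.1.trans f.1, by
    constructor
    · show f.1 (g.1 0) = 0
      rw [g.2.1, f.2.1]
    · show f.1 (g.1 1) = 1
      rw [g.2.2, f.2.2]⟩
  one := ⟨Homeomorph.refl _, rfl, rfl⟩
  inv f := ⟨f.1.symm,
    f.1.toEquiv.symm_apply_eq.mpr f.2.1.symm,
    f.1.toEquiv.symm_apply_eq.mpr f.2.2.symm⟩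
  mul_assoc a b c := Subtype.ext (Homeomorph.ext fun _ => rfl)
  one_mul a := Subtype.ext (Homeomorph.ext fun _ => rfl)
  mul_one a := Subtype.ext (Homeomorph.ext fun _ => rfl)
  inv_mul_cancel a := Subtype.ext (Homeomorph.ext fun x => a.1.symm_apply_apply x)

/-- The topology of uniform convergence on `Homeo⁺[0,1]`, induced from the
sup metric on `C([0,1], [0,1])`. -/
instance : TopologicalSpace HomeoPlus :=
  TopologicalSpace.induced
    (fun g : HomeoPlus => (⟨⇑g.1, g.1.continuous⟩ : C(unitInterval, unitInterval)))
    inferInstance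

namespace HP

open Set Filter Topology

theorem mul_app (f g : HomeoPlus) (t : unitInterval) : (f * g).1 t = f.1 (g.1 t) := rfl

theorem inv_app (f : HomeoPlus) (t : unitInterval) : (f⁻¹).1 (f.1 t) = t :=
  f.1.symm_apply_apply t

theorem app_inv (f : HomeoPlus) (t : unitInterval) : f.1 ((f⁻¹).1 t) = t :=
  f.1.apply_symm_apply t

theorem smono (g : HomeoPlus) : StrictMono g.1 := by
  apply Continuous.strictMono_of_inj_boundedOrder g.1.continuous _ g.1.injective
  have h0 : g.1 ⊥ = 0 := g.2.1
  rw [h0]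
  exact unitInterval.nonneg'

theorem exists_homeo (f : ℝ → ℝ) (hf : Continuous f) (hm : StrictMonoOn f (Icc 0 1))
    (h0 : f 0 = 0) (h1 : f 1 = 1) :
    ∃ g : HomeoPlus, ∀ t : unitInterval, (g.1 t : ℝ) = f t := by
  have hmem : ∀ t : unitInterval, f t ∈ Icc (0 : ℝ) 1 := by
    intro t
    constructor
    · rw [← h0]; exact hm.monotoneOn (by simp) t.2 t.2.1
    · rw [← h1]; exact hm.monotoneOn t.2 (by simp) t.2.2
  let F : unitInterval → unitInterval := fun t => ⟨f t, hmem t⟩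
  have hF : StrictMono F := fun a b hab => hm a.2 b.2 hab
  have hs : Function.Surjective F := by
    intro y
    have := intermediate_value_Icc (zero_le_one (α := ℝ)) hf.continuousOn
    rw [h0, h1] at this
    obtain ⟨t, ht, hty⟩ := this y.2
    exact ⟨⟨t, ht⟩, Subtype.ext hty⟩
  refine ⟨⟨(hF.orderIsoOfSurjective F hs).toHomeomorph, ?_, ?_⟩, ?_⟩
  · exact Subtype.ext h0
  · exact Subtype.ext h1
  · intro t; rfl

section act

variable {X : Type*} [MetricSpace X] [MulAction HomeoPlus X]

theorem cont_left (hc : Continuous fun p : HomeoPlus × X => p.1 • p.2) (k : HomeoPlus) (x : X)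
    {ε : ℝ} (hε : 0 < ε) :
    ∃ δ > 0, ∀ g : HomeoPlus, (∀ t, dist (g.1 t) (k.1 t) ≤ δ) → dist (g • x) (k • x) < ε := by
  have h1 : Continuous fun g : HomeoPlus => g • x := hc.comp (by fun_prop : Continuous fun g : HomeoPlus => (g, x))
  have h2 : {g : HomeoPlus | dist (g • x) (k • x) < ε} ∈ 𝓝 k :=
    h1.continuousAt.eventually (Metric.ball_mem_nhds _ hε)
  rw [nhds_induced, mem_comap] at h2
  obtain ⟨V, hV, hVs⟩ := h2
  obtain ⟨r, hr, hrV⟩ := Metric.mem_nhds_iff.1 hV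
  refine ⟨r / 2, by positivity, fun g hg => ?_⟩
  apply hVs
  apply hrV
  rw [Metric.mem_ball]
  refine lt_of_le_of_lt ((ContinuousMap.dist_le (by positivity)).2 hg) (by linarith)

theorem near (hc : Continuous fun p : HomeoPlus × X => p.1 • p.2) (x : X)
    {ε : ℝ} (hε : 0 < ε) :
    ∃ δ > 0, ∀ g : HomeoPlus, (∀ t, dist (g.1 t) t ≤ δ) → dist (g • x) x < ε := by
  obtain ⟨δ, hδ, h⟩ := cont_left hc 1 x hε
  refine ⟨δ, hδ, fun g hg => ?_⟩
  simpa using h g hg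

theorem collapse [CompleteSpace X]
    (hc : Continuous fun p : HomeoPlus × X => p.1 • p.2)
    (hiso : ∀ g : HomeoPlus, Isometry fun x : X => g • x)
    (φ : ℝ → ℝ) (hφ : Continuous φ) (hm : Monotone φ) (h0 : φ 0 = 0) (h1 : φ 1 = 1) (x : X) :
    ∃ (g : ℕ → HomeoPlus) (y : X),
      (∀ n t, (((g n)⁻¹).1 t : ℝ) = φ t + (1 / ((n : ℝ) + 1)) * (t - φ t)) ∧
      Tendsto (fun n => g n • x) atTop (𝓝 y) ∧
      ∀ u : HomeoPlus, (∀ t : unitInterval, φ (u.1 t) = φ t) → u • y = y := by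
  have key : ∀ n : ℕ, ∃ k : HomeoPlus, ∀ t : unitInterval,
      (k.1 t : ℝ) = φ t + (1 / ((n : ℝ) + 1)) * (t - φ t) := by
    intro n
    apply exists_homeo (fun t => φ t + (1 / ((n : ℝ) + 1)) * (t - φ t))
    · fun_prop
    · intro a _ b _ hab
      have e1 : 0 < 1 / ((n : ℝ) + 1) := by positivity
      have e2 : 1 / ((n : ℝ) + 1) ≤ 1 := by
        rw [div_le_one (by positivity)]; linarith [(Nat.cast_nonneg n : (0 : ℝ) ≤ n)]
      have e3 := hm hab.le
      show φ a + (1 / ((n : ℝ) + 1)) * (a - φ a) < φ b + (1 / ((n : ℝ) + 1)) * (b - φ b)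
      nlinarith [mul_nonneg (sub_nonneg.2 e2) (sub_nonneg.2 e3), mul_pos e1 (sub_pos.2 hab)]
    · simp [h0]
    · simp [h1]
  choose k hk using key
  have bd : ∀ t : unitInterval, |(t : ℝ) - φ t| ≤ 1 := by
    intro t
    have a1 := hm t.2.1
    have a2 := hm t.2.2
    have a3 := t.2.1
    have a4 := t.2.2
    rw [h0] at a1
    rw [h1] at a2
    rw [abs_le]; constructor <;> linarith
  have close : ∀ n t, |((k n).1 t : ℝ) - φ t| ≤ 1 / ((n : ℝ) + 1) := by
    intro n t
    rw [hk, add_sub_cancel_left, abs_mul, abs_of_pos (by positivity)]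
    exact mul_le_of_le_one_right (by positivity) (bd t)
  have dsm : ∀ (g : HomeoPlus) (a b : X), dist (g⁻¹ • a) b = dist a (g • b) := by
    intro g a b
    have := (hiso g).dist_eq (g⁻¹ • a) b
    simp only [smul_inv_smul] at this
    exact this.symm
  have small : ∀ δ > 0, ∃ N : ℕ, ∀ n ≥ N, 1 / ((n : ℝ) + 1) ≤ δ := by
    intro δ hδ
    obtain ⟨N, hN⟩ := exists_nat_one_div_lt hδ
    exact ⟨N, fun n hn => (Nat.one_div_le_one_div hn).trans hN.le⟩
  have cau : CauchySeq fun n => (k n)⁻¹ • x := by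
    rw [Metric.cauchySeq_iff]
    intro ε hε
    obtain ⟨δ, hδ, hd⟩ := near hc x hε
    obtain ⟨N, hN⟩ := small (δ / 2) (by positivity)
    refine ⟨N, fun m hmN n hnN => ?_⟩
    rw [dsm, dist_comm, smul_smul]
    apply hd
    intro t
    obtain ⟨r, rfl⟩ : ∃ r, (k n).1 r = t := (k n).1.surjective t
    rw [mul_app, inv_app, Subtype.dist_eq, Real.dist_eq]
    have b1 := close m r
    have b2 := close n r
    have b3 := hN m hmN
    have b4 := hN n hnN
    rw [abs_le] at *
    constructor <;> linarith
  obtain ⟨y, hy⟩ := cauchySeq_tendsto_of_complete cau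
  refine ⟨fun n => (k n)⁻¹, y, ?_, hy, ?_⟩
  · intro n t
    rw [inv_inv]
    exact hk n t
  · intro u hu
    have t1 : Tendsto (fun n => u • (k n)⁻¹ • x) atTop (𝓝 (u • y)) :=
      ((hiso u).continuous.tendsto y).comp hy
    have t2 : Tendsto (fun n => dist (u • (k n)⁻¹ • x) ((k n)⁻¹ • x)) atTop (𝓝 0) := by
      rw [Metric.tendsto_atTop]
      intro ε hε
      obtain ⟨δ, hδ, hd⟩ := near hc x hε
      obtain ⟨N, hN⟩ := small (δ / 2) (by positivity)
      refine ⟨N, fun n hn => ?_⟩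
      rw [Real.dist_eq, sub_zero, abs_of_nonneg dist_nonneg, dist_comm, dsm, dist_comm,
        smul_smul, smul_smul]
      apply hd
      intro t
      obtain ⟨r, rfl⟩ : ∃ r, (k n).1 r = t := (k n).1.surjective t
      rw [mul_app, mul_app, inv_app, Subtype.dist_eq, Real.dist_eq]
      have b1 := close n (u.1 r)
      have b2 := close n r
      rw [hu] at b1
      have b4 := hN n hn
      rw [abs_le] at *
      constructor <;> linarith
    exact dist_eq_zero.1 (tendsto_nhds_unique (t1.dist hy) t2)

variable (X) in
def Fx (b : unitInterval) : Set X := {x | ∀ h : HomeoPlus, (∀ t, b ≤ t → h.1 t = t) → h • x = x}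

theorem Fx_anti {b c : unitInterval} (h : b ≤ c) : Fx X c ⊆ Fx X b :=
  fun _ hx k hk => hx k fun t ht => hk t (h.trans ht)

theorem Fx_closed (hiso : ∀ g : HomeoPlus, Isometry fun x : X => g • x) (b : unitInterval) :
    IsClosed (Fx X b) := by
  have : Fx X b = ⋂ (h : HomeoPlus) (_ : ∀ t, b ≤ t → h.1 t = t), {x : X | h • x = x} := by
    ext x; simp [Fx]
  rw [this]
  exact isClosed_iInter fun h => isClosed_iInter fun _ =>
    isClosed_eq (hiso h).continuous continuous_id

theorem Fx_smul {b : unitInterval} {x : X} (hx : x ∈ Fx X b) (g : HomeoPlus) :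
    g • x ∈ Fx X (g.1 b) := by
  intro h hh
  have := hx (g⁻¹ * h * g) (fun t ht => by
    rw [mul_app, mul_app, hh _ ((smono g).monotone ht), inv_app])
  rw [mul_smul, mul_smul, inv_smul_eq_iff] at this
  exact this

noncomputable def s (x : X) : unitInterval := sSup {b | x ∈ Fx X b}

theorem mem_of_lt {b : unitInterval} {x : X} (h : b < s x) : x ∈ Fx X b := by
  obtain ⟨c, hc, hbc⟩ := lt_sSup_iff.1 h
  exact Fx_anti hbc.le hc

theorem le_s {b : unitInterval} {x : X} (h : x ∈ Fx X b) : b ≤ s x := le_sSup h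

theorem s_smul_ge (g : HomeoPlus) (x : X) : g.1 (s x) ≤ s (g • x) := by
  by_contra! h
  have h2 := smono g⁻¹ h
  rw [inv_app] at h2
  obtain ⟨c, hc, hbc⟩ := lt_sSup_iff.1 h2
  have h3 := smono g hbc
  rw [app_inv] at h3
  exact absurd (le_s (Fx_smul hc g)) (not_le.2 h3)

theorem s_smul (g : HomeoPlus) (x : X) : s (g • x) = g.1 (s x) := by
  apply le_antisymm _ (s_smul_ge g x)
  have := (smono g).monotone (s_smul_ge g⁻¹ (g • x))
  rwa [app_inv, inv_smul_smul] at this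

theorem generic [CompleteSpace X] [Nonempty X]
    (hiso : ∀ g : HomeoPlus, Isometry fun x : X => g • x)
    (htrans : ∀ x y : X, ∃ g : HomeoPlus, g • x = y) (y : X) (b : unitInterval)
    (hb : b < s y) : y ∈ interior (Fx X b) := by
  obtain ⟨D, hD, hDd⟩ := TopologicalSpace.exists_countable_dense unitInterval
  have hden : Dense (⋂ d ∈ D, (frontier (Fx X d))ᶜ) := by
    apply dense_biInter_of_isOpen
    · intro d _
      exact isClosed_frontier.isOpen_compl
    · exact hD
    · intro d _
      rw [← interior_eq_empty_iff_dense_compl]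
      exact interior_frontier (Fx_closed hiso d)
  obtain ⟨x, hx⟩ := hden.nonempty
  simp only [mem_iInter] at hx
  have hQ : ∀ b < s x, x ∈ interior (Fx X b) := by
    intro b hb
    obtain ⟨d, hd, h1, h2⟩ := hDd.exists_between hb
    have h3 : x ∈ Fx X d := mem_of_lt h2
    have h4 := hx d hd
    rw [(Fx_closed hiso d).frontier_eq] at h4
    have h5 : x ∈ interior (Fx X d) := by
      by_contra h6
      exact h4 ⟨h3, h6⟩
    exact interior_mono (Fx_anti h1.le) h5
  obtain ⟨g, rfl⟩ := htrans x y
  rw [s_smul] at hb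
  have h1 := smono g⁻¹ hb
  rw [inv_app] at h1
  have h2 := hQ _ h1
  rw [mem_interior_iff_mem_nhds] at h2 ⊢
  have h3 : Tendsto (fun z : X => g⁻¹ • z) (𝓝 (g • x)) (𝓝 x) := by
    have := (hiso g⁻¹).continuous.tendsto (g • x)
    simpa only [inv_smul_smul] using this
  filter_upwards [h3 h2] with z hz
  have := Fx_smul hz g
  rwa [app_inv, smul_inv_smul] at this

theorem s_pos [CompleteSpace X]
    (hc : Continuous fun p : HomeoPlus × X => p.1 • p.2)
    (hiso : ∀ g : HomeoPlus, Isometry fun x : X => g • x)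
    (htrans : ∀ x y : X, ∃ g : HomeoPlus, g • x = y) (x : X) : s x ≠ 0 := by
  obtain ⟨g, y, -, -, hu⟩ := collapse hc hiso (fun t => max (2 * t - 1) 0) (by fun_prop)
    (by intro a b hab; exact max_le_max (by linarith) le_rfl) (by norm_num) (by norm_num) x
  have hy : y ∈ Fx X ⟨1 / 2, by norm_num, by norm_num⟩ := by
    intro h hh
    apply hu
    intro t
    rcases le_total (⟨1 / 2, by norm_num, by norm_num⟩ : unitInterval) t with ht | ht
    · rw [hh t ht]
    · have h1 := (smono h).monotone ht
      rw [hh _ le_rfl] at h1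
      have h2 : (t : ℝ) ≤ 1 / 2 := ht
      have h3 : (h.1 t : ℝ) ≤ 1 / 2 := h1
      show max (2 * (h.1 t : ℝ) - 1) 0 = max (2 * (t : ℝ) - 1) 0
      rw [max_eq_right (by linarith), max_eq_right (by linarith)]
  obtain ⟨g', rfl⟩ := htrans x y
  intro h0
  have h1 := le_s hy
  rw [s_smul, h0, g'.2.1] at h1
  have h2 : (1 / 2 : ℝ) ≤ 0 := h1
  norm_num at h2

theorem move (c : unitInterval) (h0 : c ≠ 0) (h1 : c ≠ 1) :
    ∃ g : HomeoPlus, (g.1 c : ℝ) = 1 / 2 := by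
  have c0 : 0 < (c : ℝ) := unitInterval.pos_iff_ne_zero.2 h0
  have c1 : (c : ℝ) < 1 := unitInterval.lt_one_iff_ne_one.2 h1
  have c2 : 0 < 1 - (c : ℝ) := by linarith
  -- concave or convex two-slope map
  have a0 : 0 < 1 / (2 * (c : ℝ)) := by positivity
  have a1 : 0 < 1 / (2 * (1 - (c : ℝ))) := by positivity
  rcases le_total (c : ℝ) (1 / 2) with hle | hle
  · obtain ⟨g, hg⟩ := exists_homeo
      (fun t => min (1 / (2 * (c : ℝ)) * t) (1 - 1 / (2 * (1 - (c : ℝ))) * (1 - t))) (by fun_prop)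
      (by
        intro a _ b _ hab
        exact min_lt_min (by nlinarith) (by nlinarith))
      (by
        have : 1 / (2 * (1 - (c : ℝ))) ≤ 1 := by rw [div_le_one (by positivity)]; linarith
        simp only [mul_zero, sub_zero, mul_one]
        exact min_eq_left (by linarith))
      (by
        have : 1 ≤ 1 / (2 * (c : ℝ)) := by rw [le_div_iff₀ (by positivity)]; linarith
        simp only [mul_one, sub_self, mul_zero, sub_zero]
        exact min_eq_right this)
    refine ⟨g, ?_⟩
    rw [hg]
    have e1 : 1 / (2 * (c : ℝ)) * c = 1 / 2 := by field_simp
    have e2 : 1 / (2 * (1 - (c : ℝ))) * (1 - c) = 1 / 2 := by field_simp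
    rw [e1, e2]; norm_num
  · obtain ⟨g, hg⟩ := exists_homeo
      (fun t => max (1 / (2 * (c : ℝ)) * t) (1 - 1 / (2 * (1 - (c : ℝ))) * (1 - t))) (by fun_prop)
      (by
        intro a _ b _ hab
        exact max_lt_max (by nlinarith) (by nlinarith))
      (by
        have : 1 ≤ 1 / (2 * (1 - (c : ℝ))) := by rw [le_div_iff₀ (by positivity)]; linarith
        simp only [mul_zero, sub_zero, mul_one]
        exact max_eq_left (by linarith))
      (by
        have : 1 / (2 * (c : ℝ)) ≤ 1 := by rw [div_le_one (by positivity)]; linarith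
        simp only [mul_one, sub_self, mul_zero, sub_zero]
        exact max_eq_right this)
    refine ⟨g, ?_⟩
    rw [hg]
    have e1 : 1 / (2 * (c : ℝ)) * c = 1 / 2 := by field_simp
    have e2 : 1 / (2 * (1 - (c : ℝ))) * (1 - c) = 1 / 2 := by field_simp
    rw [e1, e2]; norm_num

theorem exists_bump : ∃ u : HomeoPlus, ∀ t : unitInterval,
    (u.1 t : ℝ) = max (t : ℝ) (min (1 / 4 + 3 / 2 * ((t : ℝ) - 1 / 4)) (3 / 4 + 1 / 2 * (t - 3 / 4))) := by
  apply exists_homeo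
    (fun t => max t (min (1 / 4 + 3 / 2 * (t - 1 / 4)) (3 / 4 + 1 / 2 * (t - 3 / 4))))
  · fun_prop
  · intro a _ b _ hab
    exact max_lt_max hab (min_lt_min (by linarith) (by linarith))
  · norm_num
  · norm_num

theorem s_eq_one [CompleteSpace X] [Nonempty X]
    (hc : Continuous fun p : HomeoPlus × X => p.1 • p.2)
    (hiso : ∀ g : HomeoPlus, Isometry fun x : X => g • x)
    (htrans : ∀ x y : X, ∃ g : HomeoPlus, g • x = y) (x₀ : X) : s x₀ = 1 := by
  by_contra h1
  obtain ⟨g₀, hg₀⟩ := move (s x₀) (s_pos hc hiso htrans x₀) h1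
  set x := g₀ • x₀ with hxdef
  let half : unitInterval := ⟨1 / 2, by norm_num, by norm_num⟩
  have hx : s x = half := by
    rw [hxdef, s_smul]; exact Subtype.ext hg₀
  let φ : ℝ → ℝ := fun t => min (2 * t) (max (1 / 2) (2 * t - 1))
  have φmid : ∀ t : ℝ, 1 / 4 ≤ t → t ≤ 3 / 4 → φ t = 1 / 2 := by
    intro t h1 h2
    show min (2 * t) (max (1 / 2) (2 * t - 1)) = 1 / 2
    rw [max_eq_left (by linarith), min_eq_right (by linarith)]
  obtain ⟨g, y, hg, hy, hu⟩ := collapse hc hiso φ (by fun_prop)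
    (by intro a b hab; exact min_le_min (by linarith) (max_le_max le_rfl (by linarith)))
    (by norm_num [φ]) (by norm_num [φ]) x
  have hgh : ∀ n, (g n).1 half = half := by
    intro n
    have h : ((g n)⁻¹).1 half = half := by
      apply Subtype.ext
      rw [hg]
      show φ (1 / 2) + _ * ((1 / 2 : ℝ) - φ (1 / 2)) = 1 / 2
      rw [φmid _ (by norm_num) (by norm_num)]
      simp
    have := app_inv (g n) half
    rwa [h] at this
  have sg : ∀ n, s (g n • x) = half := fun n => by rw [s_smul, hx, hgh]
  have ge : half ≤ s y := by
    apply le_of_forall_lt_imp_le_of_dense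
    intro b hb
    apply le_s
    apply (Fx_closed hiso b).mem_of_tendsto hy
    exact Eventually.of_forall fun n => mem_of_lt (by rw [sg]; exact hb)
  have le : s y ≤ half := by
    apply le_of_forall_lt_imp_le_of_dense
    intro b hb
    have h2 := generic hiso htrans y b hb
    rw [mem_interior_iff_mem_nhds] at h2
    obtain ⟨n, hn⟩ := (hy.eventually h2).exists
    rw [← sg n]
    exact le_s hn
  have hsy : s y = half := le_antisymm le ge
  obtain ⟨u, hub⟩ := exists_bump
  have huy : u • y = y := by
    apply hu
    intro t
    rw [hub]
    rcases le_total (t : ℝ) (1 / 4) with h | h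
    · rw [max_eq_left]
      exact (min_le_left _ _).trans (by linarith)
    · rcases le_total (3 / 4) (t : ℝ) with h' | h'
      · rw [max_eq_left]
        exact (min_le_right _ _).trans (by linarith)
      · rw [φmid t h h', φmid]
        · exact h.trans (le_max_left _ _)
        · exact max_le h' ((min_le_right _ _).trans (by linarith))
  have h5 : s (u • y) = s y := by rw [huy]
  rw [s_smul, hsy] at h5
  have h6 := hub half
  rw [h5] at h6
  have h7 : (half : ℝ) = 1 / 2 := rfl
  rw [h7] at h6
  norm_num at h6

theorem fixed (hc : Continuous fun p : HomeoPlus × X => p.1 • p.2) (x : X) (hx : s x = 1)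
    (h : HomeoPlus) : h • x = x := by
  apply dist_le_zero.1
  apply le_of_forall_pos_le_add
  intro ε hε
  rw [zero_add]
  obtain ⟨δ, hδ, hd⟩ := cont_left hc h x hε
  have huc := CompactSpace.uniformContinuous_of_continuous h.1.continuous
  rw [Metric.uniformContinuous_iff] at huc
  obtain ⟨η, hη, hun⟩ := huc (δ / 2) (by positivity)
  -- choose the scale b
  obtain ⟨e, he0, he1, he2, he3⟩ : ∃ e : ℝ, 0 < e ∧ e < 1 ∧ e < η ∧ e < δ / 4 :=
    ⟨min (1 / 2) (min (η / 2) (δ / 8)), by positivity,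
      (min_le_left _ _).trans_lt (by norm_num),
      ((min_le_right _ _).trans (min_le_left _ _)).trans_lt (by linarith),
      ((min_le_right _ _).trans (min_le_right _ _)).trans_lt (by linarith)⟩
  have hb : 0 < 1 - e := by linarith
  let H : ℝ → ℝ := fun t => (h.1 (projIcc 0 1 zero_le_one t) : ℝ)
  have Hc : Continuous H := continuous_subtype_val.comp (h.1.continuous.comp continuous_projIcc)
  have Hm : Monotone H := fun a b hab => (smono h).monotone (monotone_projIcc _ hab)
  have H0 : H 0 = 0 := by
    show ((h.1 (projIcc 0 1 zero_le_one 0) : unitInterval) : ℝ) = 0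
    rw [projIcc_left]
    exact congrArg Subtype.val h.2.1
  have H1 : ∀ t, 1 ≤ t → H t = 1 := by
    intro t ht
    show ((h.1 (projIcc 0 1 zero_le_one t) : unitInterval) : ℝ) = 1
    rw [projIcc_of_right_le _ ht]
    exact congrArg Subtype.val h.2.2
  have Hs : StrictMonoOn H (Icc 0 1) := fun a ha b hb' hab =>
    (smono h) (strictMonoOn_projIcc zero_le_one ha hb' hab)
  obtain ⟨k, hk⟩ := exists_homeo (fun t => (1 - e) * H (t / (1 - e)) + max (t - (1 - e)) 0)
    (by fun_prop)
    (by
      intro a ha b hb' hab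
      have m1 : H (a / (1 - e)) ≤ H (b / (1 - e)) := Hm (by gcongr)
      show (1 - e) * H (a / (1 - e)) + max (a - (1 - e)) 0 <
        (1 - e) * H (b / (1 - e)) + max (b - (1 - e)) 0
      rcases le_total b (1 - e) with hbe | hbe
      · have m2 : H (a / (1 - e)) < H (b / (1 - e)) := by
          apply Hs
          · exact ⟨div_nonneg ha.1 hb.le, by rw [div_le_one hb]; linarith⟩
          · exact ⟨div_nonneg hb'.1 hb.le, by rw [div_le_one hb]; linarith⟩
          · gcongr
        rw [max_eq_right (by linarith), max_eq_right (by linarith)]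
        nlinarith
      · rcases le_total a (1 - e) with hae | hae
        · rcases hbe.eq_or_lt with h' | h'
          · have m2 : H (a / (1 - e)) < H (b / (1 - e)) := by
              apply Hs
              · exact ⟨div_nonneg ha.1 hb.le, by rw [div_le_one hb]; linarith⟩
              · exact ⟨div_nonneg hb'.1 hb.le, by rw [div_le_one hb]; linarith⟩
              · gcongr
            rw [max_eq_right (by linarith), max_eq_right (by linarith)]
            nlinarith
          · rw [max_eq_right (by linarith), max_eq_left (by linarith)]
            nlinarith
        · rw [max_eq_left (by linarith), max_eq_left (by linarith)]
          nlinarith)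
    (by
      rw [zero_div, H0, max_eq_right (by linarith)]; ring)
    (by
      rw [H1 _ (by rw [le_div_iff₀ hb]; linarith), max_eq_left (by linarith)]; ring)
  have kfix : k • x = x := by
    have hmem : x ∈ Fx X ⟨1 - e, hb.le, by linarith⟩ := by
      apply mem_of_lt
      rw [hx]
      show (1 - e : ℝ) < 1
      linarith
    apply hmem
    intro t ht
    have ht' : 1 - e ≤ (t : ℝ) := ht
    apply Subtype.ext
    rw [hk, H1 _ (by rw [le_div_iff₀ hb]; linarith), max_eq_left (by linarith)]
    ring
  have hclose : ∀ t, dist (k.1 t) (h.1 t) ≤ δ := by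
    intro t
    rw [Subtype.dist_eq, Real.dist_eq, hk]
    have t0 := t.2.1
    have t1 := t.2.2
    let r := projIcc (0 : ℝ) 1 zero_le_one ((t : ℝ) / (1 - e))
    have hr : H ((t : ℝ) / (1 - e)) = (h.1 r : ℝ) := rfl
    have hrt : |(r : ℝ) - t| ≤ e := by
      have : (r : ℝ) = max 0 (min 1 ((t : ℝ) / (1 - e))) := coe_projIcc _ _ _ _
      have p0 : 0 ≤ (t : ℝ) / (1 - e) := div_nonneg t0 hb.le
      rw [this, max_eq_right (le_min zero_le_one p0)]
      rcases le_total (t : ℝ) (1 - e) with hte | hte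
      · rw [min_eq_right (by rw [div_le_one hb]; exact hte)]
        have : (t : ℝ) / (1 - e) * (1 - e) = t := by field_simp
        have q : (t : ℝ) / (1 - e) ≤ 1 := by rw [div_le_one hb]; exact hte
        rw [abs_le]; constructor <;> nlinarith
      · rw [min_eq_left (by rw [le_div_iff₀ hb]; linarith)]
        rw [abs_le]; constructor <;> linarith
    have hd1 := hun (a := r) (b := t) (by
      rw [Subtype.dist_eq, Real.dist_eq]; linarith)
    rw [Subtype.dist_eq, Real.dist_eq] at hd1
    rw [hr]
    have r0 := (h.1 r).2.1
    have r1 := (h.1 r).2.2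
    have m0 : 0 ≤ max ((t : ℝ) - (1 - e)) 0 := le_max_right _ _
    have m1 : max ((t : ℝ) - (1 - e)) 0 ≤ e := max_le (by linarith) he0.le
    rw [abs_lt] at hd1
    rw [abs_le]
    constructor <;> nlinarith
  have := hd k hclose
  rw [kfix, dist_comm] at this
  exact this.le

end act

end HP

/-- A transitive, jointly continuous, isometric action of `Homeo⁺[0,1]` on a nonempty
complete metric space forces the space to be a singleton. -/
theorem stmt_2 (X : Type*) [MetricSpace X] [CompleteSpace X] [Nonempty X]
    [MulAction HomeoPlus X]
    (hc : Continuous fun p : HomeoPlus × X => p.1 • p.2)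
    (hiso : ∀ g : HomeoPlus, Isometry fun x : X => g • x)
    (htrans : ∀ x y : X, ∃ g : HomeoPlus, g • x = y) :
    Subsingleton X := by
  refine ⟨fun x y => ?_⟩
  obtain ⟨g, rfl⟩ := htrans x y
  exact (HP.fixed hc x (HP.s_eq_one hc hiso htrans x) g).symm
end

section
/- Let ρ be a pseudometric on 𝔐 which is continuous with respect to the sup metric and invariant under the Homeo⁺[0,1]-action (ρ(ξ∘g, ζ∘g) = ρ(ξ,ζ) for all g ∈ Homeo⁺[0,1]), and let U_ρ ⊆ (0,1) be the union of all ρ-gaps. Then for all ξ, ζ ∈ 𝔐: ρ(ξ,ζ) = 0 if and only if for every s ∈ [0,1] with ξ(s) ≠ ζ(s) one has (ξ(s) + ζ(s))/2 ∈ U_ρ. -/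
/-- The space `𝔐` of continuous weakly increasing surjections of `[0,1]`, with the
sup metric (inherited from `C([0,1],[0,1])`). -/
def M : Type :=
  {f : C(unitInterval, unitInterval) // Monotone f ∧ Function.Surjective f}

noncomputable instance : MetricSpace M := Subtype.metricSpace

/-- Right composition of `ξ ∈ 𝔐` with an increasing self-homeomorphism `g` of `[0,1]`,
i.e. the action of `g⁻¹ ∈ Homeo⁺[0,1]` on `ξ`. -/
def Mcomp (ξ : M) (g : unitInterval ≃ₜ unitInterval) (hg : Monotone g) : M :=
  ⟨(ξ.1).comp ⟨⇑g, g.continuous⟩, by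
    constructor
    · intro a b hab
      exact ξ.2.1 (hg hab)
    · intro y
      obtain ⟨x, hx⟩ := ξ.2.2 y
      exact ⟨g.symm x, by simpa using hx⟩⟩

/-- `(α,β)` is a `ρ`-gap: a nonempty open subinterval of `(0,1)` for which there are
`ξ, ζ ∈ 𝔐` with `ρ(ξ,ζ) = 0` and, for every `s`, `ξ(s) ≤ α` or `ζ(s) ≥ β`. -/
def IsGap (ρ : M → M → ℝ) (α β : ℝ) : Prop :=
  0 ≤ α ∧ α < β ∧ β ≤ 1 ∧
    ∃ ξ ζ : M, ρ ξ ζ = 0 ∧ ∀ s : unitInterval, (ξ.1 s : ℝ) ≤ α ∨ β ≤ (ζ.1 s : ℝ)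

/-- `U_ρ`, the union of all `ρ`-gaps. -/
def Urho (ρ : M → M → ℝ) : Set ℝ :=
  {t | ∃ α β : ℝ, IsGap ρ α β ∧ t ∈ Set.Ioo α β}


open Filter Topology

namespace GapAux

abbrev I := unitInterval

structure Good (ρ : M → M → ℝ) : Prop where
  refl : ∀ ξ : M, ρ ξ ξ = 0
  symm : ∀ ξ ζ : M, ρ ξ ζ = ρ ζ ξ
  tri : ∀ ξ ζ χ : M, ρ ξ χ ≤ ρ ξ ζ + ρ ζ χ
  cont : Continuous fun p : M × M => ρ p.1 p.2
  inv : ∀ (ξ ζ : M) (g : unitInterval ≃ₜ unitInterval) (hg : Monotone ⇑g),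
      ρ (Mcomp ξ g hg) (Mcomp ζ g hg) = ρ ξ ζ

theorem Good.nonneg {ρ : M → M → ℝ} (h : Good ρ) (ξ ζ : M) : 0 ≤ ρ ξ ζ := by
  have h1 := h.tri ξ ζ ξ
  rw [h.refl, h.symm ζ ξ] at h1
  linarith

theorem M_ext {ξ ζ : M} (h : ∀ s, (ξ.1 s : ℝ) = ζ.1 s) : ξ = ζ := by
  apply Subtype.ext
  ext s
  exact h s

theorem M_le_aux0 (ξ : M) (x : I) : ξ.1 0 ≤ ξ.1 x := ξ.2.1 unitInterval.nonneg'

theorem M_le_aux1 (ξ : M) (x : I) : ξ.1 x ≤ ξ.1 1 := ξ.2.1 unitInterval.le_one'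

theorem M_zero (ξ : M) : ξ.1 0 = 0 := by
  obtain ⟨x, hx⟩ := ξ.2.2 0
  apply le_antisymm
  · exact (M_le_aux0 ξ x).trans hx.le
  · exact unitInterval.nonneg'

theorem M_one (ξ : M) : ξ.1 1 = 1 := by
  obtain ⟨x, hx⟩ := ξ.2.2 1
  apply le_antisymm
  · exact unitInterval.le_one'
  · exact hx.ge.trans (M_le_aux1 ξ x)

theorem M_mono (ξ : M) {s t : I} (h : s ≤ t) : (ξ.1 s : ℝ) ≤ ξ.1 t := ξ.2.1 h

theorem M_cont (ξ : M) : Continuous fun s : I => (ξ.1 s : ℝ) :=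
  continuous_subtype_val.comp ξ.1.continuous

theorem M_surj (ξ : M) {x : ℝ} (h0 : 0 ≤ x) (h1 : x ≤ 1) : ∃ s, (ξ.1 s : ℝ) = x := by
  obtain ⟨s, hs⟩ := ξ.2.2 ⟨x, h0, h1⟩
  exact ⟨s, by rw [hs]⟩

/-- Build an element of `M` from a real valued function. -/
def mkM (f : I → ℝ) (hc : Continuous f) (hm : Monotone f) (h0 : f 0 = 0) (h1 : f 1 = 1) : M :=
  ⟨⟨fun s => ⟨f s, by rw [← h0]; exact hm unitInterval.nonneg',
      by rw [← h1]; exact hm unitInterval.le_one'⟩, by fun_prop⟩, by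
    constructor
    · intro a b hab
      exact hm hab
    · intro y
      have : (y : ℝ) ∈ Set.range f := by
        apply mem_range_of_exists_le_of_exists_ge hc
        · exact ⟨0, by rw [h0]; exact y.2.1⟩
        · exact ⟨1, by rw [h1]; exact y.2.2⟩
      obtain ⟨x, hx⟩ := this
      exact ⟨x, Subtype.ext hx⟩⟩

theorem mkM_val (f : I → ℝ) (hc : Continuous f) (hm : Monotone f) (h0 : f 0 = 0) (h1 : f 1 = 1)
    (s : I) : ((mkM f hc hm h0 h1).1 s : ℝ) = f s := rfl

def idM : M := mkM (fun s => (s : ℝ)) continuous_subtype_val (fun _ _ h => h) rfl rfl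

theorem idM_val (s : I) : (idM.1 s : ℝ) = s := rfl

/-- composition -/
def cM (ξ h : M) : M := ⟨ξ.1.comp h.1, ξ.2.1.comp h.2.1, ξ.2.2.comp h.2.2⟩

theorem cM_val (ξ h : M) (s : I) : (cM ξ h).1 s = ξ.1 (h.1 s) := rfl

def mix (t : ℝ) (h0 : 0 ≤ t) (h1 : t ≤ 1) (ξ ζ : M) : M :=
  mkM (fun s => (1 - t) * ξ.1 s + t * ζ.1 s)
    (((M_cont ξ).const_mul _).add ((M_cont ζ).const_mul _))
    (by
      intro a b hab
      have := M_mono ξ hab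
      have := M_mono ζ hab
      have : 0 ≤ 1 - t := by linarith
      dsimp only
      gcongr)
    (by simp [M_zero]) (by simp [M_one])

theorem mix_val (t : ℝ) (h0 : 0 ≤ t) (h1 : t ≤ 1) (ξ ζ : M) (s : I) :
    ((mix t h0 h1 ξ ζ).1 s : ℝ) = (1 - t) * ξ.1 s + t * ζ.1 s := rfl

theorem M_dist_le {ξ ζ : M} {C : ℝ} (hC : 0 ≤ C) (h : ∀ s, |(ξ.1 s : ℝ) - ζ.1 s| ≤ C) :
    dist ξ ζ ≤ C := by
  change dist ξ.1 ζ.1 ≤ C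
  rw [ContinuousMap.dist_le hC]
  intro s
  exact h s

theorem mix_dist (t : ℝ) (h0 : 0 ≤ t) (h1 : t ≤ 1) (ξ ζ : M) :
    dist (mix t h0 h1 ξ ζ) ξ ≤ t := by
  apply M_dist_le h0
  intro s
  rw [mix_val]
  have a1 := (ξ.1 s).2.1
  have a2 := (ξ.1 s).2.2
  have b1 := (ζ.1 s).2.1
  have b2 := (ζ.1 s).2.2
  rw [abs_le]
  constructor <;> nlinarith

theorem mix_strict (t : ℝ) (h0 : 0 < t) (h1 : t ≤ 1) (ξ ζ : M) (hζ : StrictMono ζ.1) :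
    StrictMono (mix t h0.le h1 ξ ζ).1 := by
  intro a b hab
  have h2 := M_mono ξ hab.le
  have h3 : (ζ.1 a : ℝ) < ζ.1 b := hζ hab
  change ((mix t h0.le h1 ξ ζ).1 a : ℝ) < (mix t h0.le h1 ξ ζ).1 b
  rw [mix_val, mix_val]
  nlinarith

noncomputable def homeo (h : M) (hs : StrictMono h.1) : I ≃ₜ I :=
  (StrictMono.orderIsoOfSurjective h.1 hs h.2.2).toHomeomorph

theorem homeo_val (h : M) (hs : StrictMono h.1) (s : I) : homeo h hs s = h.1 s := rfl

theorem homeo_mono (h : M) (hs : StrictMono h.1) : Monotone (homeo h hs) := h.2.1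

theorem homeo_symm_mono (h : M) (hs : StrictMono h.1) : Monotone (homeo h hs).symm :=
  (StrictMono.orderIsoOfSurjective h.1 hs h.2.2).symm.monotone

theorem cM_cont (ξ : M) : Continuous (cM ξ) :=
  Continuous.subtype_mk ((ContinuousMap.continuous_postcomp ξ.1).comp continuous_subtype_val) _

theorem Good.inv_strict {ρ : M → M → ℝ} (hρ : Good ρ) (ξ ζ h : M) (hs : StrictMono h.1) :
    ρ (cM ξ h) (cM ζ h) = ρ ξ ζ :=
  hρ.inv ξ ζ (homeo h hs) (homeo_mono h hs)

theorem Good.inv_M {ρ : M → M → ℝ} (hρ : Good ρ) (ξ ζ h : M) :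
    ρ (cM ξ h) (cM ζ h) = ρ ξ ζ := by
  have ht : ∀ n : ℕ, (0:ℝ) < 1 / ((n:ℝ) + 1) := fun n => by positivity
  have ht1 : ∀ n : ℕ, 1 / ((n:ℝ) + 1) ≤ 1 := fun n => by
    rw [div_le_one (by positivity)]; linarith [n.cast_nonneg (α := ℝ)]
  let H : ℕ → M := fun n => mix (1 / ((n:ℝ) + 1)) (ht n).le (ht1 n) h idM
  have hH : Tendsto H atTop (𝓝 h) := by
    rw [tendsto_iff_dist_tendsto_zero]
    exact squeeze_zero (fun _ => dist_nonneg) (fun n => mix_dist _ _ _ _ _)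
      tendsto_one_div_add_atTop_nhds_zero_nat
  have h1 : Tendsto (fun n => ρ (cM ξ (H n)) (cM ζ (H n))) atTop (𝓝 (ρ (cM ξ h) (cM ζ h))) :=
    ((hρ.cont.tendsto (cM ξ h, cM ζ h)).comp
      ((((cM_cont ξ).tendsto h).comp hH).prodMk_nhds (((cM_cont ζ).tendsto h).comp hH)))
  have h2 : ∀ n, ρ (cM ξ (H n)) (cM ζ (H n)) = ρ ξ ζ := fun n =>
    hρ.inv_strict _ _ _ (mix_strict _ (ht n) _ _ _ (fun _ _ h => h))
  simp only [h2] at h1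
  exact tendsto_nhds_unique h1 tendsto_const_nhds

/-- Normalisation of a pair. -/
theorem normalize (ξ ζ : M) : ∃ u v m : M, cM u m = ξ ∧ cM v m = ζ ∧
    (∀ s : I, (u.1 s : ℝ) + v.1 s = 2 * s) ∧ (∀ s, (m.1 s : ℝ) = (ξ.1 s + ζ.1 s) / 2) := by
  let m : M := mix (1/2) (by norm_num) (by norm_num) ξ ζ
  have hm : ∀ s, (m.1 s : ℝ) = (ξ.1 s + ζ.1 s) / 2 := fun s => by
    rw [mix_val]; ring
  choose σ hσ using m.2.2
  have key : ∀ s t : I, m.1 s ≤ m.1 t → ξ.1 s ≤ ξ.1 t ∧ ζ.1 s ≤ ζ.1 t := by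
    intro s t hst
    rcases le_total s t with h | h
    · exact ⟨ξ.2.1 h, ζ.2.1 h⟩
    · have h1 := M_mono ξ h
      have h2 := M_mono ζ h
      have h3 : (m.1 s : ℝ) ≤ m.1 t := hst
      rw [hm, hm] at h3
      constructor
      · change (ξ.1 s : ℝ) ≤ ξ.1 t
        linarith
      · change (ζ.1 s : ℝ) ≤ ζ.1 t
        linarith
  have kξ : ∀ s, ξ.1 (σ (m.1 s)) = ξ.1 s := fun s =>
    le_antisymm (key _ _ (hσ _).le).1 (key _ _ (hσ _).ge).1
  have kζ : ∀ s, ζ.1 (σ (m.1 s)) = ζ.1 s := fun s =>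
    le_antisymm (key _ _ (hσ _).le).2 (key _ _ (hσ _).ge).2
  have um : Monotone (fun y => ξ.1 (σ y)) := fun a b hab =>
    (key _ _ (by rw [hσ, hσ]; exact hab)).1
  have vm : Monotone (fun y => ζ.1 (σ y)) := fun a b hab =>
    (key _ _ (by rw [hσ, hσ]; exact hab)).2
  have us : Function.Surjective (fun y => ξ.1 (σ y)) := fun y => by
    obtain ⟨s, hs⟩ := ξ.2.2 y
    exact ⟨m.1 s, by simp only [kξ, hs]⟩
  have vs : Function.Surjective (fun y => ζ.1 (σ y)) := fun y => by
    obtain ⟨s, hs⟩ := ζ.2.2 y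
    exact ⟨m.1 s, by simp only [kζ, hs]⟩
  refine ⟨⟨⟨_, um.continuous_of_surjective us⟩, um, us⟩,
    ⟨⟨_, vm.continuous_of_surjective vs⟩, vm, vs⟩, m, ?_, ?_, ?_, hm⟩
  · apply M_ext; intro s; exact congrArg Subtype.val (kξ s)
  · apply M_ext; intro s; exact congrArg Subtype.val (kζ s)
  · intro s
    have := hm (σ s)
    rw [hσ] at this
    change (ξ.1 (σ s) : ℝ) + ζ.1 (σ s) = _
    linarith

theorem norm_lip {u v : M} (h : ∀ s : I, (u.1 s : ℝ) + v.1 s = 2 * s) :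
    LipschitzWith 2 u.1 := by
  apply LipschitzWith.of_dist_le_mul
  have : ∀ a b : I, a ≤ b → dist (u.1 a) (u.1 b) ≤ (2 : NNReal) * dist a b := by
    intro a b hab
    have h1 := M_mono u hab
    have h2 := M_mono v hab
    have h3 := h a
    have h4 := h b
    have h5 : (a : ℝ) ≤ b := hab
    rw [Subtype.dist_eq, Subtype.dist_eq, Real.dist_eq, Real.dist_eq, abs_of_nonpos (by linarith),
      abs_of_nonpos (by linarith)]
    push_cast
    linarith
  intro a b
  rcases le_total a b with h | h
  · exact this a b h
  · rw [dist_comm, dist_comm a b]; exact this b a h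

theorem compact_lip : IsCompact {u : M | LipschitzWith 2 u.1} := by
  have e : Topology.IsInducing (fun u : M => u.1) := Topology.IsInducing.subtypeVal
  rw [e.isCompact_iff]
  have hcl : IsClosed {f : C(I, I) | Monotone f ∧ f 0 = 0 ∧ f 1 = 1 ∧ LipschitzWith 2 f} := by
    have ev : ∀ s : I, Continuous fun f : C(I, I) => f s := fun s =>
      continuous_eval_const s
    apply IsClosed.and
    · have : {f : C(I, I) | Monotone f} = ⋂ (a : I) (b : I) (_ : a ≤ b), {f | f a ≤ f b} := by
        ext f; simp only [Set.mem_iInter, Set.mem_ofPred_eq]; rfl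
      change IsClosed {f : C(I, I) | Monotone f}
      rw [this]
      exact isClosed_iInter fun a => isClosed_iInter fun b => isClosed_iInter fun _ =>
        isClosed_le (ev a) (ev b)
    apply IsClosed.and (isClosed_eq (ev 0) continuous_const)
    apply IsClosed.and (isClosed_eq (ev 1) continuous_const)
    have : {f : C(I, I) | LipschitzWith 2 f} =
        ⋂ (a : I) (b : I), {f | dist (f a) (f b) ≤ (2 : NNReal) * dist a b} := by
      ext f; simp only [Set.mem_iInter, Set.mem_ofPred_eq, lipschitzWith_iff_dist_le_mul]
    change IsClosed {f : C(I, I) | LipschitzWith 2 f}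
    rw [this]
    exact isClosed_iInter fun a => isClosed_iInter fun b =>
        isClosed_le ((ev a).dist (ev b)) continuous_const
  have himg : (fun u : M => u.1) '' {u : M | LipschitzWith 2 u.1} =
      {f : C(I, I) | Monotone f ∧ f 0 = 0 ∧ f 1 = 1 ∧ LipschitzWith 2 f} := by
    ext f
    constructor
    · rintro ⟨u, hu, rfl⟩
      exact ⟨u.2.1, M_zero u, M_one u, hu⟩
    · rintro ⟨h1, h2, h3, h4⟩
      refine ⟨mkM (fun s => f s) (continuous_subtype_val.comp f.continuous) (fun a b h => h1 h)
        (by simp [h2]) (by simp [h3]), ?_, ?_⟩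
      · exact h4
      · rfl
  rw [himg]
  let hiso := (ContinuousMap.isometryEquivBoundedOfCompact I I)
  have := BoundedContinuousFunction.arzela_ascoli₁
    (hiso '' {f : C(I, I) | Monotone f ∧ f 0 = 0 ∧ f 1 = 1 ∧ LipschitzWith 2 f})
    (hiso.toHomeomorph.isClosedMap _ hcl)
    (by
      apply UniformEquicontinuous.equicontinuous
      apply LipschitzWith.uniformEquicontinuous _ 2
      rintro ⟨_, f, hf, rfl⟩
      exact hf.2.2.2)
  exact (hiso.toHomeomorph.isInducing.isCompact_iff).2 this

/-- points on null curves -/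
def R (ρ : M → M → ℝ) (x y : ℝ) : Prop :=
  ∃ u v : M, ρ u v = 0 ∧ (∀ s : I, (u.1 s : ℝ) + v.1 s = 2 * s) ∧
    ∃ s : I, (u.1 s : ℝ) = x ∧ (v.1 s : ℝ) = y

theorem Good.limit {ρ : M → M → ℝ} (hρ : Good ρ) {x y : ℝ}
    (h : ∀ ε > 0, ∃ (ξ ζ : M) (s : I), ρ ξ ζ < ε ∧ |(ξ.1 s : ℝ) - x| < ε ∧ |(ζ.1 s : ℝ) - y| < ε) :
    R ρ x y := by
  have ht : ∀ n : ℕ, (0:ℝ) < 1 / ((n:ℝ) + 1) := fun n => by positivity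
  have hlim : Tendsto (fun n : ℕ => 1 / ((n:ℝ) + 1)) atTop (𝓝 0) :=
    tendsto_one_div_add_atTop_nhds_zero_nat
  have h1 : ∀ n : ℕ, ∃ p : M × M × I,
      p ∈ {u : M | LipschitzWith 2 u.1} ×ˢ ({u : M | LipschitzWith 2 u.1} ×ˢ (Set.univ : Set I)) ∧
      ρ p.1 p.2.1 < 1 / ((n:ℝ) + 1) ∧ |(p.1.1 p.2.2 : ℝ) - x| < 1 / ((n:ℝ) + 1) ∧
      |(p.2.1.1 p.2.2 : ℝ) - y| < 1 / ((n:ℝ) + 1) ∧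
      ∀ s : I, (p.1.1 s : ℝ) + p.2.1.1 s = 2 * s := by
    intro n
    obtain ⟨ξ, ζ, s, a1, a2, a3⟩ := h _ (ht n)
    obtain ⟨u, v, m, rfl, rfl, b3, -⟩ := normalize ξ ζ
    rw [hρ.inv_M] at a1
    refine ⟨(u, v, m.1 s), ⟨norm_lip b3, norm_lip (u := v) (v := u) ?_, trivial⟩, a1, a2, a3, b3⟩
    intro s; rw [add_comm]; exact b3 s
  choose p hpK hp1 hp2 hp3 hp4 using h1
  obtain ⟨q, -, φ, hφ, hq⟩ := (compact_lip.prod (compact_lip.prod isCompact_univ)).tendsto_subseq hpK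
  have hlim' := hlim.comp hφ.tendsto_atTop
  have e1 : Continuous fun p : M × M × I => (p.1.1 p.2.2 : ℝ) :=
    continuous_subtype_val.comp
      ((continuous_subtype_val.comp continuous_fst).eval (continuous_snd.comp continuous_snd))
  have e2 : Continuous fun p : M × M × I => (p.2.1.1 p.2.2 : ℝ) :=
    continuous_subtype_val.comp ((continuous_subtype_val.comp
      (continuous_fst.comp continuous_snd)).eval (continuous_snd.comp continuous_snd))
  have e3 : Continuous fun p : M × M × I => ρ p.1 p.2.1 :=
    hρ.cont.comp (continuous_fst.prodMk (continuous_fst.comp continuous_snd))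
  refine ⟨q.1, q.2.1, ?_, ?_, q.2.2, ?_, ?_⟩
  · apply le_antisymm _ (hρ.nonneg _ _)
    exact le_of_tendsto_of_tendsto' ((e3.tendsto q).comp hq) hlim' (fun n => (hp1 _).le)
  · intro s
    have c1 : Continuous fun p : M × M × I => (p.1.1 s : ℝ) + p.2.1.1 s :=
      (continuous_subtype_val.comp ((continuous_subtype_val.comp continuous_fst).eval
        continuous_const)).add (continuous_subtype_val.comp ((continuous_subtype_val.comp
      (continuous_fst.comp continuous_snd)).eval continuous_const))
    have := (c1.tendsto q).comp hq
    refine tendsto_nhds_unique this (tendsto_const_nhds.congr fun n => ?_)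
    exact (hp4 (φ n) s).symm
  · refine tendsto_nhds_unique ((e1.tendsto q).comp hq) ?_
    rw [tendsto_iff_dist_tendsto_zero]
    exact squeeze_zero (fun _ => dist_nonneg) (fun n => (hp2 (φ n)).le) hlim'
  · refine tendsto_nhds_unique ((e2.tendsto q).comp hq) ?_
    rw [tendsto_iff_dist_tendsto_zero]
    exact squeeze_zero (fun _ => dist_nonneg) (fun n => (hp3 (φ n)).le) hlim'

theorem Good.R_of {ρ : M → M → ℝ} (hρ : Good ρ) {ξ ζ : M} (h : ρ ξ ζ = 0) (s : I) :
    R ρ (ξ.1 s) (ζ.1 s) :=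
  hρ.limit fun ε hε => ⟨ξ, ζ, s, by rw [h]; exact hε, by simpa using hε, by simpa using hε⟩

theorem Good.R_symm {ρ : M → M → ℝ} (hρ : Good ρ) {x y : ℝ} (h : R ρ x y) : R ρ y x := by
  obtain ⟨u, v, h1, h2, s, h3, h4⟩ := h
  exact ⟨v, u, by rw [hρ.symm, h1], fun s => by rw [add_comm, h2], s, h4, h3⟩

theorem R_mem {ρ : M → M → ℝ} {x y : ℝ} (h : R ρ x y) : y ∈ Set.Icc (0:ℝ) 1 := by
  obtain ⟨u, v, h1, h2, s, h3, h4⟩ := h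
  rw [← h4]
  exact (v.1 s).2

theorem Good.R_refl {ρ : M → M → ℝ} (hρ : Good ρ) {x : ℝ} (h : x ∈ Set.Icc (0:ℝ) 1) : R ρ x x :=
  hρ.R_of (hρ.refl idM) ⟨x, h⟩

theorem Good.R_closed {ρ : M → M → ℝ} (hρ : Good ρ) (x : ℝ) : IsClosed {y | R ρ x y} := by
  apply isClosed_of_closure_subset
  intro y hy
  apply hρ.limit
  intro ε hε
  obtain ⟨z, ⟨u, v, h1, h2, s, h3, h4⟩, hz⟩ := Metric.mem_closure_iff.1 hy ε hε
  refine ⟨u, v, s, by rw [h1]; exact hε, by rw [h3]; simpa using hε, ?_⟩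
  rw [h4, ← Real.dist_eq, dist_comm]
  exact hz

theorem Good.near {ρ : M → M → ℝ} (hρ : Good ρ) (ξ : M) {ε : ℝ} (hε : 0 < ε) :
    ∃ δ > 0, ∀ χ : M, dist χ ξ < δ → ρ χ ξ < ε := by
  have h1 : Continuous fun χ : M => ρ χ ξ := hρ.cont.comp (continuous_id.prodMk continuous_const)
  have h2 : ∀ᶠ χ in 𝓝 ξ, ρ χ ξ < ε := by
    apply (h1.tendsto ξ).eventually_lt_const
    rw [hρ.refl]; exact hε
  obtain ⟨δ, hδ, h3⟩ := Metric.eventually_nhds_iff.1 h2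
  exact ⟨δ, hδ, fun χ h => h3 h⟩

theorem exists_strict {p q : I} (hp0 : 0 < (p : ℝ)) (hp1 : (p : ℝ) < 1) (hq0 : 0 < (q : ℝ))
    (hq1 : (q : ℝ) < 1) : ∃ e : M, StrictMono e.1 ∧ (e.1 p : ℝ) = q := by
  have hc : 0 < Real.logb p q := Real.logb_pos_of_base_lt_one hp0 hp1 hq0 hq1
  have hs : StrictMono (fun s : I => (s : ℝ) ^ (Real.logb p q)) := fun a b hab =>
    Real.rpow_lt_rpow a.2.1 hab hc
  refine ⟨mkM (fun s => (s : ℝ) ^ (Real.logb p q))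
    (continuous_subtype_val.rpow_const (fun _ => Or.inr hc.le)) hs.monotone ?_ ?_, ?_, ?_⟩
  · simp [Real.zero_rpow hc.ne']
  · simp
  · exact fun a b hab => hs hab
  · rw [mkM_val]
    exact Real.rpow_logb hp0 hp1.ne hq0

theorem Good.R_trans {ρ : M → M → ℝ} (hρ : Good ρ) {x y z : ℝ} (hxy : R ρ x y) (hyz : R ρ y z) :
    R ρ x z := by
  obtain ⟨u1, v1, h1, n1, p, hx, hy⟩ := id hxy
  obtain ⟨u2, v2, h2, n2, q, hy', hz⟩ := id hyz
  by_cases hp0 : p = 0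
  · rw [hp0, M_zero] at hx hy
    rwa [← hx, hy]
  by_cases hp1 : p = 1
  · rw [hp1, M_one] at hx hy
    rwa [← hx, hy]
  by_cases hq0 : q = 0
  · rw [hq0, M_zero] at hy' hz
    rwa [← hz, hy']
  by_cases hq1 : q = 1
  · rw [hq1, M_one] at hy' hz
    rwa [← hz, hy']
  obtain ⟨e, he, hepq⟩ := exists_strict (unitInterval.coe_pos.2 (unitInterval.pos_iff_ne_zero.2 hp0))
    (unitInterval.coe_lt_one.2 (unitInterval.lt_one_iff_ne_one.2 hp1))
    (unitInterval.coe_pos.2 (unitInterval.pos_iff_ne_zero.2 hq0))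
    (unitInterval.coe_lt_one.2 (unitInterval.lt_one_iff_ne_one.2 hq1))
  apply hρ.limit
  intro ε hε
  obtain ⟨δ1, hδ1, H1⟩ := hρ.near v1 (half_pos hε)
  obtain ⟨δ2, hδ2, H2⟩ := hρ.near u2 (half_pos hε)
  obtain ⟨t, ht0, ht⟩ := exists_between (lt_min (lt_min hδ1 hδ2) one_pos)
  have ht1 : t < δ1 := ht.trans_le ((min_le_left _ _).trans (min_le_left _ _))
  have ht2 : t < δ2 := ht.trans_le ((min_le_left _ _).trans (min_le_right _ _))
  have ht3 : t ≤ 1 := (ht.trans_le (min_le_right _ _)).le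
  have A1 := H1 (mix t ht0.le ht3 v1 e) ((mix_dist _ _ _ _ _).trans_lt ht1)
  have A2 := H2 (mix t ht0.le ht3 u2 idM) ((mix_dist _ _ _ _ _).trans_lt ht2)
  set w1 := mix t ht0.le ht3 v1 e with hw1
  set w2 := mix t ht0.le ht3 u2 idM with hw2
  have sw2 : StrictMono w2.1 := mix_strict _ ht0 _ _ _ (fun _ _ h => h)
  let g := homeo w2 sw2
  let k : M := ⟨⟨fun s => g.symm (w1.1 s), g.symm.continuous.comp w1.1.continuous⟩,
    (homeo_symm_mono w2 sw2).comp w1.2.1, g.symm.surjective.comp w1.2.2⟩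
  have hk : cM w2 k = w1 := by
    apply M_ext
    intro s
    exact congrArg Subtype.val (g.apply_symm_apply (w1.1 s))
  have hkp : k.1 p = q := by
    change g.symm (w1.1 p) = q
    rw [Homeomorph.symm_apply_eq]
    apply Subtype.ext
    change (w1.1 p : ℝ) = w2.1 q
    rw [hw1, hw2, mix_val, mix_val, hy, hy', hepq, idM_val]
  refine ⟨u1, cM v2 k, p, ?_, by rw [hx]; simpa using hε, by rw [cM_val, hkp, hz]; simpa using hε⟩
  have B1 := hρ.tri u1 v1 (cM v2 k)
  have B2 := hρ.tri v1 w1 (cM v2 k)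
  have B3 := hρ.tri w1 (cM u2 k) (cM v2 k)
  rw [hρ.inv_M u2 v2 k, h2, ← hk, hρ.inv_M w2 u2 k, hk] at B3
  rw [hρ.symm v1 w1] at B2
  linarith

theorem Good.collapse {ρ : M → M → ℝ} (hρ : Good ρ) {a b : ℝ} (hab : a < b) (hR : R ρ a b)
    (hb : ∀ y, R ρ a y → y ≤ b) (e : M) (he : ∀ s : I, ((s:ℝ) ≤ a ∨ b ≤ s) → (e.1 s : ℝ) = s) :
    ρ idM e = 0 := by
  have hb01 := R_mem hR
  obtain ⟨u, v, h, n, s0, hu0, hv0⟩ := id hR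
  obtain ⟨s1, hu1⟩ := M_surj u hb01.1 hb01.2
  have h01 : s0 ≤ s1 := by
    by_contra hc
    have := M_mono u (not_le.1 hc).le
    linarith
  have hv1 : (v.1 s1 : ℝ) = b := by
    apply le_antisymm
    · apply hb
      apply hρ.R_trans hR
      have := hρ.R_of h s1
      rwa [hu1] at this
    · rw [← hv0]; exact M_mono v h01
  have flat : ∀ s, s0 ≤ s → s ≤ s1 → (v.1 s : ℝ) = b := fun s i j =>
    le_antisymm (hv1 ▸ M_mono v j) (hv0 ▸ M_mono v i)
  have ea : (e.1 (u.1 s0) : ℝ) = a := by rw [he _ (Or.inl hu0.le), hu0]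
  have eb : (e.1 (u.1 s1) : ℝ) = b := by rw [he _ (Or.inr hu1.ge), hu1]
  let k : M := mkM (fun s => ((e.1 (u.1 s) : ℝ) + v.1 s) / 2)
    (((M_cont (cM e u)).add (M_cont v)).div_const 2)
    (fun s t hst => by
      have := M_mono (cM e u) hst
      have := M_mono v hst
      simp only [cM_val] at *
      linarith)
    (by simp [M_zero]) (by simp [M_one])
  have hk : ∀ s, (k.1 s : ℝ) = ((e.1 (u.1 s) : ℝ) + v.1 s) / 2 := fun s => rfl
  have key : ∀ s, (u.1 (k.1 s) : ℝ) = e.1 (u.1 s) ∧ (v.1 (k.1 s) : ℝ) = v.1 s := by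
    intro s
    by_cases hs : (u.1 s : ℝ) ≤ a ∨ b ≤ u.1 s
    · have h1 := he _ hs
      have : k.1 s = s := by
        apply Subtype.ext
        rw [hk, h1, n]; ring
      rw [this, h1]
      exact ⟨rfl, rfl⟩
    · push Not at hs
      have i : s0 ≤ s := by
        by_contra hc
        have := M_mono u (not_le.1 hc).le
        linarith
      have j : s ≤ s1 := by
        by_contra hc
        have := M_mono u (not_le.1 hc).le
        linarith
      have f := flat s i j
      have l := M_mono (cM e u) i
      have r := M_mono (cM e u) j
      rw [cM_val, cM_val] at l r
      have n0 := n s0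
      have n1 := n s1
      have i' : s0 ≤ k.1 s := by
        change (s0 : ℝ) ≤ k.1 s
        rw [hk]; linarith
      have j' : k.1 s ≤ s1 := by
        change (k.1 s : ℝ) ≤ s1
        rw [hk]; linarith
      have f' := flat _ i' j'
      have n2 := n (k.1 s)
      rw [hk] at n2
      constructor <;> linarith
  have k1 : cM u k = cM e u := M_ext fun s => (key s).1
  have k2 : cM v k = v := M_ext fun s => (key s).2
  have h1 := hρ.inv_M idM e u
  have h2 : cM idM u = u := M_ext fun s => rfl
  have h3 := hρ.inv_M u v k
  rw [k1, k2, h, hρ.symm] at h3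
  have h4 := hρ.tri u v (cM e u)
  rw [h2] at h1
  have := hρ.nonneg idM e
  linarith

def Ur (ρ : M → M → ℝ) : Set ℝ := {t | ∃ x y, R ρ x y ∧ x < t ∧ t < y}

theorem Good.U_sub {ρ : M → M → ℝ} (hρ : Good ρ) : Urho ρ ⊆ Ur ρ := by
  rintro t ⟨α, β, ⟨h0, h1, h2, ξ, ζ, hz, hc⟩, hα, hβ⟩
  have hcl := (isPreconnected_closed_iff.1 (isPreconnected_univ (α := I)))
    {s | (ξ.1 s : ℝ) ≤ α} {s | β ≤ (ζ.1 s : ℝ)} (isClosed_le (M_cont ξ) continuous_const)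
    (isClosed_le continuous_const (M_cont ζ)) (fun s _ => hc s)
    ⟨0, trivial, by simpa [M_zero] using h0⟩ ⟨1, trivial, by simpa [M_one] using h2⟩
  obtain ⟨s, -, hs1, hs2⟩ := hcl
  exact ⟨_, _, hρ.R_of hz s, lt_of_le_of_lt hs1 hα, lt_of_lt_of_le hβ hs2⟩

theorem Good.component {ρ : M → M → ℝ} (hρ : Good ρ) {t : ℝ} (ht : t ∈ Ur ρ) :
    ∃ a b : ℝ, a < t ∧ t < b ∧ a ∉ Ur ρ ∧ b ∉ Ur ρ ∧ R ρ a b ∧ ∀ y, R ρ a y → y ≤ b := by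
  obtain ⟨x, y, hxy, hx, hy⟩ := ht
  have hcomp : IsCompact {y | R ρ x y} :=
    isCompact_Icc.of_isClosed_subset (hρ.R_closed x) (fun y h => R_mem h)
  have hne : {y | R ρ x y}.Nonempty := ⟨y, hxy⟩
  obtain ⟨a, ha, ha'⟩ := hcomp.exists_isLeast hne
  obtain ⟨b, hb, hb'⟩ := hcomp.exists_isGreatest hne
  have hab : R ρ a b := hρ.R_trans (hρ.R_symm ha) hb
  have hax : a ≤ x := ha' (hρ.R_refl (R_mem (hρ.R_symm hxy)))
  have hyb : y ≤ b := hb' hxy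
  refine ⟨a, b, by linarith, by linarith, ?_, ?_, hab, fun z hz => hb' (hρ.R_trans ha hz)⟩
  · rintro ⟨p, q, ⟨u, v, h, n, s, hp, hq⟩, h1, h2⟩
    obtain ⟨s', hs'⟩ := M_surj v (R_mem ha).1 (R_mem ha).2
    have hle : s' ≤ s := by
      by_contra hc
      have := M_mono v (not_le.1 hc).le
      linarith
    have := hρ.R_of h s'
    rw [hs'] at this
    have h3 := ha' (hρ.R_trans ha (hρ.R_symm this))
    have := M_mono u hle
    linarith
  · rintro ⟨p, q, ⟨u, v, h, n, s, hp, hq⟩, h1, h2⟩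
    obtain ⟨s', hs'⟩ := M_surj u (R_mem hb).1 (R_mem hb).2
    have hle : s ≤ s' := by
      by_contra hc
      have := M_mono u (not_le.1 hc).le
      linarith
    have := hρ.R_of h s'
    rw [hs'] at this
    have h3 := hb' (hρ.R_trans hb this)
    have := M_mono v hle
    linarith

theorem exists_piece (u : M) (A B : I) (hAB : A ≤ B) (hA : u.1 A = A) (hB : u.1 B = B) :
    ∃ g : M, (∀ s, s ≤ A → g.1 s = s) ∧ (∀ s, B ≤ s → g.1 s = s) ∧
      (∀ s, A ≤ s → s ≤ B → g.1 s = u.1 s) := by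
  let f : I → ℝ := fun s => ((min s A : I) : ℝ) + u.1 (max A (min s B)) - A + (max s B : I) - B
  have hf1 : ∀ s, s ≤ A → f s = s := fun s hs => by
    simp only [f]
    rw [min_eq_left hs, min_eq_left (hs.trans hAB), max_eq_left hs, max_eq_right (hs.trans hAB), hA]
    ring
  have hf2 : ∀ s, B ≤ s → f s = s := fun s hs => by
    simp only [f]
    rw [min_eq_right (hAB.trans hs), min_eq_right hs, max_eq_right hAB, max_eq_left hs, hB]
    ring
  have hf3 : ∀ s, A ≤ s → s ≤ B → f s = u.1 s := fun s h1 h2 => by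
    simp only [f]
    rw [min_eq_right h1, min_eq_left h2, max_eq_right h1, max_eq_right h2]
    ring
  have hc : Continuous f := by
    have := M_cont u
    have h2 : Continuous fun s : I => (u.1 (max A (min s B)) : ℝ) := this.comp (by fun_prop)
    simp only [f]
    fun_prop
  have hm : Monotone f := by
    intro s t hst
    have a1 : ((min s A : I) : ℝ) ≤ (min t A : I) := min_le_min_right A hst
    have a2 : ((max s B : I) : ℝ) ≤ (max t B : I) := max_le_max_right B hst
    have a3 : (u.1 (max A (min s B)) : ℝ) ≤ u.1 (max A (min t B)) :=
      M_mono u (max_le_max_left A (min_le_min_right B hst))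
    simp only [f]
    linarith
  refine ⟨mkM f hc hm (hf1 0 unitInterval.nonneg') (hf2 1 unitInterval.le_one'), ?_, ?_, ?_⟩
  · exact fun s h => Subtype.ext (hf1 s h)
  · exact fun s h => Subtype.ext (hf2 s h)
  · exact fun s h h' => Subtype.ext (hf3 s h h')

/-- same component -/
def C (ρ : M → M → ℝ) (p s : ℝ) : Prop := Set.uIcc p s ⊆ Ur ρ

theorem C_symm {ρ : M → M → ℝ} {p s : ℝ} (h : C ρ p s) : C ρ s p := by
  unfold C; rwa [Set.uIcc_comm]

theorem C_trans {ρ : M → M → ℝ} {p q s : ℝ} (h : C ρ p q) (h' : C ρ q s) : C ρ p s :=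
  Set.uIcc_subset_uIcc_union_uIcc.trans (Set.union_subset h h')

theorem C_iff {ρ : M → M → ℝ} {p a b s : ℝ} (h1 : a < p) (h2 : p < b) (ha : a ∉ Ur ρ)
    (hb : b ∉ Ur ρ) (hR : R ρ a b) : C ρ p s ↔ a < s ∧ s < b := by
  constructor
  · intro h
    constructor
    · by_contra hc
      exact ha (h (Set.mem_uIcc.2 (Or.inr ⟨not_lt.1 hc, h1.le⟩)))
    · by_contra hc
      exact hb (h (Set.mem_uIcc.2 (Or.inl ⟨h2.le, not_lt.1 hc⟩)))
  · rintro ⟨h3, h4⟩ x hx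
    rcases Set.mem_uIcc.1 hx with h | h
    · exact ⟨a, b, hR, by linarith, by linarith⟩
    · exact ⟨a, b, hR, by linarith, by linarith⟩

theorem Good.finite {ρ : M → M → ℝ} (hρ : Good ρ) (u : M)
    (hu : ∀ s : I, (s : ℝ) ∉ Ur ρ → u.1 s = s) (F : Finset I) :
    (∀ p ∈ F, (p : ℝ) ∈ Ur ρ) → ∃ f : M, ρ idM f = 0 ∧
      ∀ s : I, ((∃ p ∈ F, C ρ p s) → f.1 s = u.1 s) ∧ ((∀ p ∈ F, ¬ C ρ p s) → f.1 s = s) := by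
  classical
  induction F using Finset.induction_on with
  | empty => 
    intro _
    exact ⟨idM, hρ.refl _, fun s => ⟨by simp, fun _ => rfl⟩⟩
  | insert p F hpF ih =>
    intro hF
    obtain ⟨f, hf0, hf⟩ := ih (fun q hq => hF q (Finset.mem_insert_of_mem hq))
    by_cases hq : ∃ q ∈ F, C ρ q p
    · obtain ⟨q, hqF, hq⟩ := hq
      refine ⟨f, hf0, fun s => ⟨?_, fun h => (hf s).2 fun r hr =>
        h r (Finset.mem_insert_of_mem hr)⟩⟩
      rintro ⟨r, hr, hrs⟩
      rcases Finset.mem_insert.1 hr with rfl | hr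
      · exact (hf s).1 ⟨q, hqF, C_trans hq hrs⟩
      · exact (hf s).1 ⟨r, hr, hrs⟩
    · push Not at hq
      obtain ⟨a, b, hap, hpb, ha, hb, hR, hmax⟩ := hρ.component (hF p (Finset.mem_insert_self _ _))
      have hC := fun s => C_iff (s := s) hap hpb ha hb hR
      let A : I := ⟨a, R_mem (hρ.R_symm hR)⟩
      let B : I := ⟨b, R_mem hR⟩
      have hAB : A ≤ B := (hap.trans hpb).le
      have hA := hu A ha
      have hB := hu B hb
      obtain ⟨g, g1, g2, g3⟩ := exists_piece u A B hAB hA hB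
      have hg : ρ idM g = 0 := by
        apply hρ.collapse (hap.trans hpb) hR hmax
        rintro s (h | h)
        · rw [g1 s h]
        · rw [g2 s h]
      refine ⟨cM g f, ?_, ?_⟩
      · have h1 := hρ.inv_M idM g f
        have h2 : cM idM f = f := M_ext fun s => rfl
        rw [h2, hg] at h1
        have := hρ.tri idM f (cM g f)
        have := hρ.nonneg idM (cM g f)
        linarith
      · intro s
        rw [cM_val]
        by_cases hs : C ρ p s
        · refine ⟨fun _ => ?_, fun h => absurd hs (h p (Finset.mem_insert_self _ _))⟩
          have : f.1 s = s := (hf s).2 fun q hqF hqs => hq q hqF (C_trans hqs (C_symm hs))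
          rw [this]
          have h3 := (hC s).1 hs
          exact g3 s h3.1.le h3.2.le
        · have hout : s ≤ A ∨ B ≤ s := by
            by_contra hc
            push Not at hc
            exact hs ((hC s).2 hc)
          refine ⟨?_, fun h => ?_⟩
          · rintro ⟨r, hr, hrs⟩
            rcases Finset.mem_insert.1 hr with rfl | hr
            · exact absurd hrs hs
            · rw [(hf s).1 ⟨r, hr, hrs⟩]
              rcases hout with h | h
              · exact g1 _ ((u.2.1 h).trans hA.le)
              · exact g2 _ (hB.ge.trans (u.2.1 h))
          · rw [(hf s).2 fun r hr => h r (Finset.mem_insert_of_mem hr)]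
            rcases hout with h | h
            · exact g1 _ h
            · exact g2 _ h

theorem Good.main {ρ : M → M → ℝ} (hρ : Good ρ) (u : M)
    (hu : ∀ s : I, (s : ℝ) ∉ Ur ρ → u.1 s = s) : ρ idM u = 0 := by
  classical
  apply le_antisymm _ (hρ.nonneg _ _)
  apply le_of_forall_pos_le_add
  intro ε hε
  obtain ⟨δ, hδ, hnear⟩ := hρ.near u hε
  obtain ⟨T, -, hTfin, hT⟩ := (isCompact_univ (X := I)).finite_cover_balls
    (show 0 < δ / 4 by positivity)
  obtain ⟨f, hf0, hf⟩ := hρ.finite u hu (hTfin.toFinset.filter fun p => (p : ℝ) ∈ Ur ρ)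
    (fun p hp => (Finset.mem_filter.1 hp).2)
  have hd : dist f u ≤ δ / 2 := by
    apply M_dist_le (by positivity)
    intro s
    by_cases h : ∃ p ∈ (hTfin.toFinset.filter fun p : I => (p : ℝ) ∈ Ur ρ), C ρ (p : I) s
    · rw [(hf s).1 h]; simp; positivity
    · push Not at h
      rw [(hf s).2 h]
      by_cases hs : (s : ℝ) ∈ Ur ρ
      · obtain ⟨a, b, has, hsb, ha, hb, hR, -⟩ := hρ.component hs
        let A : I := ⟨a, R_mem (hρ.R_symm hR)⟩
        let B : I := ⟨b, R_mem hR⟩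
        let m : I := ⟨(a + b) / 2, by
          have := (R_mem (hρ.R_symm hR)).1; have := (R_mem hR).1; linarith, by
          have := (R_mem (hρ.R_symm hR)).2; have := (R_mem hR).2; linarith⟩
        have h1 : (A : ℝ) ≤ u.1 s := (congrArg Subtype.val (hu A ha)).ge.trans
          (M_mono u (show A ≤ s from has.le))
        have h2 : u.1 s ≤ (B : ℝ) := (M_mono u (show s ≤ B from hsb.le)).trans
          (congrArg Subtype.val (hu B hb)).le
        change a ≤ _ at h1
        change _ ≤ b at h2
        obtain ⟨p, hpT, hp⟩ := Set.mem_iUnion₂.1 (hT (Set.mem_univ m))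
        have hp' : |(a + b) / 2 - (p : ℝ)| < δ / 4 := hp
        have hpab : ¬ (a < p ∧ (p:ℝ) < b) := by
          intro hpp
          have hc := (C_iff has hsb ha hb hR).2 hpp
          exact h p (Finset.mem_filter.2 ⟨hTfin.mem_toFinset.2 hpT,
            hc (Set.right_mem_uIcc)⟩) (C_symm hc)
        rw [abs_lt] at hp'
        have hba : b - a < δ / 2 := by
          by_contra hc
          apply hpab
          constructor <;> linarith
        rw [abs_le]
        constructor <;> linarith
      · rw [hu s hs]; simp; positivity
  have := hnear f (by linarith)
  have := hρ.tri idM f u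
  linarith

theorem Good.final {ρ : M → M → ℝ} (hρ : Good ρ) (ξ ζ : M) : ρ ξ ζ = 0 ↔
      ∀ s : unitInterval, (ξ.1 s : ℝ) ≠ (ζ.1 s : ℝ) →
        ((ξ.1 s : ℝ) + (ζ.1 s : ℝ)) / 2 ∈ Urho ρ := by
  constructor
  · have key : ∀ ξ ζ : M, ρ ξ ζ = 0 → ∀ s : I, (ξ.1 s : ℝ) < ζ.1 s →
        ((ξ.1 s : ℝ) + (ζ.1 s : ℝ)) / 2 ∈ Urho ρ := by
      intro ξ ζ h s hlt
      refine ⟨ξ.1 s, ζ.1 s, ⟨(ξ.1 s).2.1, hlt, (ζ.1 s).2.2, ξ, ζ, h, fun t => ?_⟩, ?_, ?_⟩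
      · rcases le_total t s with h | h
        · exact Or.inl (M_mono ξ h)
        · exact Or.inr (M_mono ζ h)
      · linarith
      · linarith
    intro h s hne
    rcases lt_or_gt_of_ne hne with hlt | hlt
    · exact key ξ ζ h s hlt
    · rw [add_comm]
      exact key ζ ξ (by rw [hρ.symm, h]) s hlt
  · intro h
    obtain ⟨u, v, m, rfl, rfl, n, hm⟩ := normalize ξ ζ
    have key : ∀ s : I, (s : ℝ) ∉ Ur ρ → u.1 s = s ∧ v.1 s = s := by
      intro s hs
      obtain ⟨r, rfl⟩ := m.2.2 s
      have heq : (u.1 (m.1 r) : ℝ) = v.1 (m.1 r) := by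
        by_contra hne
        apply hs
        apply hρ.U_sub
        rw [hm r]
        exact h r hne
      have := n (m.1 r)
      constructor
      · apply Subtype.ext; linarith
      · apply Subtype.ext; linarith
    have h1 := hρ.main u fun s hs => (key s hs).1
    have h2 := hρ.main v fun s hs => (key s hs).2
    rw [hρ.inv_M]
    apply le_antisymm _ (hρ.nonneg _ _)
    have := hρ.tri u idM v
    rw [hρ.symm u idM, h1, h2] at this
    linarith

end GapAux

/-- Characterisation of the kernel of a continuous `Homeo⁺[0,1]`-invariant pseudometric
`ρ` on `𝔐`: `ρ(ξ,ζ) = 0` iff wherever `ξ(s) ≠ ζ(s)`, the midpoint lies in `U_ρ`. -/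
theorem stmt_16
    (ρ : M → M → ℝ)
    (hrefl : ∀ ξ : M, ρ ξ ξ = 0)
    (hsymm : ∀ ξ ζ : M, ρ ξ ζ = ρ ζ ξ)
    (htri : ∀ ξ ζ χ : M, ρ ξ χ ≤ ρ ξ ζ + ρ ζ χ)
    (hcont : Continuous fun p : M × M => ρ p.1 p.2)
    (hinv : ∀ (ξ ζ : M) (g : unitInterval ≃ₜ unitInterval) (hg : Monotone ⇑g),
      ρ (Mcomp ξ g hg) (Mcomp ζ g hg) = ρ ξ ζ) :
    ∀ ξ ζ : M, ρ ξ ζ = 0 ↔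
      ∀ s : unitInterval, (ξ.1 s : ℝ) ≠ (ζ.1 s : ℝ) →
        ((ξ.1 s : ℝ) + (ζ.1 s : ℝ)) / 2 ∈ Urho ρ := by
  exact GapAux.Good.final ⟨hrefl, hsymm, htri, hcont, hinv⟩
end
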